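/- arXiv:0809.0645 — 3 statements merged into one kernel-verified Lean document; each statement's English description precedes it below -/
import Mathlib

section
/- The central quotient G = B₄/⟨z⟩, where z = (bac)⁴, has property RD with respect to the word length associated to the images of the generators a, b, c. -/
/-- Convolution of finitely supported complex functions on a group:
`(f * g)(x) = ∑_y f(y) g(y⁻¹x)`. -/
noncomputable def conv {Γ : Type*} [Group Γ] (f g : Γ →₀ ℂ) : Γ →₀ ℂ :=
  f.sum fun y cy => g.sum fun z cz => Finsupp.single (y * z) (cy * cz)

/-- The ℓ² norm of a finitely supported complex function. -/
noncomputable def l2norm {Γ : Type*} (f : Γ →₀ ℂ) : ℝ :=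
  Real.sqrt (f.sum fun _ c => ‖c‖ ^ 2)

/-- Property RD of a group with respect to a length function `ℓ`. -/
def HasPropertyRD (Γ : Type*) [Group Γ] (ℓ : Γ → ℝ) : Prop :=
  ∃ P : Polynomial ℝ, ∀ r : ℝ, 0 ≤ r → ∀ f g : Γ →₀ ℂ,
    (∀ x : Γ, f x ≠ 0 → ℓ x ≤ r) →
    l2norm (conv f g) ≤ P.eval r * l2norm f * l2norm g

/-- The word length with respect to a generating set `S` (using `S ∪ S⁻¹`). -/
noncomputable def wordLength {Γ : Type*} [Group Γ] (S : Set Γ) (x : Γ) : ℕ :=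
  sInf {n : ℕ | ∃ w : List Γ, w.length = n ∧ (∀ s ∈ w, s ∈ S ∨ s⁻¹ ∈ S) ∧ w.prod = x}

/-- The braid relations of `B₄ = ⟨a,b,c ∣ aba=bab, bcb=cbc, ac=ca⟩`. -/
def braidRels4 : Set (FreeGroup (Fin 3)) :=
  { FreeGroup.of 0 * FreeGroup.of 1 * FreeGroup.of 0 *
      (FreeGroup.of 1 * FreeGroup.of 0 * FreeGroup.of 1)⁻¹,
    FreeGroup.of 1 * FreeGroup.of 2 * FreeGroup.of 1 *
      (FreeGroup.of 2 * FreeGroup.of 1 * FreeGroup.of 2)⁻¹,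
    FreeGroup.of 0 * FreeGroup.of 2 * (FreeGroup.of 2 * FreeGroup.of 0)⁻¹ }

/-- The braid group on 4 strings. -/
abbrev B4 : Type := PresentedGroup braidRels4

def a : B4 := PresentedGroup.of 0
def b : B4 := PresentedGroup.of 1
def c : B4 := PresentedGroup.of 2

/-- The central element `z = (bac)⁴` of `B₄`. -/
def z : B4 := (b * a * c) ^ 4

/-- The central quotient `G = B₄/⟨z⟩`. -/
abbrev G : Type := B4 ⧸ Subgroup.normalClosure ({z} : Set B4)

/-- The quotient map `B₄ → G`. -/
noncomputable def π : B4 →* G := QuotientGroup.mk' _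

/-! ### The dual braid monoid on four strings -/

namespace DualBraid

/-- The atoms of the dual braid monoid: `0, 1, 2, 3` are the sides of a square, in cyclic order,
and `4, 5` are its diagonals. -/
abbrev Atom : Type := Fin 6

/-- The simple element of rank two represented by the product of two atoms, if there is one. -/
def simpleTwo : Atom → Atom → Option (Fin 6)
  | 0, 1 | 1, 4 | 4, 0 => some 0
  | 1, 2 | 2, 5 | 5, 1 => some 1
  | 2, 3 | 3, 4 | 4, 2 => some 2
  | 3, 0 | 0, 5 | 5, 3 => some 3
  | 0, 2 | 2, 0 => some 4
  | 1, 3 | 3, 1 => some 5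
  | _, _ => none

/-- The defining relations of the dual braid monoid. -/
def Rel (x y x' y' : Atom) : Prop :=
  (simpleTwo x y).isSome ∧ simpleTwo x y = simpleTwo x' y'

instance (x y x' y' : Atom) : Decidable (Rel x y x' y') :=
  inferInstanceAs (Decidable (_ ∧ _))

/-- Two words are equivalent if they represent the same element of the dual braid monoid. -/
inductive Equivalent : List Atom → List Atom → Prop
  | refl (u) : Equivalent u u
  | symm {u v} : Equivalent u v → Equivalent v u
  | trans {u v w} : Equivalent u v → Equivalent v w → Equivalent u w
  | cons (x) {u v} : Equivalent u v → Equivalent (x :: u) (x :: v)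
  | rel {x y x' y'} (w) : Rel x y x' y' → Equivalent (x :: y :: w) (x' :: y' :: w)

namespace Equivalent

theorem length_eq {u v : List Atom} (h : Equivalent u v) : u.length = v.length := by
  induction h with
  | refl => rfl
  | symm _ ih => exact ih.symm
  | trans _ _ ih₁ ih₂ => exact ih₁.trans ih₂
  | cons _ _ ih => simp [ih]
  | rel => simp

theorem append_left (s : List Atom) {u v : List Atom} (h : Equivalent u v) :
    Equivalent (s ++ u) (s ++ v) := by
  induction s with
  | nil => exact h
  | cons x s ih => exact ih.cons x

theorem append_right {u v : List Atom} (h : Equivalent u v) (s : List Atom) :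
    Equivalent (u ++ s) (v ++ s) := by
  induction h with
  | refl => exact refl _
  | symm _ ih => exact ih.symm
  | trans _ _ ih₁ ih₂ => exact ih₁.trans ih₂
  | cons x _ ih => exact ih.cons x
  | rel w h => exact rel (w ++ s) h

end Equivalent

/-- `x` followed by `complement x y` is the least common right multiple of `x` and `y`. -/
def complement (x y : Atom) : List Atom :=
  if x = y then [] else
    match (List.finRange 6).find? fun t => decide (∃ t', Rel x t y t') with
    | some t => [t]
    | none => if x = 4 then [0, 2] else [1, 3]

/-- Word reversing: computes words `p, q` such that `s ++ p` and `t ++ q` represent the least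
common right multiple of `s` and `t`. The first argument bounds the recursion depth. -/
def reversing : ℕ → List Atom → List Atom → Option (List Atom × List Atom)
  | _, [], t => some (t, [])
  | _, x :: s, [] => some ([], x :: s)
  | 0, _ :: _, _ :: _ => none
  | n + 1, x :: s, y :: t =>
    (reversing n s (complement x y)).bind fun p =>
      (reversing n (complement y x ++ p.2) t).map fun q => (p.1 ++ q.1, q.2)

/-- Words `u, v` for which `x :: u` and `y :: v` are visibly equivalent to a common multiple of
the least common multiple of `x` and `y`. -/
def HasLcm (x : Atom) (u : List Atom) (y : Atom) (v : List Atom) : Prop :=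
  ∃ w, Equivalent u (complement x y ++ w) ∧ Equivalent v (complement y x ++ w)

theorem HasLcm.symm {x y : Atom} {u v : List Atom} (h : HasLcm x u y v) : HasLcm y v x u :=
  let ⟨w, h₁, h₂⟩ := h
  ⟨w, h₂, h₁⟩

theorem complement_self (x : Atom) : complement x x = [] := by
  simp [complement]

theorem complement_of_rel {x y x' y' : Atom} (h : Rel x y x' y') :
    (complement x x' = [] ∧ complement x' x = [] ∧ y = y') ∨
      (complement x x' = [y] ∧ complement x' x = [y']) := by
  revert x y x' y'
  decide

/-- Equivalence of words of length at most two, in a decidable form. -/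
def ShortEquivalent (u v : List Atom) : Prop :=
  u = v ∨ match u, v with
    | [x, y], [x', y'] => Rel x y x' y'
    | _, _ => False

instance (u v : List Atom) : Decidable (ShortEquivalent u v) := by
  unfold ShortEquivalent
  split <;> infer_instance

theorem ShortEquivalent.equivalent {u v : List Atom} (h : ShortEquivalent u v) :
    Equivalent u v := by
  unfold ShortEquivalent at h
  split at h
  · rcases h with h | h
    · exact h ▸ .refl _
    · exact .rel [] h
  · rcases h with h | h
    · exact h ▸ .refl _
    · exact h.elim

/-- The cube condition for the atoms `x, y, z`. -/
def Cube (x y z : Atom) : Prop :=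
  match reversing 5 (complement z x) (complement z y) with
  | none => False
  | some p =>
    match reversing 5 (complement x y) (complement x z ++ p.1) with
    | none => False
    | some q => ShortEquivalent (complement x z ++ p.1) (complement x y ++ q.1) ∧
        ShortEquivalent (complement y z ++ p.2) (complement y x ++ q.1)

instance (x y z : Atom) : Decidable (Cube x y z) := by
  unfold Cube
  split
  · infer_instance
  · split <;> infer_instance

set_option maxRecDepth 20000 in
theorem cube (x y z : Atom) : Cube x y z := by
  revert x y z
  decide +kernel

theorem reversing_sound {N : ℕ}
    (key : ∀ x u y v, (x :: u).length ≤ N → Equivalent (x :: u) (y :: v) → HasLcm x u y v)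
    (n : ℕ) (s t p q w₁ w₂ : List Atom) (hr : reversing n s t = some (p, q))
    (hN : (s ++ w₁).length ≤ N) (h : Equivalent (s ++ w₁) (t ++ w₂)) :
    ∃ w, Equivalent w₁ (p ++ w) ∧ Equivalent w₂ (q ++ w) := by
  induction n generalizing s t p q w₁ w₂ with
  | zero =>
    match s, t with
    | [], t =>
      simp only [reversing, Option.some.injEq, Prod.mk.injEq] at hr
      obtain ⟨rfl, rfl⟩ := hr
      exact ⟨w₂, h, .refl _⟩
    | x :: s, [] =>
      simp only [reversing, Option.some.injEq, Prod.mk.injEq] at hr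
      obtain ⟨rfl, rfl⟩ := hr
      exact ⟨w₁, .refl _, h.symm⟩
    | x :: s, y :: t => simp [reversing] at hr
  | succ n ih =>
    match s, t with
    | [], t =>
      simp only [reversing, Option.some.injEq, Prod.mk.injEq] at hr
      obtain ⟨rfl, rfl⟩ := hr
      exact ⟨w₂, h, .refl _⟩
    | x :: s, [] =>
      simp only [reversing, Option.some.injEq, Prod.mk.injEq] at hr
      obtain ⟨rfl, rfl⟩ := hr
      exact ⟨w₁, .refl _, h.symm⟩
    | x :: s, y :: t =>
      simp only [reversing, Option.bind_eq_some_iff, Option.map_eq_some_iff, Prod.mk.injEq] at hr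
      obtain ⟨⟨p₁, p₂⟩, hp, ⟨q₁, q₂⟩, hq, rfl, rfl⟩ := hr
      obtain ⟨w', h₁, h₂⟩ := key _ _ _ _ hN h
      have hlen := h.length_eq
      have hlen₂ := h₂.length_eq
      simp only [List.cons_append, List.length_cons, List.length_append] at hlen hlen₂ hN
      obtain ⟨w'', h₃, h₄⟩ := ih _ _ _ _ _ _ hp (by simp; lia) h₁
      have h₅ : Equivalent ((complement y x ++ p₂) ++ w'') (t ++ w₂) := by
        rw [List.append_assoc]
        exact (h₂.trans (h₄.append_left _)).symm
      have hlen₅ := h₅.length_eq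
      obtain ⟨w, h₆, h₇⟩ := ih _ _ _ _ _ _ hq (by simp at hlen₅ ⊢; lia) h₅
      refine ⟨w, ?_, h₇⟩
      rw [List.append_assoc]
      exact h₃.trans (h₆.append_left _)

/-- Garside's key lemma: two atoms dividing the same element have their least common multiple
dividing it as well. -/
theorem hasLcm_of_equivalent {x y : Atom} {u v : List Atom}
    (h : Equivalent (x :: u) (y :: v)) : HasLcm x u y v := by
  suffices H : ∀ N, ∀ x u y v, (x :: u).length ≤ N → Equivalent (x :: u) (y :: v) →
      HasLcm x u y v from H _ x u y v le_rfl h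
  clear h x y u v
  intro N
  induction N with
  | zero => intro x u y v h; simp at h
  | succ N key =>
    intro x u y v hN h
    generalize hs : x :: u = s at h hN
    generalize ht : y :: v = t at h
    induction h generalizing x u y v with
    | refl s =>
      obtain ⟨rfl, rfl⟩ := List.cons.inj (hs.trans ht.symm)
      exact ⟨u, by simp [complement_self, Equivalent.refl],
        by simp [complement_self, Equivalent.refl]⟩
    | symm h ih => exact (ih _ _ _ _ ht (h.length_eq ▸ hN) hs).symm
    | cons z h ih =>
      obtain ⟨rfl, rfl⟩ := List.cons.inj hs
      obtain ⟨rfl, rfl⟩ := List.cons.inj ht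
      exact ⟨v, by simpa [complement_self] using h, by simp [complement_self, Equivalent.refl]⟩
    | rel w h =>
      obtain ⟨rfl, rfl⟩ := List.cons.inj hs
      obtain ⟨rfl, rfl⟩ := List.cons.inj ht
      rcases complement_of_rel h with ⟨h₁, h₂, rfl⟩ | ⟨h₁, h₂⟩
      · exact ⟨_, by simpa [h₁] using .refl _, by simpa [h₂] using .refl _⟩
      · exact ⟨w, by simpa [h₁] using .refl _, by simpa [h₂] using .refl _⟩
    | @trans s m t h₁ h₂ ih₁ ih₂ =>
      match m with
      | [] => simpa [← hs] using h₁.length_eq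
      | z :: w =>
        have hlen := h₁.length_eq
        obtain ⟨w₁, hu, hw₁⟩ := ih₁ _ _ _ _ hs hN rfl
        obtain ⟨w₂, hw₂, hv⟩ := ih₂ _ _ _ _ rfl (hlen ▸ hN) ht
        have hcube := cube x y z
        unfold Cube at hcube
        split at hcube
        · exact hcube.elim
        · next p hp =>
          split at hcube
          · exact hcube.elim
          · next q hq =>
            obtain ⟨hx, hy⟩ := hcube
            have hlen₁ := hw₁.length_eq
            obtain ⟨w₃, h₃, h₄⟩ := reversing_sound key _ _ _ _ _ _ _ hp
              (by simp only [List.length_cons] at hlen; lia) (hw₁.symm.trans hw₂)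
            refine ⟨q.1 ++ w₃, ?_, ?_⟩
            · refine hu.trans ((h₃.append_left _).trans ?_)
              simpa only [List.append_assoc] using hx.equivalent.append_right w₃
            · refine hv.trans ((h₄.append_left _).trans ?_)
              simpa only [List.append_assoc] using hy.equivalent.append_right w₃

end DualBraid
/-! ### The dual braid monoid embeds in the braid group -/

namespace DualBraid

/-- Equivalence of words, as a congruence on the free monoid. -/
def equivalentCon : Con (FreeMonoid Atom) where
  r u v := Equivalent u.toList v.toList
  iseqv := ⟨fun _ => .refl _, .symm, .trans⟩
  mul' h₁ h₂ := (h₁.append_right _).trans (h₂.append_left _)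

/-- The dual braid monoid. -/
abbrev DualMonoid : Type := equivalentCon.Quotient

/-- The element of the dual braid monoid represented by a word. -/
def ofWord (u : List Atom) : DualMonoid := equivalentCon.mk' (FreeMonoid.ofList u)

theorem ofWord_eq_iff {u v : List Atom} : ofWord u = ofWord v ↔ Equivalent u v :=
  equivalentCon.eq

theorem ofWord_surjective : Function.Surjective ofWord :=
  equivalentCon.mk'_surjective

theorem ofWord_append (u v : List Atom) : ofWord (u ++ v) = ofWord u * ofWord v :=
  map_mul equivalentCon.mk' (FreeMonoid.ofList u) (FreeMonoid.ofList v)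

theorem ofWord_cons (x : Atom) (u : List Atom) : ofWord (x :: u) = ofWord [x] * ofWord u :=
  ofWord_append [x] u

theorem ofWord_nil : ofWord [] = 1 := rfl

theorem mul_eq_mul_of_rel {x y x' y' : Atom} (h : Rel x y x' y') :
    ofWord [x] * ofWord [y] = ofWord [x'] * ofWord [y'] := by
  rw [← ofWord_append, ← ofWord_append]
  exact ofWord_eq_iff.2 (.rel [] h)

instance : IsLeftCancelMul DualMonoid where
  mul_left_cancel p q r h := by
    obtain ⟨s, rfl⟩ := ofWord_surjective p
    obtain ⟨u, rfl⟩ := ofWord_surjective q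
    obtain ⟨v, rfl⟩ := ofWord_surjective r
    simp only [← ofWord_append, ofWord_eq_iff] at h ⊢
    induction s with
    | nil => exact h
    | cons x s ih =>
      obtain ⟨w, h₁, h₂⟩ := hasLcm_of_equivalent h
      rw [complement_self] at h₁ h₂
      exact ih (h₁.trans h₂.symm)

/-- The Garside element of the dual braid monoid. -/
def garside : DualMonoid := ofWord [0] * ofWord [1] * ofWord [2]

/-- The permutation of the atoms induced by conjugation with the Garside element. -/
def rotate : Atom → Atom := ![1, 2, 3, 0, 5, 4]

theorem garside_eq_of_side :
    ∀ x : Atom, x ≤ 3 →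
      garside = ofWord [x] * (ofWord [rotate x] * ofWord [rotate (rotate x)]) := by
  have h₁ : garside = ofWord [1] * (ofWord [2] * ofWord [3]) := by
    rw [garside, mul_eq_mul_of_rel (show Rel 0 1 1 4 by decide), mul_assoc,
      mul_eq_mul_of_rel (show Rel 4 2 2 3 by decide)]
  have h₂ : garside = ofWord [2] * (ofWord [3] * ofWord [0]) := by
    rw [h₁, ← mul_assoc, mul_eq_mul_of_rel (show Rel 1 2 2 5 by decide), mul_assoc,
      mul_eq_mul_of_rel (show Rel 5 3 3 0 by decide)]
  have h₃ : garside = ofWord [3] * (ofWord [0] * ofWord [1]) := by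
    rw [h₂, ← mul_assoc, mul_eq_mul_of_rel (show Rel 2 3 3 4 by decide), mul_assoc,
      mul_eq_mul_of_rel (show Rel 4 0 0 1 by decide)]
  intro x hx
  fin_cases x
  · rw [garside, mul_assoc]; rfl
  · exact h₁
  · exact h₂
  · exact h₃
  · exact absurd hx (by decide)
  · exact absurd hx (by decide)

theorem garside_eq_four : garside = ofWord [4] * (ofWord [0] * ofWord [2]) := by
  rw [garside, mul_eq_mul_of_rel (show Rel 0 1 4 0 by decide), mul_assoc]

theorem garside_eq_five : garside = ofWord [5] * (ofWord [1] * ofWord [3]) := by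
  rw [garside_eq_of_side 1 (by decide), ← mul_assoc]
  change ofWord [1] * ofWord [2] * ofWord [3] = _
  rw [mul_eq_mul_of_rel (show Rel 1 2 5 1 by decide), mul_assoc]

/-- Every atom is a left divisor of the Garside element. -/
theorem exists_garside_eq (x : Atom) : ∃ y y' : Atom, garside = ofWord [x] * ofWord [y, y'] := by
  by_cases hx : x ≤ 3
  · exact ⟨rotate x, rotate (rotate x), by
      rw [garside_eq_of_side x hx, ← ofWord_append]; rfl⟩
  · obtain rfl | rfl : x = 4 ∨ x = 5 := by revert hx; revert x; decide
    · exact ⟨0, 2, by rw [garside_eq_four, ← ofWord_append]; rfl⟩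
    · exact ⟨1, 3, by rw [garside_eq_five, ← ofWord_append]; rfl⟩

theorem garside_mul (x : Atom) : garside * ofWord [x] = ofWord [rotate x] * garside := by
  by_cases hx : x ≤ 3
  · have h : rotate (rotate (rotate (rotate x))) = x := by revert x; decide
    have hx' : rotate x ≤ 3 := by revert x; decide
    have hx'' : rotate (rotate x) ≤ 3 := by revert x; decide
    conv_lhs => rw [garside_eq_of_side _ hx']
    conv_rhs => rw [garside_eq_of_side _ hx'', h]
    simp only [mul_assoc]
  · obtain rfl | rfl : x = 4 ∨ x = 5 := by revert hx; revert x; decide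
    · conv_rhs => rw [garside_eq_four]
      rw [garside_eq_five]
      change _ = ofWord [5] * _
      rw [mul_eq_mul_of_rel (show Rel 1 3 3 1 by decide)]
      simp only [mul_assoc]
      rw [mul_eq_mul_of_rel (show Rel 1 4 4 0 by decide), ← mul_assoc (ofWord [3]),
        mul_eq_mul_of_rel (show Rel 3 4 4 2 by decide), mul_assoc,
        mul_eq_mul_of_rel (show Rel 2 0 0 2 by decide)]
    · conv_rhs => rw [garside_eq_five]
      rw [garside_eq_four]
      change _ = ofWord [4] * _
      simp only [mul_assoc]
      rw [mul_eq_mul_of_rel (show Rel 2 5 5 1 by decide), ← mul_assoc (ofWord [0]),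
        mul_eq_mul_of_rel (show Rel 0 5 5 3 by decide), mul_assoc,
        mul_eq_mul_of_rel (show Rel 3 1 1 3 by decide)]

theorem garside_pow_four_comm (p : DualMonoid) : p * garside ^ 4 = garside ^ 4 * p := by
  obtain ⟨u, rfl⟩ := ofWord_surjective p
  induction u with
  | nil => simp [ofWord_nil]
  | cons x u ih =>
    have h : rotate (rotate (rotate (rotate x))) = x := by revert x; decide
    have hx : SemiconjBy (garside * garside * (garside * garside)) (ofWord [x]) (ofWord [x]) := by
      have hs (y : Atom) : SemiconjBy garside (ofWord [y]) (ofWord [rotate y]) := garside_mul y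
      have h₂ (y : Atom) := (hs (rotate y)).mul_left (hs y)
      simpa only [h] using (h₂ (rotate (rotate x))).mul_left (h₂ x)
    have hx' : garside ^ 4 * ofWord [x] = ofWord [x] * garside ^ 4 := by
      simpa only [SemiconjBy, pow_succ, pow_zero, one_mul, mul_assoc] using hx
    rw [ofWord_cons, mul_assoc, ih, ← mul_assoc, ← mul_assoc, hx']

/-- The powers of the central element. -/
def centralPowers : Submonoid DualMonoid := Submonoid.powers (garside ^ 4)

theorem mul_comm_of_mem_centralPowers (p : DualMonoid) (s : centralPowers) :
    (s : DualMonoid) * p = p * s := by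
  obtain ⟨_, n, rfl⟩ := s
  exact (Commute.pow_right (garside_pow_four_comm p) n).symm

instance : OreLocalization.OreSet centralPowers where
  ore_right_cancel p q s h := ⟨s, by
    rwa [mul_comm_of_mem_centralPowers, mul_comm_of_mem_centralPowers]⟩
  oreNum p _ := p
  oreDenom _ s := s
  ore_eq p s := mul_comm_of_mem_centralPowers p s

/-- The monoid of fractions of the dual braid monoid. -/
abbrev Fractions : Type := OreLocalization centralPowers DualMonoid

/-- The embedding of the dual braid monoid in its monoid of fractions. -/
def toFractions : DualMonoid →* Fractions := OreLocalization.numeratorHom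

theorem toFractions_injective : Function.Injective toFractions := by
  intro p q h
  obtain ⟨s, t, h₁, h₂⟩ := OreLocalization.oreDiv_eq_iff.1 h
  obtain rfl : (s : DualMonoid) = t := by simpa using h₂
  exact (mul_left_cancel h₁).symm

theorem isUnit_toFractions (x : Atom) : IsUnit (toFractions (ofWord [x])) := by
  obtain ⟨y, y', h⟩ := exists_garside_eq x
  have h₁ : garside ^ 4 = ofWord [x] * (ofWord [y, y'] * garside ^ 3) := by
    rw [pow_succ', ← mul_assoc, ← h]
  have h₂ : garside ^ 4 = ofWord [y, y'] * garside ^ 3 * ofWord [x] := by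
    refine mul_left_cancel (a := ofWord [x]) ?_
    rw [← mul_assoc, ← h₁, garside_pow_four_comm]
  have hu : IsUnit (toFractions (garside ^ 4)) :=
    OreLocalization.numerator_isUnit (⟨garside ^ 4, 1, pow_one _⟩ : centralPowers)
  refine isUnit_iff_exists_and_exists.2
    ⟨⟨toFractions (ofWord [y, y'] * garside ^ 3) * hu.unit⁻¹, ?_⟩,
    ⟨hu.unit⁻¹ * toFractions (ofWord [y, y'] * garside ^ 3), ?_⟩⟩
  · rw [← mul_assoc, ← map_mul, ← h₁, IsUnit.mul_val_inv]
  · rw [mul_assoc, ← map_mul, ← h₂, IsUnit.val_inv_mul]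

/-- An atom as a unit of the monoid of fractions. -/
noncomputable def atomUnit (x : Atom) : Fractionsˣ := (isUnit_toFractions x).unit

theorem atomUnit_mul_of_rel {x y x' y' : Atom} (h : Rel x y x' y') :
    atomUnit x * atomUnit y = atomUnit x' * atomUnit y' := by
  ext
  simp only [atomUnit, Units.val_mul, IsUnit.unit_spec, ← map_mul, mul_eq_mul_of_rel h]

/-- The homomorphism from the braid group to the group of fractions. -/
noncomputable def braidToUnits : B4 →* Fractionsˣ :=
  PresentedGroup.toGroup (f := ![atomUnit 0, atomUnit 4, atomUnit 2]) <| by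
    have h₁ := atomUnit_mul_of_rel (show Rel 4 0 0 1 by decide)
    have h₂ := atomUnit_mul_of_rel (show Rel 1 4 4 0 by decide)
    have h₃ := atomUnit_mul_of_rel (show Rel 4 2 2 3 by decide)
    have h₄ := atomUnit_mul_of_rel (show Rel 3 4 4 2 by decide)
    have h₅ := atomUnit_mul_of_rel (show Rel 0 2 2 0 by decide)
    rintro _ (rfl | rfl | rfl)
    · simp only [map_mul, map_inv, FreeGroup.lift_apply_of, mul_inv_eq_one]
      change atomUnit 0 * atomUnit 4 * atomUnit 0 = atomUnit 4 * atomUnit 0 * atomUnit 4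
      rw [h₁, mul_assoc, mul_assoc, h₁, h₂, h₁]
    · simp only [map_mul, map_inv, FreeGroup.lift_apply_of, mul_inv_eq_one]
      change atomUnit 4 * atomUnit 2 * atomUnit 4 = atomUnit 2 * atomUnit 4 * atomUnit 2
      rw [h₃, mul_assoc, h₄, mul_assoc]
    · simp only [map_mul, map_inv, FreeGroup.lift_apply_of, mul_inv_eq_one]
      exact h₅

theorem braidToUnits_a : braidToUnits a = atomUnit 0 := PresentedGroup.toGroup.of _
theorem braidToUnits_b : braidToUnits b = atomUnit 4 := PresentedGroup.toGroup.of _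
theorem braidToUnits_c : braidToUnits c = atomUnit 2 := PresentedGroup.toGroup.of _

/-- The atoms as elements of the braid group. -/
def atom : Atom → B4 := ![a, b * a * b⁻¹, c, b * c * b⁻¹, b, (a * c)⁻¹ * b * (a * c)]

theorem braidToUnits_atom (x : Atom) : braidToUnits (atom x) = atomUnit x := by
  have h₁ := atomUnit_mul_of_rel (show Rel 4 0 1 4 by decide)
  have h₂ := atomUnit_mul_of_rel (show Rel 4 2 3 4 by decide)
  fin_cases x
  · exact braidToUnits_a
  · change braidToUnits (b * a * b⁻¹) = _
    rw [map_mul, map_mul, map_inv, braidToUnits_a, braidToUnits_b, h₁, mul_inv_cancel_right]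
    rfl
  · exact braidToUnits_c
  · change braidToUnits (b * c * b⁻¹) = _
    rw [map_mul, map_mul, map_inv, braidToUnits_c, braidToUnits_b, h₂, mul_inv_cancel_right]
    rfl
  · exact braidToUnits_b
  · change braidToUnits ((a * c)⁻¹ * b * (a * c)) = _
    have h₃ := atomUnit_mul_of_rel (show Rel 2 5 1 2 by decide)
    have h₄ := atomUnit_mul_of_rel (show Rel 0 1 4 0 by decide)
    rw [map_mul, map_mul, map_inv, map_mul, braidToUnits_a, braidToUnits_b, braidToUnits_c,
      mul_assoc, inv_mul_eq_iff_eq_mul, ← mul_assoc, ← h₄, mul_assoc, ← h₃, mul_assoc]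
    rfl

/-- The element of the braid group represented by a word in the atoms. -/
def evalWord (u : List Atom) : B4 := (u.map atom).prod

theorem braidToUnits_evalWord (u : List Atom) :
    (braidToUnits (evalWord u) : Fractions) = toFractions (ofWord u) := by
  induction u with
  | nil => simp [evalWord, ofWord_nil]
  | cons x u ih =>
    rw [ofWord_cons, map_mul, ← ih, evalWord, List.map_cons, List.prod_cons, map_mul,
      braidToUnits_atom]
    rfl

theorem a_mul_b_mul_a : a * b * a = b * a * b :=
  mul_inv_eq_one.1 (PresentedGroup.one_of_mem (Or.inl rfl))

theorem b_mul_c_mul_b : b * c * b = c * b * c :=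
  mul_inv_eq_one.1 (PresentedGroup.one_of_mem (Or.inr (Or.inl rfl)))

theorem a_mul_c : a * c = c * a :=
  mul_inv_eq_one.1 (PresentedGroup.one_of_mem (Or.inr (Or.inr rfl)))

/-- The simple elements of rank two. -/
def simple : Fin 6 → B4 :=
  ![b * a, b * a * b⁻¹ * c, b * c, b * c * b⁻¹ * a, a * c, b * a * c * b⁻¹]

theorem conj_b_inv_mul {g h : B4} (H : g * h * g = h * g * h) : g⁻¹ * h * g = h * g * h⁻¹ := by
  rw [eq_mul_inv_iff_mul_eq, mul_assoc, mul_assoc, inv_mul_eq_iff_eq_mul, ← mul_assoc, ← mul_assoc,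
    H]

theorem conj_braid {g h k : B4} (H : h * k * h = k * h * k) (hc : k * g = g * k) :
    (g⁻¹ * h * g) * k * (g⁻¹ * h * g) = k * (g⁻¹ * h * g) * k := by
  have hk : k = g⁻¹ * k * g := by rw [mul_assoc, hc, inv_mul_cancel_left]
  calc (g⁻¹ * h * g) * k * (g⁻¹ * h * g)
      = (g⁻¹ * h * g) * (g⁻¹ * k * g) * (g⁻¹ * h * g) := by rw [← hk]
    _ = g⁻¹ * (h * k * h) * g := by group
    _ = (g⁻¹ * k * g) * (g⁻¹ * h * g) * (g⁻¹ * k * g) := by rw [H]; group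
    _ = k * (g⁻¹ * h * g) * k := by rw [← hk]

theorem atom_five_eq : atom 5 = c⁻¹ * (b * a * b⁻¹) * c := by
  rw [← conj_b_inv_mul a_mul_b_mul_a]
  change (a * c)⁻¹ * b * (a * c) = _
  group

theorem atom_five_eq' : atom 5 = a⁻¹ * (b * c * b⁻¹) * a := by
  rw [← conj_b_inv_mul b_mul_c_mul_b.symm]
  change (a * c)⁻¹ * b * (a * c) = _
  rw [a_mul_c]
  group

theorem atom_mul_atom {x y : Atom} {k : Fin 6} (h : simpleTwo x y = some k) :
    atom x * atom y = simple k := by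
  have hs : ∀ x y k, simpleTwo x y = some k →
    (x, y, k) ∈ ([(0, 1, 0), (1, 4, 0), (4, 0, 0), (1, 2, 1), (2, 5, 1), (5, 1, 1), (2, 3, 2),
      (3, 4, 2), (4, 2, 2), (3, 0, 3), (0, 5, 3), (5, 3, 3), (0, 2, 4), (2, 0, 4), (1, 3, 5),
      (3, 1, 5)] : List (Fin 6 × Fin 6 × Fin 6)) := by decide
  have h := hs x y k h
  simp only [List.mem_cons, Prod.mk.injEq, List.not_mem_nil, or_false] at h
  rcases h with h | h | h | h | h | h | h | h | h | h | h | h | h | h | h | h <;>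
    obtain ⟨rfl, rfl, rfl⟩ := h
  · change a * (b * a * b⁻¹) = b * a
    rw [← mul_assoc, ← mul_assoc, a_mul_b_mul_a, mul_inv_cancel_right]
  · change b * a * b⁻¹ * b = b * a
    rw [inv_mul_cancel_right]
  · rfl
  · rfl
  · rw [atom_five_eq]
    change c * _ = b * a * b⁻¹ * c
    group
  · rw [atom_five_eq, ← conj_b_inv_mul a_mul_b_mul_a]
    change _ * (b * a * b⁻¹) = b * a * b⁻¹ * c
    rw [← conj_b_inv_mul a_mul_b_mul_a, mul_assoc, mul_assoc c⁻¹, inv_mul_eq_iff_eq_mul]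
    simpa only [mul_assoc] using conj_braid b_mul_c_mul_b a_mul_c.symm
  · change c * (b * c * b⁻¹) = b * c
    rw [← mul_assoc, ← mul_assoc, ← b_mul_c_mul_b, mul_inv_cancel_right]
  · change b * c * b⁻¹ * b = b * c
    rw [inv_mul_cancel_right]
  · rfl
  · rfl
  · rw [atom_five_eq']
    change a * _ = b * c * b⁻¹ * a
    group
  · rw [atom_five_eq', ← conj_b_inv_mul b_mul_c_mul_b.symm]
    change _ * (b * c * b⁻¹) = b * c * b⁻¹ * a
    rw [← conj_b_inv_mul b_mul_c_mul_b.symm, mul_assoc, mul_assoc a⁻¹, inv_mul_eq_iff_eq_mul]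
    simpa only [mul_assoc] using conj_braid a_mul_b_mul_a.symm a_mul_c
  · rfl
  · exact a_mul_c.symm
  · change b * a * b⁻¹ * (b * c * b⁻¹) = b * a * c * b⁻¹
    group
  · change b * c * b⁻¹ * (b * a * b⁻¹) = b * a * c * b⁻¹
    rw [mul_assoc b a c, a_mul_c]
    group

theorem evalWord_cons (x : Atom) (u : List Atom) : evalWord (x :: u) = atom x * evalWord u :=
  List.prod_cons

theorem evalWord_append (u v : List Atom) : evalWord (u ++ v) = evalWord u * evalWord v := by
  simp [evalWord]

theorem Equivalent.evalWord_eq {u v : List Atom} (h : Equivalent u v) :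
    evalWord u = evalWord v := by
  induction h with
  | refl => rfl
  | symm _ ih => exact ih.symm
  | trans _ _ ih₁ ih₂ => exact ih₁.trans ih₂
  | cons x _ ih => rw [evalWord_cons, evalWord_cons, ih]
  | @rel x y x' y' w h =>
    obtain ⟨k, hk⟩ := Option.isSome_iff_exists.1 h.1
    simp only [evalWord_cons, ← mul_assoc, atom_mul_atom hk, atom_mul_atom (h.2 ▸ hk)]

/-- The dual braid monoid embeds in the braid group. -/
theorem evalWord_eq_iff {u v : List Atom} : evalWord u = evalWord v ↔ Equivalent u v :=
  ⟨fun h => ofWord_eq_iff.1 <| toFractions_injective <| by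
    rw [← braidToUnits_evalWord, h, braidToUnits_evalWord], Equivalent.evalWord_eq⟩

/-- The submonoid of the braid group generated by the atoms. -/
def positive : Submonoid B4 where
  carrier := Set.range evalWord
  one_mem' := ⟨[], rfl⟩
  mul_mem' := by
    rintro _ _ ⟨u, rfl⟩ ⟨v, rfl⟩
    exact ⟨u ++ v, evalWord_append u v⟩

theorem evalWord_mem (u : List Atom) : evalWord u ∈ positive := ⟨u, rfl⟩

/-- The image in the braid group of the complement of two atoms. -/
def residue (x y : Atom) : B4 := evalWord (complement x y)

theorem residue_mem (x y : Atom) : residue x y ∈ positive := evalWord_mem _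

theorem atom_mem (x : Atom) : atom x ∈ positive := ⟨[x], mul_one _⟩

theorem exists_of_atom_mul_eq {x y : Atom} {u v : B4} (hu : u ∈ positive) (hv : v ∈ positive)
    (h : atom x * u = atom y * v) : ∃ w ∈ positive, u = residue x y * w ∧ v = residue y x * w := by
  obtain ⟨u, rfl⟩ := hu
  obtain ⟨v, rfl⟩ := hv
  rw [← evalWord_cons, ← evalWord_cons, evalWord_eq_iff] at h
  obtain ⟨w, h₁, h₂⟩ := hasLcm_of_equivalent h
  refine ⟨evalWord w, evalWord_mem w, ?_, ?_⟩
  · rw [h₁.evalWord_eq, evalWord_append, residue]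
  · rw [h₂.evalWord_eq, evalWord_append, residue]

/-- The exponent sum of a braid. -/
def exponentSum : B4 →* Multiplicative ℤ :=
  PresentedGroup.toGroup (f := fun _ => Multiplicative.ofAdd 1) <| by
    rintro _ (rfl | rfl | rfl) <;> simp

/-- The exponent sum of a braid, as an integer. -/
def rank (x : B4) : ℤ := (exponentSum x).toAdd

theorem rank_mul (x y : B4) : rank (x * y) = rank x + rank y := by simp [rank]

theorem rank_inv (x : B4) : rank x⁻¹ = -rank x := by simp [rank]

theorem rank_atom (x : Atom) : rank (atom x) = 1 := by
  have ha : rank a = 1 := rfl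
  have hb : rank b = 1 := rfl
  have hc : rank c = 1 := rfl
  fin_cases x <;> simp [atom, rank_mul, rank_inv, ha, hb, hc]

theorem rank_evalWord (u : List Atom) : rank (evalWord u) = u.length := by
  induction u with
  | nil => simp [evalWord, rank]
  | cons x u ih => rw [evalWord_cons, rank_mul, ih, rank_atom, List.length_cons]; push_cast; ring

theorem rank_nonneg {x : B4} (hx : x ∈ positive) : 0 ≤ rank x := by
  obtain ⟨u, rfl⟩ := hx
  rw [rank_evalWord]
  positivity

/-- A positive braid is trivial or divisible by an atom. -/
theorem eq_one_or_exists_atom {x : B4} (hx : x ∈ positive) :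
    x = 1 ∨ ∃ i, (atom i)⁻¹ * x ∈ positive := by
  obtain ⟨_ | ⟨i, u⟩, rfl⟩ := hx
  · exact .inl rfl
  · exact .inr ⟨i, by rw [evalWord_cons, inv_mul_cancel_left]; exact evalWord_mem u⟩

theorem eq_one_of_rank_eq_zero {x : B4} (hx : x ∈ positive) (h : rank x = 0) : x = 1 := by
  refine (eq_one_or_exists_atom hx).resolve_right ?_
  rintro ⟨i, hi⟩
  have := rank_nonneg hi
  rw [rank_mul, rank_inv, rank_atom, h] at this
  lia

/-- The meet of two positive braids. -/
theorem exists_meet_of_mem {x y : B4} (hx : x ∈ positive) (hy : y ∈ positive) :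
    ∃ m ∈ positive, m⁻¹ * x ∈ positive ∧ m⁻¹ * y ∈ positive ∧
      ∀ e ∈ positive, e⁻¹ * x ∈ positive → e⁻¹ * y ∈ positive → e⁻¹ * m ∈ positive := by
  suffices H : ∀ (n : ℕ) (x y : B4), x ∈ positive → y ∈ positive → rank x < n →
      ∃ m ∈ positive, m⁻¹ * x ∈ positive ∧ m⁻¹ * y ∈ positive ∧
        ∀ e ∈ positive, e⁻¹ * x ∈ positive → e⁻¹ * y ∈ positive → e⁻¹ * m ∈ positive by
    exact H ((rank x).toNat + 1) x y hx hy (by have := rank_nonneg hx; push_cast; lia)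
  clear hx hy x y
  intro n
  induction n with
  | zero => intro x y hx hy h; exact absurd (rank_nonneg hx) (by simpa using h)
  | succ n ih =>
    intro x y hx hy h
    have hdiv {e : B4} {i : Atom} (hi : (atom i)⁻¹ * e ∈ positive) {x : B4}
        (he : e⁻¹ * x ∈ positive) : (atom i)⁻¹ * x ∈ positive := by
      simpa [mul_assoc] using mul_mem hi he
    have hih (i : Atom) (hix : (atom i)⁻¹ * x ∈ positive) (hiy : (atom i)⁻¹ * y ∈ positive) :=
      ih _ _ hix hiy (by rw [rank_mul, rank_inv, rank_atom]; push_cast at h; lia)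
    by_cases hc : ∃ i, (atom i)⁻¹ * x ∈ positive ∧ (atom i)⁻¹ * y ∈ positive
    · obtain ⟨i, hix, hiy⟩ := hc
      obtain ⟨m, hm, hmx, hmy, hmax⟩ := hih i hix hiy
      refine ⟨atom i * m, mul_mem (atom_mem i) hm, by rwa [mul_inv_rev, mul_assoc],
        by rwa [mul_inv_rev, mul_assoc], fun e he hex hey => ?_⟩
      rcases eq_one_or_exists_atom he with rfl | ⟨j, hj⟩
      · simpa using mul_mem (atom_mem i) hm
      have hjx := hdiv hj hex
      have hjy := hdiv hj hey
      obtain ⟨m', -, hmx', hmy', hmax'⟩ := hih j hjx hjy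
      obtain ⟨w, hw, hw₁, hw₂⟩ := exists_of_atom_mul_eq (x := j) (y := i) hjx hix (by group)
      obtain ⟨w', hw', hw₁', -⟩ := exists_of_atom_mul_eq (x := j) (y := i) hjy hiy (by group)
      have hlcm : atom j * residue j i = atom i * residue i j := by
        rw [inv_mul_eq_iff_eq_mul, ← mul_assoc] at hw₁ hw₂
        exact mul_right_cancel (hw₁.symm.trans hw₂)
      have hres := hmax' (residue j i) (residue_mem j i) (by rwa [hw₁, inv_mul_cancel_left])
        (by rwa [hw₁', inv_mul_cancel_left])
      have hjm : (atom i * (residue i j * ((residue j i)⁻¹ * m'))) = atom j * m' := by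
        rw [← mul_assoc, ← hlcm]; group
      have hjm' : (residue i j * ((residue j i)⁻¹ * m'))⁻¹ = (atom j * m')⁻¹ * atom i := by
        rw [← hjm]; group
      have hle := hmax _ (mul_mem (residue_mem i j) hres)
        (by rw [hjm']; simpa [mul_assoc] using hmx') (by rw [hjm']; simpa [mul_assoc] using hmy')
      rw [hjm'] at hle
      have hej := hmax' ((atom j)⁻¹ * e) hj (by simpa [mul_assoc] using hex)
        (by simpa [mul_assoc] using hey)
      simpa [mul_assoc] using mul_mem hej hle
    · refine ⟨1, one_mem _, by simpa, by simpa, fun e he hex hey => ?_⟩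
      rcases eq_one_or_exists_atom he with rfl | ⟨j, hj⟩
      · simp [one_mem]
      · exact absurd ⟨j, hdiv hj hex, hdiv hj hey⟩ hc

/-- The Garside element of the braid group. -/
def delta : B4 := b * a * c

theorem evalWord_eq_of_ofWord_eq {u v : List Atom} (h : ofWord u = ofWord v) :
    evalWord u = evalWord v :=
  (ofWord_eq_iff.1 h).evalWord_eq

theorem ofWord_garside : ofWord [0, 1, 2] = garside := by
  rw [garside, ← ofWord_append, ← ofWord_append]; rfl

theorem delta_eq : delta = evalWord [0, 1, 2] := by
  have h : ofWord [4, 0, 2] = ofWord [0, 1, 2] := by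
    rw [ofWord_garside, garside_eq_four, ← ofWord_append, ← ofWord_append]; rfl
  rw [← evalWord_eq_of_ofWord_eq h]
  simp [evalWord, atom, delta, mul_assoc]

theorem delta_mem : delta ∈ positive := delta_eq ▸ evalWord_mem _

theorem rank_delta : rank delta = 3 := by
  rw [delta_eq, rank_evalWord]; rfl

theorem delta_mul_atom (x : Atom) : delta * atom x = atom (rotate x) * delta := by
  have h : ofWord ([0, 1, 2] ++ [x]) = ofWord (rotate x :: [0, 1, 2]) := by
    rw [ofWord_append, ofWord_cons (rotate x), ofWord_garside, garside_mul]
  have := evalWord_eq_of_ofWord_eq h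
  rwa [evalWord_append, evalWord_cons (rotate x), ← delta_eq, evalWord, List.map_singleton,
    List.prod_singleton] at this

theorem delta_conj_evalWord (u : List Atom) :
    delta * evalWord u * delta⁻¹ = evalWord (u.map rotate) := by
  rw [mul_inv_eq_iff_eq_mul]
  induction u with
  | nil => simp [evalWord]
  | cons x u ih =>
    rw [List.map_cons, evalWord_cons, evalWord_cons, ← mul_assoc, delta_mul_atom, mul_assoc, ih,
      mul_assoc]

theorem delta_conj_mem {x : B4} (hx : x ∈ positive) : delta * x * delta⁻¹ ∈ positive := by
  obtain ⟨u, rfl⟩ := hx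
  exact delta_conj_evalWord u ▸ evalWord_mem _

theorem delta_conj_inv_mem {x : B4} (hx : x ∈ positive) : delta⁻¹ * x * delta ∈ positive := by
  obtain ⟨u, rfl⟩ := hx
  have h : ∀ x, rotate (rotate (rotate (rotate x))) = x := by decide
  have hu : u = (u.map fun x => rotate (rotate (rotate x))).map rotate := by
    simp [Function.comp_def, h]
  rw [hu, ← delta_conj_evalWord]
  simpa [mul_assoc] using evalWord_mem _

theorem delta_pow_conj_mem (n : ℕ) {x : B4} (hx : x ∈ positive) :
    delta ^ n * x * (delta ^ n)⁻¹ ∈ positive := by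
  induction n with
  | zero => simpa
  | succ n ih => simpa [pow_succ', mul_assoc] using delta_conj_mem ih

/-- Every atom is a left divisor of the Garside element. -/
theorem atom_inv_mul_delta_mem (x : Atom) : (atom x)⁻¹ * delta ∈ positive := by
  obtain ⟨y, y', h⟩ := exists_garside_eq x
  rw [← ofWord_garside, ← ofWord_cons] at h
  rw [delta_eq, evalWord_eq_of_ofWord_eq h, evalWord_cons, inv_mul_cancel_left]
  exact evalWord_mem _

theorem delta_mul_atom_inv_mem (x : Atom) : delta * (atom x)⁻¹ ∈ positive := by
  have := delta_conj_mem (atom_inv_mul_delta_mem x)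
  simpa [mul_assoc] using this

/-- The braids which become positive after multiplication with a power of the Garside element
form a submonoid. -/
def eventuallyPositive : Submonoid B4 where
  carrier := {x | ∃ n : ℕ, delta ^ n * x ∈ positive}
  one_mem' := ⟨0, by simp [one_mem]⟩
  mul_mem' := by
    rintro x y ⟨k, hx⟩ ⟨l, hy⟩
    refine ⟨l + k, ?_⟩
    have := mul_mem (delta_pow_conj_mem l hx) hy
    simpa [pow_add, mul_assoc] using this

theorem positive_le_eventuallyPositive : positive ≤ eventuallyPositive :=
  fun x hx => ⟨0, by simpa using hx⟩

theorem inv_mem_eventuallyPositive {x : B4} (hx : x ∈ eventuallyPositive) :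
    x⁻¹ ∈ eventuallyPositive := by
  have hpos (u : List Atom) : (evalWord u)⁻¹ ∈ eventuallyPositive := by
    induction u with
    | nil => exact ⟨0, by simp [evalWord, one_mem]⟩
    | cons i u ih =>
      rw [evalWord_cons, mul_inv_rev]
      exact mul_mem ih ⟨1, by simpa using delta_mul_atom_inv_mem i⟩
  obtain ⟨n, u, hu⟩ := hx
  have hx : x⁻¹ = (evalWord u)⁻¹ * delta ^ n := by rw [hu]; group
  rw [hx]
  exact mul_mem (hpos u) (positive_le_eventuallyPositive (pow_mem delta_mem n))

theorem exists_delta_pow_mul_mem (x : B4) : ∃ n : ℕ, delta ^ n * x ∈ positive := by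
  refine PresentedGroup.generated_by _
    { eventuallyPositive with inv_mem' := inv_mem_eventuallyPositive } (fun j => ⟨0, ?_⟩) x
  rw [pow_zero, one_mul]
  fin_cases j
  exacts [atom_mem 0, atom_mem 4, atom_mem 2]

/-- The meet of two braids. -/
theorem exists_meet (x y : B4) :
    ∃ m, m⁻¹ * x ∈ positive ∧ m⁻¹ * y ∈ positive ∧
      ∀ e, e⁻¹ * x ∈ positive → e⁻¹ * y ∈ positive → e⁻¹ * m ∈ positive := by
  obtain ⟨k, hkx, hky⟩ : ∃ k : ℕ, delta ^ k * x ∈ positive ∧ delta ^ k * y ∈ positive := by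
    obtain ⟨k, hk⟩ := exists_delta_pow_mul_mem x
    obtain ⟨l, hl⟩ := exists_delta_pow_mul_mem y
    refine ⟨k + l, ?_, ?_⟩
    · rw [add_comm, pow_add, mul_assoc]
      exact mul_mem (pow_mem delta_mem l) hk
    · rw [pow_add, mul_assoc]
      exact mul_mem (pow_mem delta_mem k) hl
  obtain ⟨m, hm, hmx, hmy, hmax⟩ := exists_meet_of_mem hkx hky
  refine ⟨(delta ^ k)⁻¹ * m, by simpa [mul_assoc] using hmx, by simpa [mul_assoc] using hmy,
    fun e hex hey => ?_⟩
  obtain ⟨l, hl⟩ := exists_delta_pow_mul_mem e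
  have hpow (g : B4) : delta ^ (l + k) * g = delta ^ l * (delta ^ k * g) := by
    rw [pow_add, mul_assoc]
  have hlx := mul_mem (pow_mem delta_mem l) hkx
  have hly := mul_mem (pow_mem delta_mem l) hky
  obtain ⟨m', hm', hmx', hmy', hmax'⟩ := exists_meet_of_mem hlx hly
  have hl' : (delta ^ l)⁻¹ * m' ∈ positive :=
    hmax' _ (pow_mem delta_mem l) (by rwa [inv_mul_cancel_left]) (by rwa [inv_mul_cancel_left])
  have hle := hmax _ hl' (by simpa [mul_assoc] using hmx') (by simpa [mul_assoc] using hmy')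
  have he : delta ^ (l + k) * e ∈ positive := by
    rw [add_comm, pow_add, mul_assoc]
    exact mul_mem (pow_mem delta_mem k) hl
  have hle' := hmax' _ he (by rw [← hpow]; simpa [mul_assoc] using hex)
    (by rw [← hpow]; simpa [mul_assoc] using hey)
  have := mul_mem hle' hle
  simpa [pow_add, mul_assoc] using this

end DualBraid

/-- A left-invariant family of segments and of core triangles in a group. The segments have at most
`Q` points and every triangle with a short side, as measured by `D`, has a core. -/
structure CoreStructure (Γ : Type*) [Group Γ] (D : Γ → Prop) (Q : ℕ) where
  /-- `J x y m` means that `m` is in the segment from `x` to `y`. -/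
  J : Γ → Γ → Γ → Prop
  /-- The core triangles. -/
  E : Γ → Γ → Γ → Prop
  mul_left_J {x y m : Γ} (g : Γ) : J x y m → J (g * x) (g * y) (g * m)
  mul_left_E {p q s : Γ} (g : Γ) : E p q s → E (g * p) (g * q) (g * s)
  encard_le (x y : Γ) : {m | J x y m}.encard ≤ Q
  exists_core (x y z : Γ) : D (x⁻¹ * y) →
    ∃ p q s, E p q s ∧ (J x y p ∧ J x y q) ∧ (J y z q ∧ J y z s) ∧ (J x z s ∧ J x z p)
  exists_median {p q s s' : Γ} : E p q s → E p q s' →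
    ∃ u v, (J p s u ∧ J p s' u) ∧ (J q s v ∧ J q s' v) ∧ (J s s' u ∧ J s s' v)

/-! ### The geometry of a dual Garside group of rank three -/

/-- A group with a left-invariant meet-semilattice order which is graded by a rank homomorphism
and has a Garside element of rank three. -/
class DualGarside (B : Type*) [Group B] extends SemilatticeInf B where
  /-- The rank homomorphism. -/
  rk : B → ℤ
  /-- The Garside element. -/
  gar : B
  mul_le_mul_left' (x : B) {y y' : B} : y ≤ y' → x * y ≤ x * y'
  rk_mul (x y : B) : rk (x * y) = rk x + rk y
  rk_lt {x y : B} : x < y → rk x < rk y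
  rk_gar : rk gar = 3
  one_le_gar : 1 ≤ gar
  mul_gar_le {x y : B} : x ≤ y → x * gar ≤ y * gar
  mul_gar_inv_le {x y : B} : x ≤ y → x * gar⁻¹ ≤ y * gar⁻¹
  exists_atom {x y : B} : x < y → ∃ e, x < e ∧ e ≤ y ∧ e ≤ x * gar ∧ rk e = rk x + 1
  exists_pow_inv_le (x : B) : ∃ n : ℕ, (gar ^ n)⁻¹ ≤ x

namespace DualGarside

variable {B : Type*} [Group B] [DualGarside B]

theorem rk_le {x y : B} (h : x ≤ y) : rk x ≤ rk y :=
  h.eq_or_lt.elim (fun h => h ▸ le_rfl) fun h => (rk_lt h).le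

theorem eq_of_le_of_rk_le {x y : B} (h : x ≤ y) (hr : rk y ≤ rk x) : x = y :=
  h.eq_of_not_lt fun hlt => (rk_lt hlt).not_ge hr

theorem mul_zpow_le {x y : B} (h : x ≤ y) (k : ℤ) : x * gar ^ k ≤ y * gar ^ k := by
  induction k with
  | zero => simpa
  | succ k ih => simpa only [zpow_add_one, ← mul_assoc] using mul_gar_le ih
  | pred k ih => simpa only [zpow_sub_one, ← mul_assoc] using mul_gar_inv_le ih

theorem mul_zpow_le_iff {x y : B} {k : ℤ} : x * gar ^ k ≤ y ↔ x ≤ y * gar ^ (-k) :=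
  ⟨fun h => by simpa using mul_zpow_le h (-k), fun h => by simpa using mul_zpow_le h k⟩

theorem le_mul_zpow {k : ℤ} (hk : 0 ≤ k) (x : B) : x ≤ x * gar ^ k := by
  lift k to ℕ using hk
  induction k with
  | zero => simp
  | succ k ih =>
    refine ih.trans ?_
    have := mul_le_mul_left' (x * gar ^ (k : ℤ)) (one_le_gar (B := B))
    rwa [mul_one, mul_assoc, ← zpow_add_one, ← Nat.cast_succ] at this

theorem rk_mul_zpow (x : B) (k : ℤ) : rk (x * gar ^ k) = rk x + 3 * k := by
  have h1 : rk (1 : B) = 0 := by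
    have := rk_mul (1 : B) 1
    rw [mul_one] at this
    lia
  have hi (x : B) : rk x⁻¹ = -rk x := by
    have := rk_mul x x⁻¹
    rw [mul_inv_cancel, h1] at this
    lia
  induction k with
  | zero => simp
  | succ k ih => rw [zpow_add_one, ← mul_assoc, rk_mul, ih, rk_gar]; ring
  | pred k ih => rw [zpow_sub_one, ← mul_assoc, rk_mul, ih, hi, rk_gar]; ring

theorem exists_height (x y : B) : ∃ k : ℤ, ∀ j : ℤ, y ≤ x * gar ^ j ↔ k ≤ j := by
  obtain ⟨n, hn⟩ := exists_pow_inv_le (y⁻¹ * x)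
  have hn' : y ≤ x * gar ^ (n : ℤ) := by
    have := mul_zpow_le (mul_le_mul_left' y hn) (n : ℤ)
    simpa [mul_assoc] using this
  obtain ⟨k, hk, hmin⟩ := Int.exists_least_of_bdd (P := fun j => y ≤ x * gar ^ j)
    ⟨(rk y - rk x) / 3, fun j hj => by
      have := rk_le hj
      rw [rk_mul_zpow] at this
      lia⟩ ⟨n, hn'⟩
  refine ⟨k, fun j => ⟨hmin j, fun hj => hk.trans ?_⟩⟩
  have := le_mul_zpow (sub_nonneg.2 hj) (x * gar ^ k)
  rwa [mul_assoc, ← zpow_add, add_sub_cancel] at this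

/-- The least `k` such that `y ≤ x * gar ^ k`. -/
noncomputable def height (x y : B) : ℤ := (exists_height x y).choose

theorem le_mul_zpow_iff {x y : B} {j : ℤ} : y ≤ x * gar ^ j ↔ height x y ≤ j :=
  (exists_height x y).choose_spec j

theorem height_le_zero {x y : B} : height x y ≤ 0 ↔ y ≤ x := by
  rw [← le_mul_zpow_iff, zpow_zero, mul_one]

theorem height_mul_zpow (x y : B) (i j : ℤ) :
    height (x * gar ^ i) (y * gar ^ j) = height x y + j - i := by
  refine eq_of_forall_ge_iff fun k => ?_
  rw [← le_mul_zpow_iff, mul_zpow_le_iff, mul_assoc, mul_assoc, ← zpow_add, ← zpow_add,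
    le_mul_zpow_iff]
  constructor <;> intro <;> lia

theorem height_mul_left (g x y : B) : height (g * x) (g * y) = height x y := by
  refine eq_of_forall_ge_iff fun k => ?_
  rw [← le_mul_zpow_iff, ← le_mul_zpow_iff, mul_assoc]
  exact ⟨fun h => by simpa using mul_le_mul_left' g⁻¹ h, mul_le_mul_left' g⟩

theorem height_triangle (x y z : B) : height x z ≤ height x y + height y z := by
  rw [← le_mul_zpow_iff, zpow_add, ← mul_assoc]
  exact (le_mul_zpow_iff.2 le_rfl).trans (mul_zpow_le (le_mul_zpow_iff.2 le_rfl) _)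

theorem rk_sub_rk_le (x y : B) : rk y - rk x ≤ 3 * height x y := by
  have := rk_le (le_mul_zpow_iff (x := x) (y := y).2 le_rfl)
  rw [rk_mul_zpow] at this
  lia

theorem height_self (x : B) : height x x = 0 := by
  have h₁ := rk_sub_rk_le x x
  have h₂ := height_le_zero.2 (le_refl x)
  lia

theorem height_le_rk_sub {x y : B} (h : x ≤ y) : height x y ≤ rk y - rk x := by
  obtain ⟨n, hn⟩ := Int.eq_ofNat_of_zero_le (sub_nonneg.2 (rk_le h))
  induction n generalizing x with
  | zero => rw [eq_of_le_of_rk_le h (by lia), height_self]; lia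
  | succ n ih =>
    obtain ⟨e, -, hey, hex, hre⟩ := exists_atom (h.lt_of_ne fun hxy => by subst hxy; lia)
    have h₁ := ih hey (by lia)
    have h₂ := height_triangle x e y
    have h₃ : height x e ≤ 1 := by rwa [← le_mul_zpow_iff, zpow_one]
    lia

/-- The distance of two cosets of the cyclic group generated by the Garside element. -/
noncomputable def gap (x y : B) : ℤ := height x y + height y x

/-- The rank of the normalised quotient of two elements. -/
noncomputable def twist (x y : B) : ℤ := rk y - rk x + 3 * height y x

theorem gap_comm (x y : B) : gap x y = gap y x := add_comm _ _

theorem gap_nonneg (x y : B) : 0 ≤ gap x y := by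
  have := height_triangle x y x
  rwa [height_self] at this

theorem gap_triangle (x y z : B) : gap x z ≤ gap x y + gap y z := by
  have h₁ := height_triangle x y z
  have h₂ := height_triangle z y x
  unfold gap
  lia

theorem twist_add_twist (x y : B) : twist x y + twist y x = 3 * gap x y := by
  unfold twist gap
  ring

theorem gap_le_twist (x y : B) : gap x y ≤ twist x y := by
  have h := height_le_rk_sub (le_mul_zpow_iff (x := y) (y := x).2 le_rfl)
  have h' := height_mul_zpow x y 0 (height y x)
  rw [zpow_zero, mul_one] at h'
  rw [rk_mul_zpow, h'] at h
  unfold twist gap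
  lia

theorem twist_le (x y : B) : twist x y ≤ 2 * gap x y := by
  have h₁ := twist_add_twist x y
  have h₂ := gap_le_twist y x
  rw [gap_comm] at h₂
  lia

theorem eq_mul_zpow_of_gap_eq_zero {x y : B} (h : gap x y = 0) : ∃ k : ℤ, y = x * gar ^ k := by
  refine ⟨height x y, le_antisymm (le_mul_zpow_iff.2 le_rfl) ?_⟩
  rw [mul_zpow_le_iff, le_mul_zpow_iff]
  unfold gap at h
  lia

/-- `m` lies on a geodesic from `x` to `y`. -/
def Between (x m y : B) : Prop :=
  height x y = height x m + height m y ∧ height y x = height y m + height m x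

theorem Between.symm {x m y : B} (h : Between x m y) : Between y m x := ⟨h.2, h.1⟩

theorem between_left (x y : B) : Between x x y := by simp [Between, height_self]

theorem between_right (x y : B) : Between x y y := by simp [Between, height_self]

theorem Between.gap_eq {x m y : B} (h : Between x m y) : gap x y = gap x m + gap m y := by
  have h₁ := h.1
  have h₂ := h.2
  unfold gap
  lia

theorem Between.twist_eq {x m y : B} (h : Between x m y) :
    twist x y = twist x m + twist m y := by
  have h₂ := h.2
  unfold twist
  lia

/-- Between-ness of a point of a terminal segment. -/
theorem Between.trans {x p m y : B} (h : Between x p y) (h' : Between p m y) :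
    Between x m y ∧ Between x p m := by
  have h₁ := height_triangle x m y
  have h₂ := height_triangle y m x
  have h₃ := height_triangle x p m
  have h₄ := height_triangle m p x
  obtain ⟨h₅, h₆⟩ := h
  obtain ⟨h₇, h₈⟩ := h'
  refine ⟨⟨?_, ?_⟩, ?_, ?_⟩ <;> lia

theorem Between.of_gap_eq_zero {x m y m' : B} (h : Between x m y) (h' : gap m m' = 0) :
    Between x m' y := by
  obtain ⟨k, rfl⟩ := eq_mul_zpow_of_gap_eq_zero h'
  have h₁ (w : B) := height_mul_zpow w m 0 k
  have h₂ (w : B) := height_mul_zpow m w k 0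
  simp only [zpow_zero, mul_one] at h₁ h₂
  unfold Between at h ⊢
  rw [h₁, h₂, h₁, h₂]
  constructor <;> lia

theorem between_mul_zpow_iff {x m y : B} (i j k : ℤ) :
    Between (x * gar ^ i) (m * gar ^ j) (y * gar ^ k) ↔ Between x m y := by
  simp only [Between, height_mul_zpow]
  constructor <;> rintro ⟨h₁, h₂⟩ <;> constructor <;> lia

theorem gap_mul_zpow (x y : B) (i j : ℤ) : gap (x * gar ^ i) (y * gar ^ j) = gap x y := by
  simp only [gap, height_mul_zpow]
  ring

theorem twist_mul_zpow (x y : B) (i j : ℤ) : twist (x * gar ^ i) (y * gar ^ j) = twist x y := by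
  simp only [twist, height_mul_zpow, rk_mul_zpow]
  ring

theorem between_mul_left {x m y : B} (g : B) :
    Between (g * x) (g * m) (g * y) ↔ Between x m y := by
  simp only [Between, height_mul_left]

theorem gap_mul_left (g x y : B) : gap (g * x) (g * y) = gap x y := by
  simp only [gap, height_mul_left]

theorem twist_mul_left (g x y : B) : twist (g * x) (g * y) = twist x y := by
  simp only [twist, height_mul_left, rk_mul]
  ring

theorem eq_of_between_of_normalised {x y m₁ m₂ : B} (hy : height y x = 0)
    (hx₁ : height m₁ x = 0) (hx₂ : height m₂ x = 0) (h₁ : Between x m₁ y) (h₂ : Between x m₂ y)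
    (hh : height x m₁ = height x m₂) (hr : rk m₁ = rk m₂) : m₁ = m₂ := by
  by_contra hne
  obtain ⟨h₁, h₁'⟩ := h₁
  obtain ⟨h₂, h₂'⟩ := h₂
  set k := height x m₁ with hk
  set l := height m₁ y with hl
  have hxm₁ := height_le_zero.1 hx₁.le
  have hxm₂ := height_le_zero.1 hx₂.le
  have hm₁k : m₁ ≤ x * gar ^ k := le_mul_zpow_iff.2 le_rfl
  have hm₂k : m₂ ≤ x * gar ^ k := le_mul_zpow_iff.2 hh.ge
  have hm₁y : m₁ ≤ y := height_le_zero.1 (by lia)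
  have hm₂y : m₂ ≤ y := height_le_zero.1 (by lia)
  have hk0 : 0 < k := by
    by_contra hk0
    have h₁ := height_le_zero.1 (not_lt.1 hk0)
    have h₂ := height_le_zero.1 (hh ▸ not_lt.1 hk0)
    exact hne ((le_antisymm h₁ hxm₁).trans (le_antisymm hxm₂ h₂))
  set m := m₁ ⊓ m₂ with hm
  have hym : height m y ≤ l := by
    rw [← le_mul_zpow_iff, ← neg_neg l, ← mul_zpow_le_iff]
    refine le_inf ?_ ?_ <;> rw [mul_zpow_le_iff, neg_neg, le_mul_zpow_iff]
    lia
  have hkm : k ≤ height x m := by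
    have := height_triangle x m y
    lia
  have hlt₁ : m < m₁ := inf_le_left.lt_of_ne fun h =>
    hne (eq_of_le_of_rk_le (inf_eq_left.1 h) hr.ge)
  have hlt₂ : m < m₂ := inf_le_right.lt_of_ne fun h =>
    hne (eq_of_le_of_rk_le (inf_eq_right.1 h) hr.le).symm
  obtain ⟨e₁, hme₁, he₁, hd₁, hr₁⟩ := exists_atom hlt₁
  obtain ⟨e₂, hme₂, he₂, hd₂, hr₂⟩ := exists_atom hlt₂
  have hee : ¬ e₂ ≤ e₁ := fun h => hme₂.not_ge (le_inf (h.trans he₁) he₂)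
  set w := y ⊓ x * gar ^ k ⊓ m * gar with hw
  have hew₁ : e₁ ≤ w := le_inf (le_inf (he₁.trans hm₁y) (he₁.trans hm₁k)) hd₁
  have hew₂ : e₂ ≤ w := le_inf (le_inf (he₂.trans hm₂y) (he₂.trans hm₂k)) hd₂
  have hrw := rk_lt (hew₁.lt_of_ne fun h => hee (h ▸ hew₂))
  have hwy : w * gar ^ (-1 : ℤ) ≤ y * gar ^ (-1 : ℤ) :=
    mul_zpow_le (inf_le_left.trans inf_le_left) _
  have hwx : w * gar ^ (-1 : ℤ) ≤ x * gar ^ (k - 1) := by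
    have := mul_zpow_le ((inf_le_left.trans inf_le_right : w ≤ x * gar ^ k)) (-1)
    rwa [mul_assoc, ← zpow_add] at this
  have hwm : w * gar ^ (-1 : ℤ) ≤ m := by
    rw [mul_zpow_le_iff, neg_neg, zpow_one]
    exact inf_le_right
  set v := m ⊓ x * gar ^ (k - 1) with hv
  have hwv : w * gar ^ (-1 : ℤ) ≤ v := le_inf hwm hwx
  have hvm : v ≠ m := fun h => by
    have := le_mul_zpow_iff.1 (inf_eq_left.1 h)
    lia
  have hrv := rk_lt (inf_le_left.lt_of_ne hvm)
  have hwv' : w * gar ^ (-1 : ℤ) = v := eq_of_le_of_rk_le hwv (by rw [rk_mul_zpow]; lia)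
  have hxv : x ≤ v := le_inf (le_inf hxm₁ hxm₂) (le_mul_zpow (by lia) x)
  have := le_mul_zpow_iff.1 ((hxv.trans hwv'.ge).trans hwy)
  lia

/-- A point of a segment is determined, up to a power of the Garside element, by its distance and
its twist. -/
theorem exists_eq_mul_zpow_of_between {x y m₁ m₂ : B} (h₁ : Between x m₁ y) (h₂ : Between x m₂ y)
    (hg : gap x m₁ = gap x m₂) (ht : twist x m₁ = twist x m₂) : ∃ i : ℤ, m₂ = m₁ * gar ^ i := by
  have hn (w : B) : height (w * gar ^ height w x) x = 0 := by
    have := height_mul_zpow w x (height w x) 0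
    rw [zpow_zero, mul_one] at this
    lia
  have hn' (w : B) : height x (w * gar ^ height w x) = gap x w := by
    have := height_mul_zpow x w 0 (height w x)
    rw [zpow_zero, mul_one] at this
    unfold gap
    lia
  have hb {w : B} (h : Between x w y) :
      Between x (w * gar ^ height w x) (y * gar ^ height y x) := by
    simpa using (between_mul_zpow_iff 0 (height w x) (height y x)).2 h
  have := eq_of_between_of_normalised (hn y) (hn m₁) (hn m₂) (hb h₁) (hb h₂)
    (by rw [hn', hn', hg]) (by
      rw [rk_mul_zpow, rk_mul_zpow]
      unfold twist at ht
      lia)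
  refine ⟨height m₁ x - height m₂ x, ?_⟩
  rw [zpow_sub, ← mul_assoc, this, mul_inv_cancel_right]

theorem exists_corner {p q s : B} (hp : 1 ≤ gap q p) (hs : 1 ≤ gap q s)
    (h₁ : height s p ≠ height s q + height q p) (h₂ : height p s ≠ height p q + height q s) :
    ∃ e, gap q e = 1 ∧ Between q e p ∧ Between q e s := by
  have hl (w : B) (j : ℤ) : height q (w * gar ^ j) = height q w + j := by
    have := height_mul_zpow q w 0 j
    rw [zpow_zero, mul_one] at this
    lia
  have hr (w : B) (j : ℤ) : height (w * gar ^ j) q = height w q - j := by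
    have := height_mul_zpow w q j 0
    rw [zpow_zero, mul_one] at this
    lia
  suffices H : ∀ p' s' : B, height p' q = 0 → height s' q = 0 → 1 ≤ height q p' →
      1 ≤ height q s' → height s' p' ≤ height q p' - 1 → height p' s' ≤ height q s' - 1 →
      ∃ e, gap q e = 1 ∧ Between q e p' ∧ Between q e s' by
    have hsp := height_triangle s q p
    have hps := height_triangle p q s
    unfold gap at hp hs
    obtain ⟨e, he, hep, hes⟩ := H (p * gar ^ height p q) (s * gar ^ height s q)
      (by rw [hr]; lia) (by rw [hr]; lia) (by rw [hl]; lia) (by rw [hl]; lia)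
      (by rw [hl, height_mul_zpow]; lia) (by rw [hl, height_mul_zpow]; lia)
    refine ⟨e, he, ?_, ?_⟩
    · simpa using (between_mul_zpow_iff 0 0 (height p q)).1 (by simpa using hep)
    · simpa using (between_mul_zpow_iff 0 0 (height s q)).1 (by simpa using hes)
  intro p' s' hp' hs' hqp hqs hsp hps
  set e := q * gar ⊓ p' ⊓ s' with he
  have hqe : height e q ≤ 0 := height_le_zero.2 <|
    le_inf (le_inf (by simpa using le_mul_zpow zero_le_one q) (height_le_zero.1 hp'.le))
      (height_le_zero.1 hs'.le)
  have heq : height q e ≤ 1 := by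
    rw [← le_mul_zpow_iff, zpow_one]
    exact inf_le_left.trans inf_le_left
  have hep : height p' e ≤ 0 := height_le_zero.2 (inf_le_left.trans inf_le_right)
  have hes : height s' e ≤ 0 := height_le_zero.2 inf_le_right
  have hle {w : B} {n : ℤ} (h₁ : height q w ≤ n + 1) (h₂ : height p' w ≤ n)
      (h₃ : height s' w ≤ n) : height e w ≤ n := by
    rw [← le_mul_zpow_iff, ← neg_neg n, ← mul_zpow_le_iff]
    refine le_inf (le_inf ?_ ?_) ?_
    · rw [mul_zpow_le_iff, mul_assoc, ← zpow_one_add, le_mul_zpow_iff]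
      lia
    · rwa [mul_zpow_le_iff, neg_neg, le_mul_zpow_iff]
    · rwa [mul_zpow_le_iff, neg_neg, le_mul_zpow_iff]
  have hep' : height e p' ≤ height q p' - 1 := hle (by lia) (by rw [height_self]; lia) hsp
  have hes' : height e s' ≤ height q s' - 1 := hle (by lia) hps (by rw [height_self]; lia)
  have h₁ := height_triangle q e p'
  have h₂ := height_triangle p' e q
  have h₃ := height_triangle q e s'
  have h₄ := height_triangle s' e q
  refine ⟨e, ?_, ⟨?_, ?_⟩, ?_, ?_⟩ <;> first | unfold gap; lia | lia

/-- A triangle whose sides are pure geodesics of the same type and of the same length. -/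
def Equilateral (n : ℤ) (p q s : B) : Prop :=
  gap p q = n ∧ gap q s = n ∧ gap s p = n ∧
    ((twist p q = n ∧ twist q s = n ∧ twist s p = n) ∨
      (twist p q = 2 * n ∧ twist q s = 2 * n ∧ twist s p = 2 * n))

theorem Equilateral.rotate {n : ℤ} {p q s : B} (h : Equilateral n p q s) :
    Equilateral n q s p := by
  unfold Equilateral at h ⊢
  lia

theorem equilateral_of_gap_eq_zero {p q s : B}
    (hs : ∀ e, Between s e p → Between s e q → gap s e = 0) (hpq : gap p q = 0) :
    Equilateral 0 p q s := by
  have h := hs p (between_right s p)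
    ((between_right s q).of_gap_eq_zero (by rwa [gap_comm]))
  have h₁ := gap_triangle q p s
  have h₂ := gap_nonneg q s
  have h₃ := gap_le_twist p q
  have h₄ := gap_le_twist q s
  have h₅ := gap_le_twist s p
  have h₆ := twist_le p q
  have h₇ := twist_le q s
  have h₈ := twist_le s p
  rw [gap_comm q p, gap_comm p s] at h₁
  unfold Equilateral
  lia

theorem equilateral_of_corners {p q s : B}
    (hp : ∀ e, Between p e q → Between p e s → gap p e = 0)
    (hq : ∀ e, Between q e p → Between q e s → gap q e = 0)
    (hs : ∀ e, Between s e p → Between s e q → gap s e = 0) :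
    Equilateral (gap p q) p q s := by
  have h₁ := gap_nonneg p q
  have h₂ := gap_nonneg q s
  have h₃ := gap_nonneg s p
  by_cases hpq : gap p q = 0
  · exact hpq.symm ▸ equilateral_of_gap_eq_zero hs hpq
  by_cases hqs : gap q s = 0
  · have := equilateral_of_gap_eq_zero (fun e h h' => hp e h h') hqs
    exact absurd ((gap_comm p q).trans (by unfold Equilateral at this; lia)) hpq
  by_cases hsp : gap s p = 0
  · have := equilateral_of_gap_eq_zero (fun e h h' => hq e h' h) hsp
    exact absurd (by unfold Equilateral at this; lia) hpq
  have corner {x y z : B} (hx : gap x y ≠ 0) (hz : gap x z ≠ 0)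
      (h : ∀ e, Between x e y → Between x e z → gap x e = 0) :
      height z y = height z x + height x y ∨ height y z = height y x + height x z := by
    by_contra! hc
    have h₁ := gap_nonneg x y
    have h₂ := gap_nonneg x z
    obtain ⟨e, he, hey, hez⟩ := exists_corner (by lia) (by lia) hc.1 hc.2
    rw [h e hey hez] at he
    lia
  have cp := corner hpq (by rwa [gap_comm]) hp
  have cq := corner (by rwa [gap_comm]) hqs hq
  have cs := corner hsp (by rwa [gap_comm]) hs
  have h₃ := gap_le_twist p q
  have h₄ := gap_le_twist q s
  have h₅ := gap_le_twist s p
  have h₆ := twist_le p q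
  have h₇ := twist_le q s
  have h₈ := twist_le s p
  unfold Equilateral
  unfold gap twist at *
  lia

theorem exists_maximal (x : B) {P : B → Prop} {N : ℤ} (hne : ∃ e, P e)
    (hN : ∀ e, P e → gap x e ≤ N) : ∃ e, P e ∧ ∀ e', P e' → gap x e' ≤ gap x e := by
  obtain ⟨_, ⟨e, he, rfl⟩, hmax⟩ := Int.exists_greatest_of_bdd
    (P := fun n => ∃ e, P e ∧ gap x e = n) ⟨N, fun _ ⟨e, he, h⟩ => h ▸ hN e he⟩
    (hne.imp' (gap x) fun e he => ⟨e, he, rfl⟩)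
  exact ⟨e, he, fun e' he' => hmax _ ⟨e', he', rfl⟩⟩

/-- Every geodesic triangle contains an equilateral triangle. -/
theorem exists_core (x y z : B) : ∃ p q s : B, Between x p y ∧ Between p q y ∧ Between x p z ∧
    Between p s z ∧ Between y q z ∧ Between q s z ∧ Equilateral (gap p q) p q s := by
  obtain ⟨p, ⟨hpy, hpz⟩, hp⟩ := exists_maximal x (P := fun e => Between x e y ∧ Between x e z)
    (N := gap x y) ⟨x, between_left x y, between_left x z⟩
    fun e he => by have := he.1.gap_eq; have := gap_nonneg e y; lia
  obtain ⟨q, ⟨hqp, hqz⟩, hq⟩ := exists_maximal y (P := fun e => Between y e p ∧ Between y e z)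
    (N := gap y p) ⟨y, between_left y p, between_left y z⟩
    fun e he => by have := he.1.gap_eq; have := gap_nonneg e p; lia
  obtain ⟨s, ⟨hsp, hsq⟩, hs⟩ := exists_maximal z (P := fun e => Between z e p ∧ Between z e q)
    (N := gap z p) ⟨z, between_left z p, between_left z q⟩
    fun e he => by have := he.1.gap_eq; have := gap_nonneg e p; lia
  have vanish {w m e : B} (h : Between w m e) (hle : gap w e ≤ gap w m) : gap m e = 0 := by
    have h₁ := h.gap_eq
    have h₂ := gap_nonneg m e
    lia
  refine ⟨p, q, s, hpy, hqp.symm, hpz, hsp.symm, hqz, hsq.symm, equilateral_of_corners ?_ ?_ ?_⟩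
  · intro e heq hes
    have hy := hpy.trans (hqp.trans heq.symm).1.symm
    have hz := hpz.trans (hsp.trans hes.symm).1.symm
    exact vanish hy.2 (hp e ⟨hy.1, hz.1⟩)
  · intro e hep hes
    have hy := hqp.trans hep
    exact vanish hy.2 (hq e ⟨hy.1, (hqz.trans (hsq.trans hes.symm).1.symm).1⟩)
  · intro e hep heq
    have hz := hsp.trans hep
    exact vanish hz.2 (hs e ⟨hz.1, (hsq.trans heq).1⟩)

/-- Two points at the same distance from `p` and joined to `p` by pure geodesics of the same type
have a common median with `p`. -/
theorem exists_median {p s s' : B} (h : gap p s = gap p s')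
    (ht : (twist p s = gap p s ∧ twist p s' = gap p s) ∨
      (twist p s = 2 * gap p s ∧ twist p s' = 2 * gap p s)) :
    ∃ u, Between p u s ∧ Between p u s' ∧ Between s u s' := by
  obtain ⟨u, v, w, hus, hvs, hus', hws', hv, hw, he⟩ := exists_core p s s'
  have h₁ := hus.gap_eq
  have h₂ := hvs.gap_eq
  have h₃ := hus'.gap_eq
  have h₄ := hws'.gap_eq
  have h₅ := hus.twist_eq
  have h₆ := hvs.twist_eq
  have h₇ := hus'.twist_eq
  have h₈ := hws'.twist_eq
  have h₉ (m n : B) : gap m n ≤ twist m n ∧ twist m n ≤ 2 * gap m n :=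
    ⟨gap_le_twist m n, twist_le m n⟩
  have p₁ := h₉ p u
  have p₂ := h₉ u v
  have p₃ := h₉ v s
  have p₄ := h₉ u w
  have p₅ := h₉ w s'
  have h₁₀ := twist_add_twist w u
  have h₁₁ := gap_comm w u
  have h₁₂ : gap v u = 0 := by
    rw [gap_comm]
    unfold Equilateral at he
    lia
  exact ⟨u, hus, hus', hv.of_gap_eq_zero h₁₂⟩

theorem Equilateral.exists_median {n : ℤ} {p q s s' : B} (h : Equilateral n p q s)
    (h' : Equilateral n p q s') :
    (∃ u, Between p u s ∧ Between p u s' ∧ Between s u s') ∧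
      ∃ v, Between q v s ∧ Between q v s' ∧ Between s v s' := by
  have h₁ := twist_add_twist s p
  have h₂ := twist_add_twist s' p
  have h₃ := gap_comm s p
  have h₄ := gap_comm s' p
  have h₅ := gap_nonneg p q
  unfold Equilateral at h h'
  constructor <;> refine DualGarside.exists_median ?_ ?_ <;> lia

theorem Equilateral.mul_left {n : ℤ} {p q s : B} (h : Equilateral n p q s) (g : B) :
    Equilateral n (g * p) (g * q) (g * s) := by
  simpa only [Equilateral, gap_mul_left, twist_mul_left] using h

theorem equilateral_mul_zpow_iff {n : ℤ} {p q s : B} (i j k : ℤ) :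
    Equilateral n (p * gar ^ i) (q * gar ^ j) (s * gar ^ k) ↔ Equilateral n p q s := by
  simp only [Equilateral, gap_mul_zpow, twist_mul_zpow]

variable {Γ : Type*} [Group Γ] {φ : B →* Γ}

theorem exists_eq_mul_zpow_of_map_eq (hker : ∀ x, φ x = 1 → ∃ k : ℤ, x = gar ^ k) {x x' : B}
    (h : φ x' = φ x) : ∃ k : ℤ, x' = x * gar ^ k := by
  obtain ⟨k, hk⟩ := hker (x⁻¹ * x') (by rw [map_mul, map_inv, h, inv_mul_cancel])
  exact ⟨k, by rw [← hk, mul_inv_cancel_left]⟩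

theorem encard_image_segment_le (hgar : φ gar ^ 4 = 1) (x y : B) (r : ℕ) :
    (φ '' {m | Between x m y ∧ gap x m ≤ r}).encard ≤ ((r + 1) * ((2 * r + 1) * 4) : ℕ) := by
  classical
  let F : ℕ × ℕ × ℕ → Γ := fun t =>
    if h : ∃ m, Between x m y ∧ gap x m = t.1 ∧ twist x m = t.2.1 then
      φ h.choose * φ gar ^ t.2.2 else 1
  let A := Finset.range (r + 1) ×ˢ Finset.range (2 * r + 1) ×ˢ Finset.range 4
  have hA : A.card = (r + 1) * ((2 * r + 1) * 4) := by simp [A]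
  rw [← hA]
  calc (φ '' {m | Between x m y ∧ gap x m ≤ r}).encard
      ≤ (A.image F : Set Γ).encard := Set.encard_le_encard ?_
    _ ≤ A.card := by
      rw [Set.encard_coe_eq_coe_finsetCard]
      exact_mod_cast Finset.card_image_le
  rintro _ ⟨m, ⟨hm, hr⟩, rfl⟩
  have h₁ := gap_nonneg x m
  have h₂ := gap_le_twist x m
  have h₃ := twist_le x m
  have h : ∃ m', Between x m' y ∧ gap x m' = (gap x m).toNat ∧
      twist x m' = (twist x m).toNat := ⟨m, hm, by lia, by lia⟩
  obtain ⟨i, hi⟩ := exists_eq_mul_zpow_of_between h.choose_spec.1 hm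
    (h.choose_spec.2.1.trans (by lia)) (h.choose_spec.2.2.trans (by lia))
  refine Finset.mem_coe.2 (Finset.mem_image.2
    ⟨((gap x m).toNat, (twist x m).toNat, (i % 4).toNat), ?_, ?_⟩)
  · simp only [A, Finset.mem_product, Finset.mem_range]
    lia
  · have hpow : φ gar ^ (i % 4).toNat = φ gar ^ i := by
      rw [← zpow_natCast, Int.toNat_of_nonneg (by lia)]
      conv_rhs => rw [← Int.emod_add_mul_ediv i 4, zpow_add, zpow_mul]
      rw [show (4 : ℤ) = (4 : ℕ) from rfl, zpow_natCast (φ gar) 4, hgar, one_zpow, mul_one]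
    simp only [F, dif_pos h]
    rw [hpow, ← map_zpow, ← map_mul, ← hi]

/-- The core structure on a quotient by a group of powers of the Garside element. -/
def coreStructure (hsurj : Function.Surjective φ) (hker : ∀ x, φ x = 1 → ∃ k : ℤ, x = gar ^ k)
    (hgar : φ gar ^ 4 = 1) (r : ℕ) :
    CoreStructure Γ (fun g => ∃ x, φ x = g ∧ gap 1 x ≤ r) ((r + 1) * ((2 * r + 1) * 4)) where
  J X Y M := ∃ x y m, φ x = X ∧ φ y = Y ∧ φ m = M ∧ Between x m y ∧ gap x m ≤ r
  E P Q S := ∃ (n : ℤ) (p q s : B), φ p = P ∧ φ q = Q ∧ φ s = S ∧ Equilateral n p q s ∧ n ≤ r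
  mul_left_J g := by
    obtain ⟨g, rfl⟩ := hsurj g
    rintro ⟨x, y, m, rfl, rfl, rfl, h, hr⟩
    exact ⟨g * x, g * y, g * m, map_mul .., map_mul .., map_mul .., (between_mul_left g).2 h,
      by rwa [gap_mul_left]⟩
  mul_left_E g := by
    obtain ⟨g, rfl⟩ := hsurj g
    rintro ⟨n, p, q, s, rfl, rfl, rfl, h, hr⟩
    exact ⟨n, g * p, g * q, g * s, map_mul .., map_mul .., map_mul .., h.mul_left g, hr⟩
  encard_le X Y := by
    obtain ⟨x, rfl⟩ := hsurj X
    obtain ⟨y, rfl⟩ := hsurj Y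
    refine (Set.encard_le_encard ?_).trans (encard_image_segment_le hgar x y r)
    rintro _ ⟨x', y', m, hx, hy, rfl, h, hr⟩
    obtain ⟨i, rfl⟩ := exists_eq_mul_zpow_of_map_eq hker hx
    obtain ⟨j, rfl⟩ := exists_eq_mul_zpow_of_map_eq hker hy
    refine ⟨m, ⟨(between_mul_zpow_iff i 0 j).1 (by simpa using h), ?_⟩, rfl⟩
    have := gap_mul_zpow x m i 0
    rw [zpow_zero, mul_one] at this
    lia
  exists_core X Y Z := by
    rintro ⟨t, ht, hr⟩
    obtain ⟨x, rfl⟩ := hsurj X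
    obtain ⟨z, rfl⟩ := hsurj Z
    obtain rfl : φ (x * t) = Y := by rw [map_mul, ht, mul_inv_cancel_left]
    have hxy : gap x (x * t) ≤ r := by simpa only [mul_one] using (gap_mul_left x 1 t).trans_le hr
    obtain ⟨p, q, s, hpy, hqy, hpz, hsz, hyq, hqs, he⟩ := DualGarside.exists_core x (x * t) z
    have hxq := hpy.trans hqy
    have hxs := hpz.trans hsz
    have hys := hyq.trans hqs
    have h₁ := hpy.gap_eq
    have h₂ := hqy.gap_eq
    have h₃ := hxq.2.gap_eq
    have h₄ := hxs.2.gap_eq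
    have h₅ := hys.2.gap_eq
    have h₆ := gap_nonneg x p
    have h₇ := gap_nonneg q (x * t)
    have h₈ := gap_comm q (x * t)
    have h₉ := gap_comm s p
    have h₁₀ := gap_nonneg p q
    have he' := he
    unfold Equilateral at he'
    refine ⟨φ p, φ q, φ s, ⟨_, p, q, s, rfl, rfl, rfl, he, by lia⟩,
      ⟨⟨x, x * t, p, rfl, rfl, rfl, hpy, by lia⟩, ⟨x, x * t, q, rfl, rfl, rfl, hxq.1, by lia⟩⟩,
      ⟨⟨x * t, z, q, rfl, rfl, rfl, hyq, by lia⟩, ⟨x * t, z, s, rfl, rfl, rfl, hys.1, by lia⟩⟩,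
      ⟨⟨x, z, s, rfl, rfl, rfl, hxs.1, by lia⟩, ⟨x, z, p, rfl, rfl, rfl, hpz, by lia⟩⟩⟩
  exists_median := by
    rintro _ _ _ _ ⟨n, p, q, s, rfl, rfl, rfl, h, hr⟩ ⟨n', p', q', s', hp, hq, rfl, h', -⟩
    obtain ⟨i, rfl⟩ := exists_eq_mul_zpow_of_map_eq hker hp
    obtain ⟨j, rfl⟩ := exists_eq_mul_zpow_of_map_eq hker hq
    have h' : Equilateral n' p q s' := (equilateral_mul_zpow_iff i j 0).1 (by simpa using h')
    obtain rfl : n = n' := h.1.symm.trans h'.1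
    obtain ⟨⟨u, hu, hu', hsu⟩, v, hv, hv', hsv⟩ := h.exists_median h'
    have h₁ := hu.gap_eq
    have h₂ := hv.gap_eq
    have h₃ := gap_comm s p
    have h₄ := gap_comm u s
    have h₅ := gap_comm v s
    have h₆ := gap_nonneg p u
    have h₇ := gap_nonneg q v
    have h₈ := gap_nonneg s u
    have h₉ := gap_nonneg s v
    unfold Equilateral at h
    exact ⟨φ u, φ v,
      ⟨⟨p, s, u, rfl, rfl, rfl, hu, by lia⟩, ⟨p, s', u, rfl, rfl, rfl, hu', by lia⟩⟩,
      ⟨⟨q, s, v, rfl, rfl, rfl, hv, by lia⟩, ⟨q, s', v, rfl, rfl, rfl, hv', by lia⟩⟩,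
      ⟨⟨s, s', u, rfl, rfl, rfl, hsu, by lia⟩, ⟨s, s', v, rfl, rfl, rfl, hsv, by lia⟩⟩⟩

end DualGarside

/-! ### The triple convolution estimate -/

namespace CoreStructure

open scoped ENNReal

section Sums

variable {ι κ μ : Type*}

theorem tsum_mul_sq_le (f g : ι → ℝ≥0∞) :
    (∑' i, f i * g i) ^ 2 ≤ (∑' i, f i ^ 2) * ∑' i, g i ^ 2 := by
  have h : ∑' i, f i * g i ≤ ((∑' i, f i ^ 2) * ∑' i, g i ^ 2) ^ (1 / 2 : ℝ) := by
    refine ENNReal.summable.tsum_le_of_sum_le fun s => ?_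
    refine (ENNReal.inner_le_Lp_mul_Lq s f g Real.HolderConjugate.two_two).trans ?_
    simp only [ENNReal.rpow_two]
    rw [← ENNReal.mul_rpow_of_nonneg _ _ (by norm_num)]
    gcongr <;> exact ENNReal.sum_le_tsum s
  calc _ ≤ (((∑' i, f i ^ 2) * ∑' i, g i ^ 2) ^ (1 / 2 : ℝ)) ^ 2 := by gcongr
    _ = _ := by
      rw [← ENNReal.rpow_natCast, ← ENNReal.rpow_mul]
      norm_num

theorem tsum_tsum_tsum_mul_sq_le (f : ι → κ → ℝ≥0∞) (g : κ → μ → ℝ≥0∞) (h : ι → μ → ℝ≥0∞) :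
    (∑' x, ∑' y, ∑' z, f x y * g y z * h x z) ^ 2 ≤
      (∑' x, ∑' y, f x y ^ 2) * (∑' y, ∑' z, g y z ^ 2) * ∑' x, ∑' z, h x z ^ 2 := by
  have h₁ : ∑' x, ∑' y, ∑' z, f x y * g y z * h x z =
      ∑' t : ι × μ, (∑' y, f t.1 y * g y t.2) * h t.1 t.2 := by
    rw [ENNReal.tsum_prod (f := fun x z => (∑' y, f x y * g y z) * h x z)]
    exact tsum_congr fun x => ENNReal.tsum_comm.trans (tsum_congr fun z => ENNReal.tsum_mul_right)
  rw [h₁]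
  refine (tsum_mul_sq_le _ _).trans ?_
  rw [← ENNReal.tsum_prod (f := fun x z => h x z ^ 2)]
  gcongr
  calc ∑' t : ι × μ, (∑' y, f t.1 y * g y t.2) ^ 2
      ≤ ∑' t : ι × μ, (∑' y, f t.1 y ^ 2) * ∑' y, g y t.2 ^ 2 :=
        ENNReal.tsum_le_tsum fun t => tsum_mul_sq_le _ _
    _ = (∑' x, ∑' y, f x y ^ 2) * ∑' y, ∑' z, g y z ^ 2 := by
        rw [ENNReal.tsum_prod (f := fun x z => (∑' y, f x y ^ 2) * ∑' y, g y z ^ 2),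
          ENNReal.tsum_comm (f := fun y z => g y z ^ 2),
          ← ENNReal.tsum_mul_right]
        exact tsum_congr fun x => ENNReal.tsum_mul_left

theorem tsum_rotate {ν : Type*} (f : ι → κ → μ → ν → ℝ≥0∞) :
    ∑' x, ∑' y, ∑' z, ∑' t, f x y z t = ∑' t, ∑' x, ∑' y, ∑' z, f x y z t := by
  rw [ENNReal.tsum_comm (f := fun t x => ∑' y, ∑' z, f x y z t)]
  refine tsum_congr fun x => ?_
  rw [ENNReal.tsum_comm (f := fun t y => ∑' z, f x y z t)]
  exact tsum_congr fun y => ENNReal.tsum_comm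

end Sums

open Classical in
/-- The indicator of a proposition. -/
noncomputable def ind (p : Prop) : ℝ≥0∞ := if p then 1 else 0

theorem ind_of {p : Prop} (h : p) : ind p = 1 := if_pos h

theorem ind_sq (p : Prop) : ind p ^ 2 = ind p := by
  unfold ind
  split <;> simp

theorem tsum_ind {ι : Type*} (p : ι → Prop) : ∑' i, ind (p i) = {i | p i}.encard := by
  rw [← ENNReal.tsum_set_one, tsum_subtype {i | p i} fun _ => (1 : ℝ≥0∞)]
  rfl

variable {Γ : Type*} [Group Γ]

/-- Invariance of a kernel under left translations. -/
def Invariant (K : Γ → Γ → ℝ≥0∞) : Prop := ∀ g x y, K (g * x) (g * y) = K x y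

theorem tsum_translate (g : Γ) {f f' : Γ → ℝ≥0∞} (h : ∀ x, f (g * x) = f' x) :
    ∑' x, f x = ∑' x, f' x := by
  rw [← (Equiv.mulLeft g).tsum_eq]
  exact tsum_congr h

theorem Invariant.tsum_rebase {K : Γ → Γ → ℝ≥0∞} (h : Invariant K) :
    ∑' y, K 1 y = ∑' x, K x 1 := by
  rw [← (Equiv.inv Γ).tsum_eq]
  refine tsum_congr fun x => ?_
  rw [← h x, mul_one, Equiv.inv_apply, mul_inv_cancel]

theorem Invariant.tsum_left {K : Γ → Γ → ℝ≥0∞} (h : Invariant K) (y : Γ) :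
    ∑' x, K x y = ∑' x, K x 1 :=
  tsum_translate y fun x => by rw [← h y x 1, mul_one]

variable {D : Γ → Prop} {Q : ℕ} (S : CoreStructure Γ D Q)

theorem J_mul_left_iff (g x y m : Γ) : S.J (g * x) (g * y) (g * m) ↔ S.J x y m :=
  ⟨fun h => by simpa using S.mul_left_J g⁻¹ h, S.mul_left_J g⟩

theorem E_mul_left_iff (g p q s : Γ) : S.E (g * p) (g * q) (g * s) ↔ S.E p q s :=
  ⟨fun h => by simpa using S.mul_left_E g⁻¹ h, S.mul_left_E g⟩

theorem tsum_ind_J_le (x y : Γ) : ∑' m, ind (S.J x y m) ≤ Q := by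
  rw [tsum_ind]
  exact_mod_cast ENat.toENNReal_le.2 (S.encard_le x y)

/-- The pairing of the sections of a kernel over the medians. -/
noncomputable def medianKernel (K : Γ → Γ → ℝ≥0∞) (p s s' : Γ) : ℝ≥0∞ :=
  ∑' u, ind (S.J s s' u) * ((ind (S.J p s u) * K p s) * (ind (S.J p s' u) * K p s'))

variable {S}

theorem medianKernel_mul_left {K : Γ → Γ → ℝ≥0∞} (hK : Invariant K) (g p s s' : Γ) :
    S.medianKernel K (g * p) (g * s) (g * s') = S.medianKernel K p s s' :=
  tsum_translate g fun u => by simp only [S.J_mul_left_iff, hK g]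

theorem tsum_medianKernel_sq_le {K : Γ → Γ → ℝ≥0∞} (hK : Invariant K) :
    ∑' s', (∑' p, S.medianKernel K p 1 s') ^ 2 ≤ (Q ^ 3 : ℝ≥0∞) * (∑' y, K 1 y ^ 2) ^ 2 := by
  let M (s u : Γ) : ℝ≥0∞ := ∑' p, (ind (S.J p s u) * K p s) ^ 2
  have hM : Invariant M := fun g s u =>
    tsum_translate g fun p => by simp only [S.J_mul_left_iff, hK g]
  have hM₁ : ∑' u, M 1 u ≤ Q * ∑' y, K 1 y ^ 2 := by
    have hK₂ : Invariant fun x y => K x y ^ 2 := fun g x y => by simp only [hK g]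
    rw [ENNReal.tsum_comm, hK₂.tsum_rebase, ← ENNReal.tsum_mul_left]
    refine ENNReal.tsum_le_tsum fun p => ?_
    simp only [mul_pow, ind_sq]
    rw [ENNReal.tsum_mul_right]
    gcongr
    exact S.tsum_ind_J_le p 1
  have hle (s' : Γ) : (∑' p, S.medianKernel K p 1 s') ^ 2 ≤ Q * ∑' u, M 1 u * M s' u := by
    have : ∑' p, S.medianKernel K p 1 s' = ∑' u, ind (S.J 1 s' u) *
        ∑' p, (ind (S.J p 1 u) * K p 1) * (ind (S.J p s' u) * K p s') := by
      unfold medianKernel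
      rw [ENNReal.tsum_comm]
      exact tsum_congr fun u => ENNReal.tsum_mul_left
    rw [this]
    refine (tsum_mul_sq_le _ _).trans ?_
    simp only [ind_sq]
    gcongr with u
    · exact S.tsum_ind_J_le 1 s'
    · exact tsum_mul_sq_le _ _
  calc ∑' s', (∑' p, S.medianKernel K p 1 s') ^ 2
      ≤ ∑' s', Q * ∑' u, M 1 u * M s' u := ENNReal.tsum_le_tsum hle
    _ = Q * ((∑' u, M 1 u) * ∑' u, M 1 u) := by
      rw [ENNReal.tsum_mul_left, ENNReal.tsum_comm, ← ENNReal.tsum_mul_right]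
      congr 1
      refine tsum_congr fun u => ?_
      rw [ENNReal.tsum_mul_left, hM.tsum_left, hM.tsum_rebase]
    _ ≤ Q * ((Q * ∑' y, K 1 y ^ 2) * (Q * ∑' y, K 1 y ^ 2)) := by gcongr
    _ = _ := by ring

theorem ind_E_mul_le (G H : Γ → Γ → ℝ≥0∞) (p q s s' : Γ) :
    (ind (S.E p q s) * (G q s * H p s)) * (ind (S.E p q s') * (G q s' * H p s')) ≤
      S.medianKernel H p s s' * S.medianKernel G q s s' := by
  by_cases h : S.E p q s ∧ S.E p q s'
  · obtain ⟨u, v, hu, hv, huv⟩ := S.exists_median h.1 h.2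
    unfold medianKernel
    refine le_trans (le_of_eq ?_) (mul_le_mul' (ENNReal.le_tsum u) (ENNReal.le_tsum v))
    simp only [ind_of, *]
    ring
  · rw [not_and_or] at h
    rcases h with h | h <;> simp [ind, h]

/-- The estimate for equilateral triangles. -/
theorem tsum_equilateral_sq_le {F G H : Γ → Γ → ℝ≥0∞} (hG : Invariant G) (hH : Invariant H) :
    (∑' q, ∑' s, ind (S.E 1 q s) * (F 1 q * G q s * H 1 s)) ^ 2 ≤
      (Q ^ 3 : ℝ≥0∞) * ((∑' y, F 1 y ^ 2) * (∑' y, G 1 y ^ 2) * ∑' y, H 1 y ^ 2) := by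
  have hsum : ∑' q, (∑' s, ind (S.E 1 q s) * (G q s * H 1 s)) ^ 2 ≤
      (Q ^ 3 : ℝ≥0∞) * ((∑' y, H 1 y ^ 2) * ∑' y, G 1 y ^ 2) := by
    let T (p s : Γ) : ℝ≥0∞ :=
      ∑' s', S.medianKernel H p s s' * ∑' q, S.medianKernel G q s s'
    have hT : Invariant T := fun g p s => tsum_translate g fun s' => by
      rw [medianKernel_mul_left hH]
      congr 1
      exact tsum_translate g fun q => medianKernel_mul_left hG ..
    calc ∑' q, (∑' s, ind (S.E 1 q s) * (G q s * H 1 s)) ^ 2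
        ≤ ∑' q, ∑' s, ∑' s', S.medianKernel H 1 s s' * S.medianKernel G q s s' := by
          refine ENNReal.tsum_le_tsum fun q => ?_
          rw [sq, ← ENNReal.tsum_mul_right]
          refine ENNReal.tsum_le_tsum fun s => ?_
          rw [← ENNReal.tsum_mul_left]
          exact ENNReal.tsum_le_tsum fun s' => ind_E_mul_le G H 1 q s s'
      _ = ∑' s, T 1 s := by
          rw [ENNReal.tsum_comm]
          refine tsum_congr fun s => ?_
          rw [ENNReal.tsum_comm]
          exact tsum_congr fun s' => ENNReal.tsum_mul_left
      _ = ∑' s', (∑' p, S.medianKernel H p 1 s') * ∑' q, S.medianKernel G q 1 s' := by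
          rw [hT.tsum_rebase, ENNReal.tsum_comm]
          exact tsum_congr fun s' => ENNReal.tsum_mul_right
      _ ≤ _ := by
          rw [← ENNReal.pow_le_pow_left_iff two_ne_zero]
          refine (tsum_mul_sq_le _ _).trans ((mul_le_mul' (tsum_medianKernel_sq_le hH)
            (tsum_medianKernel_sq_le hG)).trans_eq ?_)
          ring
  have h₁ : ∑' q, ∑' s, ind (S.E 1 q s) * (F 1 q * G q s * H 1 s) =
      ∑' q, F 1 q * ∑' s, ind (S.E 1 q s) * (G q s * H 1 s) := by
    refine tsum_congr fun q => ?_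
    rw [← ENNReal.tsum_mul_left]
    exact tsum_congr fun s => by ring
  rw [h₁]
  calc _ ≤ _ := tsum_mul_sq_le _ _
    _ ≤ _ := mul_le_mul_right hsum _
    _ = _ := by ring

variable (S)

/-- The Hilbert-Schmidt norm of the part of a kernel supported on the segments through `p` and
`q`. -/
noncomputable def throughKernel (K : Γ → Γ → ℝ≥0∞) (p q : Γ) : ℝ≥0∞ :=
  (∑' x, ∑' y, (ind (S.J x y p ∧ S.J x y q) * K x y) ^ 2) ^ (1 / 2 : ℝ)

variable {S}

theorem throughKernel_sq (K : Γ → Γ → ℝ≥0∞) (p q : Γ) :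
    S.throughKernel K p q ^ 2 = ∑' x, ∑' y, (ind (S.J x y p ∧ S.J x y q) * K x y) ^ 2 := by
  rw [throughKernel, ← ENNReal.rpow_natCast, ← ENNReal.rpow_mul]
  norm_num

theorem invariant_throughKernel {K : Γ → Γ → ℝ≥0∞} (hK : Invariant K) :
    Invariant (S.throughKernel K) := fun g p q => by
  unfold throughKernel
  congr 1
  exact tsum_translate g fun x => tsum_translate g fun y => by
    simp only [S.J_mul_left_iff, hK g]

theorem tsum_throughKernel_sq_le {K : Γ → Γ → ℝ≥0∞} (hK : Invariant K) :
    ∑' q, S.throughKernel K 1 q ^ 2 ≤ (Q ^ 2 : ℝ≥0∞) * ∑' y, K 1 y ^ 2 := by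
  let T (x p : Γ) : ℝ≥0∞ := ∑' y, ∑' q, ind (S.J x y p) * ind (S.J x y q) * K x y ^ 2
  have hT : Invariant T := fun g x p => tsum_translate g fun y => tsum_translate g fun q => by
    simp only [S.J_mul_left_iff, hK g]
  have hind (p q : Prop) : ind (p ∧ q) = ind p * ind q := by
    by_cases hp : p <;> by_cases hq : q <;> simp [ind, hp, hq]
  calc ∑' q, S.throughKernel K 1 q ^ 2 = ∑' x, T x 1 := by
        simp only [throughKernel_sq, mul_pow, ind_sq, hind]
        rw [ENNReal.tsum_comm]
        exact tsum_congr fun x => ENNReal.tsum_comm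
    _ = ∑' y, (∑' p, ind (S.J 1 y p)) * (∑' q, ind (S.J 1 y q)) * K 1 y ^ 2 := by
        rw [← hT.tsum_rebase, ENNReal.tsum_comm]
        refine tsum_congr fun y => ?_
        simp only [ENNReal.tsum_mul_right, ENNReal.tsum_mul_left]
    _ ≤ ∑' y, Q * Q * K 1 y ^ 2 := by
        gcongr with y <;> exact S.tsum_ind_J_le 1 y
    _ = _ := by rw [ENNReal.tsum_mul_left, sq]

/-- The triple convolution estimate, for invariant kernels. -/
theorem tsum_triangle_sq_le (S : CoreStructure Γ D Q) {F G H : Γ → Γ → ℝ≥0∞}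
    (hF : Invariant F) (hG : Invariant G) (hH : Invariant H) (hD : ∀ y, F 1 y ≠ 0 → D y) :
    (∑' y, ∑' z, F 1 y * G y z * H 1 z) ^ 2 ≤
      (Q ^ 9 : ℝ≥0∞) * ((∑' y, F 1 y ^ 2) * (∑' y, G 1 y ^ 2) * ∑' y, H 1 y ^ 2) := by
  let Φ (x y z p q s : Γ) : ℝ≥0∞ := ind (S.E p q s) *
    ((ind (S.J x y p ∧ S.J x y q) * F x y) * (ind (S.J y z q ∧ S.J y z s) * G y z) *
      (ind (S.J x z p ∧ S.J x z s) * H x z))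
  have hle (y z : Γ) : F 1 y * G y z * H 1 z ≤ ∑' p, ∑' q, ∑' s, Φ 1 y z p q s := by
    by_cases hy : F 1 y = 0
    · simp [hy]
    obtain ⟨p, q, s, he, hxy, hyz, hs, hp⟩ :=
      S.exists_core 1 y z (by simpa using hD y hy)
    have : Φ 1 y z p q s = F 1 y * G y z * H 1 z := by
      simp only [Φ, ind_of, he, hxy, hyz, hs, hp, and_self, one_mul]
    rw [← this]
    exact (ENNReal.le_tsum s).trans ((ENNReal.le_tsum (f := fun q => ∑' s, Φ 1 y z p q s) q).trans
      (ENNReal.le_tsum (f := fun p => ∑' q, ∑' s, Φ 1 y z p q s) p))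
  let T (x p : Γ) : ℝ≥0∞ := ∑' y, ∑' z, ∑' q, ∑' s, Φ x y z p q s
  have hT : Invariant T := fun g x p => tsum_translate g fun y => tsum_translate g fun z =>
    tsum_translate g fun q => tsum_translate g fun s => by
      simp only [Φ, S.J_mul_left_iff, S.E_mul_left_iff, hF g, hG g, hH g]
  have hfix (q s : Γ) : ∑' x, ∑' y, ∑' z, Φ x y z 1 q s ≤ ind (S.E 1 q s) *
      (S.throughKernel F 1 q * S.throughKernel G q s * S.throughKernel H 1 s) := by
    simp only [Φ, ENNReal.tsum_mul_left]
    gcongr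
    rw [← ENNReal.pow_le_pow_left_iff two_ne_zero, mul_pow, mul_pow]
    simp only [throughKernel_sq]
    exact tsum_tsum_tsum_mul_sq_le _ _ _
  have htotal : ∑' y, ∑' z, F 1 y * G y z * H 1 z ≤ ∑' q, ∑' s, ind (S.E 1 q s) *
      (S.throughKernel F 1 q * S.throughKernel G q s * S.throughKernel H 1 s) :=
    calc _ ≤ ∑' y, ∑' z, ∑' p, ∑' q, ∑' s, Φ 1 y z p q s :=
          ENNReal.tsum_le_tsum fun y => ENNReal.tsum_le_tsum fun z => hle y z
      _ = ∑' p, T 1 p := by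
          rw [ENNReal.tsum_comm (f := fun p y => ∑' z, ∑' q, ∑' s, Φ 1 y z p q s)]
          exact tsum_congr fun y => ENNReal.tsum_comm
      _ = ∑' q, ∑' s, ∑' x, ∑' y, ∑' z, Φ x y z 1 q s := by
          rw [hT.tsum_rebase, tsum_rotate]
          exact tsum_congr fun q => tsum_rotate _
      _ ≤ _ := ENNReal.tsum_le_tsum fun q => ENNReal.tsum_le_tsum fun s => hfix q s
  calc _ ≤ _ := pow_le_pow_left' htotal 2
    _ ≤ _ := tsum_equilateral_sq_le (invariant_throughKernel hG) (invariant_throughKernel hH)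
    _ ≤ (Q ^ 3 : ℝ≥0∞) * ((Q ^ 2 * ∑' y, F 1 y ^ 2) * (Q ^ 2 * ∑' y, G 1 y ^ 2) *
        (Q ^ 2 * ∑' y, H 1 y ^ 2)) := by
        gcongr <;> exact tsum_throughKernel_sq_le ‹_›
    _ = _ := by ring

end CoreStructure

/-! ### From the triple convolution estimate to the operator norm -/

namespace CoreStructure

open scoped ENNReal

variable {Γ : Type*} [Group Γ]

theorem conv_apply (f g : Γ →₀ ℂ) (x : Γ) :
    conv f g x = ∑ y ∈ f.support, f y * g (y⁻¹ * x) := by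
  classical
  rw [conv, Finsupp.sum_apply, Finsupp.sum]
  refine Finset.sum_congr rfl fun y _ => ?_
  have h (t : Γ) : Finsupp.single (y * t) (f y * g t) x =
      if t = y⁻¹ * x then f y * g t else 0 := by
    simp only [Finsupp.single_apply, eq_inv_mul_iff_mul_eq]
  rw [Finsupp.sum, Finsupp.finsetSum_apply]
  simp only [h, Finset.sum_ite_eq', Finsupp.mem_support_iff]
  split_ifs with h₀
  · rfl
  · rw [not_not.1 h₀, mul_zero]

theorem enorm_conv_apply_le (f g : Γ →₀ ℂ) (x : Γ) :
    ‖conv f g x‖ₑ ≤ ∑' y, ‖f y‖ₑ * ‖g (y⁻¹ * x)‖ₑ := by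
  rw [conv_apply]
  refine (enorm_sum_le _ _).trans ?_
  simp only [enorm_mul]
  exact ENNReal.sum_le_tsum _

theorem tsum_enorm_sq {α : Type*} (f : α →₀ ℂ) :
    ∑' x, ‖f x‖ₑ ^ 2 = ENNReal.ofReal (l2norm f ^ 2) := by
  have h : 0 ≤ f.sum fun _ t => ‖t‖ ^ 2 := Finset.sum_nonneg fun _ _ => by positivity
  rw [l2norm, Real.sq_sqrt h, tsum_eq_sum (s := f.support) (by simp), Finsupp.sum,
    ENNReal.ofReal_sum_of_nonneg fun _ _ => by positivity]
  exact Finset.sum_congr rfl fun x _ => by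
    rw [ENNReal.ofReal_pow (norm_nonneg _), ofReal_norm]

variable {D : Γ → Prop} {Q : ℕ}

theorem l2norm_conv_le (S : CoreStructure Γ D Q) {f : Γ →₀ ℂ} (hf : ∀ x, f x ≠ 0 → D x)
    (g : Γ →₀ ℂ) : l2norm (conv f g) ≤ (Q ^ 5 : ℝ) * l2norm f * l2norm g := by
  have hnonneg (f : Γ →₀ ℂ) : 0 ≤ l2norm f := Real.sqrt_nonneg _
  let K (f : Γ →₀ ℂ) (x y : Γ) : ℝ≥0∞ := ‖f (x⁻¹ * y)‖ₑ
  have hK (f : Γ →₀ ℂ) : Invariant (K f) := fun g x y => by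
    simp only [K, mul_inv_rev, mul_assoc, inv_mul_cancel_left]
  have hK₁ (f : Γ →₀ ℂ) (y : Γ) : K f 1 y = ‖f y‖ₑ := by simp only [K, inv_one, one_mul]
  have hT := S.tsum_triangle_sq_le (hK f) (hK g) (hK (conv f g))
    fun y hy => hf y fun h₀ => hy (by rw [hK₁, h₀, enorm_zero])
  have hle : ∑' x, ‖conv f g x‖ₑ ^ 2 ≤ ∑' y, ∑' z, K f 1 y * K g y z * K (conv f g) 1 z := by
    rw [ENNReal.tsum_comm]
    refine ENNReal.tsum_le_tsum fun z => ?_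
    simp only [hK₁]
    rw [ENNReal.tsum_mul_right, sq]
    gcongr
    exact enorm_conv_apply_le f g z
  replace hT := (pow_le_pow_left' hle 2).trans hT
  simp only [hK₁, tsum_enorm_sq] at hT
  rw [← ENNReal.ofReal_pow (by positivity), ← ENNReal.ofReal_mul (by positivity),
    ← ENNReal.ofReal_mul (by positivity), ← ENNReal.ofReal_natCast,
    ← ENNReal.ofReal_pow (by positivity), ← ENNReal.ofReal_mul (by positivity),
    ENNReal.ofReal_le_ofReal_iff (by positivity)] at hT
  have hQ : (Q : ℝ) ^ 9 ≤ (Q : ℝ) ^ 10 := by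
    rcases Q.eq_zero_or_pos with rfl | hpos
    · simp
    · exact pow_le_pow_right₀ (by exact_mod_cast hpos) (by norm_num)
  rcases (hnonneg (conv f g)).eq_or_lt with h₀ | h₀
  · rw [← h₀]
    have := hnonneg f
    have := hnonneg g
    positivity
  · have hf₀ := hnonneg f
    have hg₀ := hnonneg g
    refine le_of_sq_le_sq ?_ (by positivity)
    refine le_of_mul_le_mul_right (a := l2norm (conv f g) ^ 2) ?_ (by positivity)
    calc _ = (l2norm (conv f g) ^ 2) ^ 2 := by ring
      _ ≤ _ := hT
      _ = Q ^ 9 * (l2norm f ^ 2 * l2norm g ^ 2 * l2norm (conv f g) ^ 2) := rfl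
      _ ≤ Q ^ 10 * (l2norm f ^ 2 * l2norm g ^ 2 * l2norm (conv f g) ^ 2) := by gcongr
      _ = _ := by ring

end CoreStructure

/-! ### Property RD for the central quotient -/

namespace DualBraid

noncomputable instance : PartialOrder B4 where
  le x y := x⁻¹ * y ∈ positive
  le_refl x := by simp [one_mem]
  le_trans x y t hxy hyt := by simpa [mul_assoc] using mul_mem hxy hyt
  le_antisymm x y hxy hyx := by
    have h := rank_nonneg hyx
    have h' : rank (x⁻¹ * y) = -rank (y⁻¹ * x) := by
      rw [← rank_inv, mul_inv_rev, inv_inv]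
    exact inv_mul_eq_one.1 (eq_one_of_rank_eq_zero hxy (by have := rank_nonneg hxy; lia))

theorem le_iff {x y : B4} : x ≤ y ↔ x⁻¹ * y ∈ positive := Iff.rfl

theorem rank_eq_add (x y : B4) : rank y = rank x + rank (x⁻¹ * y) := by
  rw [← rank_mul, mul_inv_cancel_left]

noncomputable instance : DualGarside B4 where
  inf x y := (exists_meet x y).choose
  inf_le_left x y := (exists_meet x y).choose_spec.1
  inf_le_right x y := (exists_meet x y).choose_spec.2.1
  le_inf e x y := (exists_meet x y).choose_spec.2.2 e
  rk := rank
  gar := delta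
  mul_le_mul_left' x y y' h := by
    rw [le_iff] at h ⊢
    rwa [mul_inv_rev, mul_assoc, inv_mul_cancel_left]
  rk_mul := rank_mul
  rk_lt {x y} h := by
    have h₁ := rank_nonneg (le_iff.1 h.le)
    have h₂ : rank (x⁻¹ * y) ≠ 0 := fun h₀ =>
      h.ne (inv_mul_eq_one.1 (eq_one_of_rank_eq_zero (le_iff.1 h.le) h₀))
    have := rank_eq_add x y
    lia
  rk_gar := rank_delta
  one_le_gar := by simpa [le_iff] using delta_mem
  mul_gar_le h := by
    rw [le_iff] at h ⊢
    simpa [mul_assoc] using delta_conj_inv_mem h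
  mul_gar_inv_le h := by
    rw [le_iff] at h ⊢
    simpa [mul_assoc] using delta_conj_mem h
  exists_atom {x y} h := by
    obtain h₁ | ⟨i, hi⟩ := eq_one_or_exists_atom (le_iff.1 h.le)
    · exact absurd (inv_mul_eq_one.1 h₁) h.ne
    have hr : rank (x * atom i) = rank x + 1 := by rw [rank_mul, rank_atom]
    refine ⟨x * atom i, lt_of_le_of_ne ?_ fun h₀ => ?_, ?_, ?_, hr⟩
    · simpa [le_iff] using atom_mem i
    · rw [← h₀] at hr
      lia
    · simpa [le_iff, mul_assoc] using hi
    · simpa [le_iff, mul_assoc] using atom_inv_mul_delta_mem i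
  exists_pow_inv_le x := by
    obtain ⟨n, hn⟩ := exists_delta_pow_mul_mem x
    exact ⟨n, by rwa [le_iff, inv_inv]⟩

theorem z_eq : z = delta ^ 4 := rfl

theorem commute_z (x : B4) : Commute z x := by
  have hatom (i : Atom) : Commute z (atom i) := by
    have h (k : ℕ) : delta ^ k * atom i = atom (rotate^[k] i) * delta ^ k := by
      induction k with
      | zero => simp
      | succ k ih =>
        rw [pow_succ', mul_assoc, ih, ← mul_assoc, delta_mul_atom, mul_assoc,
          Function.iterate_succ_apply']
    have hr : ∀ i : Atom, rotate^[4] i = i := by decide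
    exact z_eq ▸ (h 4).trans (by rw [hr])
  have hx := PresentedGroup.generated_by _ (Subgroup.centralizer {z}) (fun j => ?_) x
  · exact (Subgroup.mem_centralizer_singleton_iff.1 hx).symm
  refine Subgroup.mem_centralizer_singleton_iff.2 (Commute.symm ?_)
  fin_cases j
  exacts [hatom 0, hatom 4, hatom 2]

theorem exists_eq_delta_zpow {x : B4} (h : π x = 1) : ∃ k : ℤ, x = delta ^ k := by
  have hnormal : (Subgroup.zpowers z).Normal := ⟨by
    rintro _ ⟨k, rfl⟩ g
    exact ⟨k, by simp only [((commute_z g).zpow_left k).symm.eq, mul_inv_cancel_right]⟩⟩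
  obtain ⟨k, hk⟩ := Subgroup.mem_zpowers_iff.1 <|
    Subgroup.normalClosure_le_normal (N := Subgroup.zpowers z) (by simp)
      ((QuotientGroup.eq_one_iff x).1 h)
  exact ⟨4 * k, by rw [← hk, z_eq, zpow_mul, zpow_ofNat]⟩

theorem π_delta_pow : π delta ^ 4 = 1 := by
  rw [← map_pow]
  exact (QuotientGroup.eq_one_iff _).2 (Subgroup.subset_normalClosure rfl)

open DualGarside in
theorem gap_one_atom_le (i : Atom) : gap 1 (atom i) ≤ 1 := by
  have h₁ : height 1 (atom i) ≤ 1 := by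
    rw [← le_mul_zpow_iff, zpow_one, one_mul]
    exact atom_inv_mul_delta_mem i
  have h₂ : height (atom i) 1 ≤ 0 := height_le_zero.2 (by simpa [le_iff] using atom_mem i)
  unfold gap
  lia

open DualGarside in
theorem exists_gap_le_length (w : List G)
    (hw : ∀ s ∈ w, s ∈ ({π a, π b, π c} : Set G) ∨ s⁻¹ ∈ ({π a, π b, π c} : Set G)) :
    ∃ x, π x = w.prod ∧ gap 1 x ≤ w.length := by
  have hS {s : G} (hs : s ∈ ({π a, π b, π c} : Set G)) : ∃ i, π (atom i) = s := by
    rcases hs with rfl | rfl | rfl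
    exacts [⟨0, rfl⟩, ⟨4, rfl⟩, ⟨2, rfl⟩]
  have hgen {s : G} (hs : s ∈ ({π a, π b, π c} : Set G) ∨ s⁻¹ ∈ ({π a, π b, π c} : Set G)) :
      ∃ x, π x = s ∧ gap 1 x ≤ 1 := by
    rcases hs with hs | hs
    · obtain ⟨i, rfl⟩ := hS hs
      exact ⟨atom i, rfl, gap_one_atom_le i⟩
    · obtain ⟨i, hi⟩ := hS hs
      refine ⟨(atom i)⁻¹, by rw [map_inv, hi, inv_inv], ?_⟩
      rw [← gap_mul_left (atom i), mul_one, mul_inv_cancel, gap_comm]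
      exact gap_one_atom_le i
  induction w with
  | nil => exact ⟨1, map_one π, by simp [gap, height_self]⟩
  | cons s w ih =>
    obtain ⟨x, hx, hx'⟩ := ih fun t ht => hw t (List.mem_cons_of_mem s ht)
    obtain ⟨y, hy, hy'⟩ := hgen (hw s List.mem_cons_self)
    refine ⟨y * x, by rw [map_mul, hx, hy, List.prod_cons], ?_⟩
    have h₁ := gap_triangle 1 y (y * x)
    have h₂ := gap_mul_left y 1 x
    rw [mul_one] at h₂
    rw [List.length_cons]
    push_cast
    lia

theorem exists_word (g : G) : ∃ w : List G,
    (∀ s ∈ w, s ∈ ({π a, π b, π c} : Set G) ∨ s⁻¹ ∈ ({π a, π b, π c} : Set G)) ∧ w.prod = g := by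
  obtain ⟨x, rfl⟩ := QuotientGroup.mk'_surjective _ g
  have hx := PresentedGroup.generated_by _ ((Subgroup.closure {π a, π b, π c}).comap π)
    (fun j => Subgroup.subset_closure ?_) x
  · rw [Subgroup.mem_comap, ← Subgroup.mem_toSubmonoid, Subgroup.closure_toSubmonoid] at hx
    exact Submonoid.exists_list_of_mem_closure hx
  fin_cases j
  exacts [Or.inl rfl, Or.inr (Or.inl rfl), Or.inr (Or.inr rfl)]

theorem exists_gap_le_wordLength (g : G) :
    ∃ x, π x = g ∧ DualGarside.gap 1 x ≤ wordLength ({π a, π b, π c} : Set G) g := by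
  obtain ⟨w, hw, hg⟩ := exists_word g
  obtain ⟨w, hl, hw, rfl⟩ := Nat.sInf_mem (s := {n : ℕ | ∃ w : List G, w.length = n ∧
    (∀ s ∈ w, s ∈ ({π a, π b, π c} : Set G) ∨ s⁻¹ ∈ ({π a, π b, π c} : Set G)) ∧ w.prod = g})
    ⟨_, w, rfl, hw, hg⟩
  obtain ⟨x, hx, hx'⟩ := exists_gap_le_length w hw
  exact ⟨x, hx, hx'.trans (by rw [hl]; rfl)⟩

end DualBraid

/-- The central quotient `G = B₄/⟨z⟩` has property RD with respect to the word
length associated to the images of the generators `a, b, c`. -/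
theorem centralQuotientB4_hasPropertyRD :
    HasPropertyRD G (fun x => (wordLength ({π a, π b, π c} : Set G) x : ℝ)) := by
  refine ⟨((Polynomial.X + 1) * ((2 * Polynomial.X + 1) * 4)) ^ 5, fun r hr f g hf => ?_⟩
  let S := DualGarside.coreStructure (φ := π) (QuotientGroup.mk'_surjective _)
    (fun _ => DualBraid.exists_eq_delta_zpow) DualBraid.π_delta_pow ⌊r⌋₊
  refine (S.l2norm_conv_le (fun x hx => ?_) g).trans ?_
  · obtain ⟨y, hy, hy'⟩ := DualBraid.exists_gap_le_wordLength x
    exact ⟨y, hy, hy'.trans (by exact_mod_cast Nat.le_floor (hf x hx))⟩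
  · have hfloor := Nat.floor_le hr
    have h₁ : 0 ≤ l2norm f := Real.sqrt_nonneg _
    have h₂ : 0 ≤ l2norm g := Real.sqrt_nonneg _
    simp only [Polynomial.eval_pow, Polynomial.eval_mul, Polynomial.eval_add, Polynomial.eval_X,
      Polynomial.eval_one, Polynomial.eval_ofNat]
    push_cast
    gcongr
end

section
/- The center of the braid group B₄ is the infinite cyclic subgroup generated by z = (bac)⁴; that is, z has infinite order and the subgroup generated by z equals the center of B₄. -/
namespace BraidFour

open FreeGroup (of)

section Words

variable {G : Type*} [Group G]

/-- Every element of the subgroup generated by two elements `x`, `y` satisfying the braid relation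
is a power of `x y x` times a positive word in `x` and `y⁻¹` times one of `1`, `x y`, `(x y)²`. -/
theorem exists_braid_normal_form {x y : G} (hxy : x * y * x = y * x * y) {h : G}
    (hh : h ∈ Subgroup.closure {x, y}) :
    ∃ m : ℤ, ∃ p ∈ Submonoid.closure {x, y⁻¹}, ∃ j < 3,
      h = (x * y * x) ^ m * p * (x * y) ^ j := by
  obtain ⟨s, hs⟩ : ∃ s, s = x * y * x := ⟨_, rfl⟩
  obtain ⟨r, hr⟩ : ∃ r, r = x * y := ⟨_, rfl⟩
  rw [← hs, ← hr]
  have hx : x = r⁻¹ * s := by rw [hs, hr]; group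
  have hy : y = s * r⁻¹ := by rw [hs, hr, hxy]; group
  have hrs : r * r * r = s * s := by
    calc r * r * r = x * y * x * (y * x * y) := by rw [hr]; group
      _ = s * s := by rw [← hxy, hs]
  have hcr : Commute (s * s) r := by
    rw [← hrs]; exact ((Commute.refl r).mul_left (Commute.refl r)).mul_left (Commute.refl r)
  have hcs : Commute (s * s) s := (Commute.refl s).mul_left (Commute.refl s)
  have hcx : Commute (s * s) x := by rw [hx]; exact hcr.inv_right.mul_right hcs
  have hcy : Commute (s * s) y := by rw [hy]; exact hcs.mul_right hcr.inv_right
  have hcp : ∀ p ∈ Submonoid.closure {x, y⁻¹}, Commute (s * s) p := by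
    intro p hp
    induction hp using Submonoid.closure_induction with
    | mem w hw =>
      rcases hw with rfl | rfl
      · exact hcx
      · exact hcy.inv_right
    | one => exact Commute.one_right _
    | mul u v _ _ hu hv => exact hu.mul_right hv
  have hxmem : x ∈ Submonoid.closure {x, y⁻¹} := Submonoid.subset_closure (by simp)
  have hymem : y⁻¹ ∈ Submonoid.closure {x, y⁻¹} := Submonoid.subset_closure (by simp)
  let F : G → Prop := fun g => ∃ m : ℤ, ∃ p ∈ Submonoid.closure {x, y⁻¹}, ∃ j < 3,
    g = s ^ m * p * r ^ j
  have hFz : ∀ g, F g → F (g * (s * s)) := by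
    rintro g ⟨m, p, hp, j, hj, rfl⟩
    refine ⟨m + 2, p, hp, j, hj, ?_⟩
    rw [mul_assoc (s ^ m * p), ← (hcr.pow_right j).eq, ← mul_assoc, mul_assoc (s ^ m),
      ← (hcp p hp).eq, zpow_add, zpow_two]
    simp only [mul_assoc]
  have hFz' : ∀ g, F g → F (g * (s * s)⁻¹) := by
    rintro g ⟨m, p, hp, j, hj, rfl⟩
    refine ⟨m - 2, p, hp, j, hj, ?_⟩
    rw [mul_assoc (s ^ m * p), ← (hcr.pow_right j).inv_left.eq, ← mul_assoc, mul_assoc (s ^ m),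
      ← (hcp p hp).inv_left.eq, zpow_sub, zpow_two]
    simp only [mul_assoc]
  have hFr : ∀ g, F g → F (g * r) := by
    rintro g ⟨m, p, hp, j, hj, rfl⟩
    by_cases hj2 : j < 2
    · exact ⟨m, p, hp, j + 1, by omega, by rw [pow_succ]; simp only [mul_assoc]⟩
    · obtain rfl : j = 2 := by omega
      have : s ^ m * p * r ^ 2 * r = s ^ m * p * r ^ 0 * (s * s) := by
        rw [← hrs]; simp only [pow_zero, pow_two, mul_assoc, mul_one]
      rw [this]
      exact hFz _ ⟨m, p, hp, 0, by omega, rfl⟩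
  have hFs : ∀ g, F g → F (g * s) := by
    rintro g ⟨m, p, hp, j, hj, rfl⟩
    have hcases : j = 0 ∨ j = 1 ∨ j = 2 := by omega
    rcases hcases with rfl | rfl | rfl
    · have key : p = 1 ∨ ∃ q ∈ Submonoid.closure {x, y⁻¹}, p = q * x ∨ p = q * y⁻¹ := by
        induction hp using Submonoid.closure_induction_right with
        | one => exact Or.inl rfl
        | mul_right q hq w hw =>
          rcases hw with rfl | rfl
          · exact Or.inr ⟨q, hq, Or.inl rfl⟩
          · exact Or.inr ⟨q, hq, Or.inr rfl⟩
      rcases key with rfl | ⟨q, hq, rfl | rfl⟩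
      · exact ⟨m + 1, 1, one_mem _, 0, by omega, by rw [zpow_add_one]; simp⟩
      · refine ⟨m, q, hq, 2, by omega, ?_⟩
        have : x * s = r ^ 2 := by rw [hx, mul_assoc, ← hrs, pow_two]; group
        rw [← this]; simp only [pow_zero, mul_one, mul_assoc]
      · refine ⟨m, q, hq, 1, by omega, ?_⟩
        rw [hy]; group
    · have : s ^ m * p * r ^ 1 * s = s ^ m * (p * y⁻¹) * r ^ 0 * (s * s) := by
        rw [hy]; group
      rw [this]
      exact hFz _ ⟨m, _, mul_mem hp hymem, 0, by omega, rfl⟩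
    · have h2 : r ^ 2 * s = x * (s * s) := by
        rw [← hcx.eq, hx, ← hrs, pow_two]; group
      have : s ^ m * p * r ^ 2 * s = s ^ m * (p * x) * r ^ 0 * (s * s) := by
        rw [mul_assoc _ (r ^ 2), h2]; simp only [pow_zero, mul_one, mul_assoc]
      rw [this]
      exact hFz _ ⟨m, _, mul_mem hp hxmem, 0, by omega, rfl⟩
  have hri : r⁻¹ = r * r * (s * s)⁻¹ := by rw [← hrs]; group
  change F h
  induction hh using Subgroup.closure_induction_right with
  | one => exact ⟨0, 1, one_mem _, 0, by omega, by simp⟩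
  | mul_right g _ w hw ih =>
    rcases hw with rfl | rfl
    · have : g * w = g * r * r * s * (s * s)⁻¹ := by
        rw [hx, hri, mul_assoc (r * r), hcs.inv_left.eq]; simp only [mul_assoc]
      rw [this]
      exact hFz' _ (hFs _ (hFr _ (hFr _ ih)))
    · have : g * w = g * s * r * r * (s * s)⁻¹ := by
        rw [hy, hri]; simp only [mul_assoc]
      rw [this]
      exact hFz' _ (hFr _ (hFr _ (hFs _ ih)))
  | mul_inv_cancel g _ w hw ih =>
    rcases hw with rfl | rfl
    · have : g * w⁻¹ = g * (s * s)⁻¹ * s * r := by rw [hx]; group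
      rw [this]
      exact hFr _ (hFs _ (hFz' _ ih))
    · have : g * w⁻¹ = g * r * s * (s * s)⁻¹ := by rw [hy]; group
      rw [this]
      exact hFz' _ (hFs _ (hFr _ ih))

theorem inv_mul_mul_of_braid {x y : G} (hxy : x * y * x = y * x * y) :
    x⁻¹ * y * x = y * x * y⁻¹ := by
  rw [eq_mul_inv_iff_mul_eq, mul_assoc, mul_assoc, inv_mul_eq_iff_eq_mul, ← mul_assoc, ← mul_assoc,
    hxy]

/-- A free group on at least two generators has trivial center. -/
theorem freeGroup_eq_one_of_forall_commute {ι : Type*} [Nontrivial ι] {w : FreeGroup ι}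
    (hw : ∀ i, Commute (of i) w) : w = 1 := by
  classical
  rw [← FreeGroup.toWord_eq_nil_iff]
  rcases hL : w.toWord with _ | ⟨⟨p, e⟩, L⟩
  · rfl
  exfalso
  obtain ⟨q, hq⟩ := exists_ne p
  have hred : FreeGroup.IsReduced ((q, true) :: w.toWord) := by
    have := FreeGroup.isReduced_toWord (x := w)
    rw [hL] at this ⊢
    exact List.isChain_cons_cons.2 ⟨fun h => absurd h hq, this⟩
  have h1 : (of q * w).toWord = (q, true) :: w.toWord := by
    rw [FreeGroup.toWord_mul, FreeGroup.toWord_of]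
    exact hred.reduce_eq
  have h2 := FreeGroup.toWord_mul_sublist w (of q)
  rw [← (hw q).eq, h1, FreeGroup.toWord_of] at h2
  have h3 := h2.eq_of_length (by simp)
  rw [hL] at h3
  simp only [List.cons_append, List.cons.injEq, Prod.mk.injEq] at h3
  exact hq h3.1.1

end Words

section Relations

theorem braid_ab : a * b * a = b * a * b := by
  rw [← mul_inv_eq_one]
  exact (PresentedGroup.one_of_mem (rels := braidRels4) (by simp [braidRels4]))

theorem braid_bc : b * c * b = c * b * c := by
  rw [← mul_inv_eq_one]
  exact (PresentedGroup.one_of_mem (rels := braidRels4) (by simp [braidRels4]))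

theorem comm_ac : a * c = c * a := by
  rw [← mul_inv_eq_one]
  exact (PresentedGroup.one_of_mem (rels := braidRels4) (by simp [braidRels4]))

theorem closure_generators : Subgroup.closure {a, b, c} = ⊤ := by
  rw [← PresentedGroup.closure_range_of braidRels4]
  congr 1
  ext x
  simp [Fin.exists_fin_succ, a, b, c, eq_comm]

/-- The homomorphism out of `B₄` given by three elements satisfying the braid relations. -/
def lift {G : Type*} [Group G] (x y w : G) (h₁ : x * y * x = y * x * y)
    (h₂ : y * w * y = w * y * w) (h₃ : x * w = w * x) : B4 →* G :=
  PresentedGroup.toGroup (f := ![x, y, w]) (by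
    rintro r (rfl | rfl | rfl) <;> simp [h₁, h₂, h₃])

section lift

variable {G : Type*} [Group G] {x y w : G} (h₁ : x * y * x = y * x * y)
    (h₂ : y * w * y = w * y * w) (h₃ : x * w = w * x)

@[simp] theorem lift_a : lift x y w h₁ h₂ h₃ a = x := PresentedGroup.toGroup.of _
@[simp] theorem lift_b : lift x y w h₁ h₂ h₃ b = y := PresentedGroup.toGroup.of _
@[simp] theorem lift_c : lift x y w h₁ h₂ h₃ c = w := PresentedGroup.toGroup.of _

end lift

theorem garside_mul_a : b * a * c * (b * a * c) * a = c * (b * a * c * (b * a * c)) := by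
  calc b * a * c * (b * a * c) * a = b * a * c * b * a * (c * a) := by group
    _ = b * (a * c) * (b * a * a) * c := by rw [← comm_ac]; group
    _ = b * c * (a * b * a) * a * c := by rw [comm_ac]; group
    _ = b * c * b * a * b * a * c := by rw [braid_ab]; group
    _ = c * (b * (c * a) * b * a * c) := by rw [braid_bc]; group
    _ = c * (b * a * c * (b * a * c)) := by rw [← comm_ac]; group

theorem garside_mul_c : b * a * c * (b * a * c) * c = a * (b * a * c * (b * a * c)) := by
  calc b * a * c * (b * a * c) * c = b * (a * c) * b * (a * c) * c := by group
    _ = b * a * (c * b * c) * a * c := by rw [comm_ac]; nth_rw 1 [← comm_ac]; group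
    _ = (b * a * b) * c * b * a * c := by rw [← braid_bc]; group
    _ = a * (b * a * c * (b * a * c)) := by rw [← braid_ab]; group

theorem garside_mul_b : b * a * c * (b * a * c) * b = b * (b * a * c * (b * a * c)) := by
  calc b * a * c * (b * a * c) * b = b * (a * c) * b * (a * c) * b := by group
    _ = b * c * (a * b * a) * c * b := by rw [comm_ac]; nth_rw 2 [← comm_ac]; group
    _ = b * c * b * a * (b * c * b) := by rw [braid_ab]; group
    _ = b * (c * b * (a * c) * b * c) := by nth_rw 2 [braid_bc]; group
    _ = b * ((c * b * c) * (a * b) * c) := by rw [comm_ac]; group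
    _ = b * (b * c * (b * a * b) * c) := by rw [← braid_bc]; group
    _ = b * (b * (c * a) * b * a * c) := by rw [← braid_ab]; group
    _ = b * (b * a * c * (b * a * c)) := by rw [← comm_ac]; group

theorem z_mem_center : z ∈ Subgroup.center B4 := by
  obtain ⟨d, hd⟩ : ∃ d, d = b * a * c * (b * a * c) := ⟨_, rfl⟩
  have ha : d * a = c * d := by rw [hd, garside_mul_a]
  have hb : d * b = b * d := by rw [hd, garside_mul_b]
  have hc : d * c = a * d := by rw [hd, garside_mul_c]
  have hz : z = d * d := by simp only [hd, z, pow_succ, pow_zero, one_mul, mul_assoc]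
  have hle : Subgroup.closure {a, b, c} ≤ Subgroup.centralizer {z} := by
    rw [Subgroup.closure_le]
    intro g hg
    rw [SetLike.mem_coe, Subgroup.mem_centralizer_singleton_iff, hz]
    rcases hg with rfl | rfl | rfl
    · rw [← mul_assoc, ← hc, mul_assoc, ← ha, mul_assoc]
    · rw [← mul_assoc, ← hb, mul_assoc, ← hb, mul_assoc]
    · rw [← mul_assoc, ← ha, mul_assoc, ← hc, mul_assoc]
  rw [closure_generators] at hle
  rw [Subgroup.mem_center_iff]
  intro g
  have := hle (Subgroup.mem_top g)
  rw [Subgroup.mem_centralizer_singleton_iff] at this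
  exact this

theorem not_isOfFinOrder_z : ¬ IsOfFinOrder z := by
  let t : Multiplicative ℤ := Multiplicative.ofAdd 1
  let f : B4 →* Multiplicative ℤ := lift t t t rfl rfl rfl
  intro h
  have hf : IsOfFinOrder (f z) := f.isOfFinOrder h
  rw [isOfFinOrder_iff_pow_eq_one] at hf
  obtain ⟨n, hn, hn'⟩ := hf
  have := congrArg Multiplicative.toAdd hn'
  simp [f, z, t] at this
  omega

end Relations

section FreeAction

/-- The automorphism `U ↦ U`, `V ↦ V U⁻¹` of the free group on `U`, `V`. -/
def autA : MulAut (FreeGroup (Fin 2)) :=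
  MonoidHom.toMulEquiv (FreeGroup.lift ![of 0, of 1 * (of 0)⁻¹])
    (FreeGroup.lift ![of 0, of 1 * of 0])
    (by ext i; fin_cases i <;> simp) (by ext i; fin_cases i <;> simp)

/-- The automorphism `U ↦ V`, `V ↦ V U⁻¹ V` of the free group on `U`, `V`. -/
def autB : MulAut (FreeGroup (Fin 2)) :=
  MonoidHom.toMulEquiv (FreeGroup.lift ![of 1, of 1 * (of 0)⁻¹ * of 1])
    (FreeGroup.lift ![of 0 * (of 1)⁻¹ * of 0, of 0])
    (by ext i; fin_cases i <;> simp [mul_assoc]) (by ext i; fin_cases i <;> simp [mul_assoc])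

/-- The automorphism `U ↦ U`, `V ↦ U⁻¹ V` of the free group on `U`, `V`. -/
def autC : MulAut (FreeGroup (Fin 2)) :=
  MonoidHom.toMulEquiv (FreeGroup.lift ![of 0, (of 0)⁻¹ * of 1])
    (FreeGroup.lift ![of 0, of 0 * of 1])
    (by ext i; fin_cases i <;> simp) (by ext i; fin_cases i <;> simp)

@[simp] theorem autA_zero : autA (of 0) = of 0 := by simp [autA]
@[simp] theorem autA_one : autA (of 1) = of 1 * (of 0)⁻¹ := by simp [autA]
@[simp] theorem autB_zero : autB (of 0) = of 1 := by simp [autB]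
@[simp] theorem autB_one : autB (of 1) = of 1 * (of 0)⁻¹ * of 1 := by simp [autB]
@[simp] theorem autC_zero : autC (of 0) = of 0 := by simp [autC]
@[simp] theorem autC_one : autC (of 1) = (of 0)⁻¹ * of 1 := by simp [autC]

theorem mulAut_ext {f g : MulAut (FreeGroup (Fin 2))} (h₀ : f (of 0) = g (of 0))
    (h₁ : f (of 1) = g (of 1)) : f = g := by
  have : f.toMonoidHom = g.toMonoidHom := by
    ext i
    fin_cases i
    · exact h₀
    · exact h₁
  exact MulEquiv.ext fun w => DFunLike.congr_fun this w

/-- The action of `B₄` on the free group of rank two by conjugation on `⟨a c⁻¹, b a c⁻¹ b⁻¹⟩`. -/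
def action : B4 →* MulAut (FreeGroup (Fin 2)) :=
  lift autA autB autC
    (by apply mulAut_ext <;> simp [mul_assoc])
    (by apply mulAut_ext <;> simp [mul_assoc])
    (by apply mulAut_ext <;> simp [mul_assoc])

@[simp] theorem action_a : action a = autA := lift_a ..
@[simp] theorem action_b : action b = autB := lift_b ..
@[simp] theorem action_c : action c = autC := lift_c ..

/-- The homomorphism from the free group of rank two sending the generators to `a c⁻¹` and
`b a c⁻¹ b⁻¹`. -/
def incl : FreeGroup (Fin 2) →* B4 := FreeGroup.lift ![a * c⁻¹, b * a * c⁻¹ * b⁻¹]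

@[simp] theorem incl_zero : incl (of 0) = a * c⁻¹ := by simp [incl]
@[simp] theorem incl_one : incl (of 1) = b * a * c⁻¹ * b⁻¹ := by simp [incl]

theorem incl_ext {f g : FreeGroup (Fin 2) →* B4} (h₀ : f (of 0) = g (of 0))
    (h₁ : f (of 1) = g (of 1)) : f = g := by
  ext i
  fin_cases i
  · exact h₀
  · exact h₁

theorem inv_c_mul_inv_b_mul_c : c⁻¹ * b⁻¹ * c = b * c⁻¹ * b⁻¹ := by
  simpa [mul_assoc] using congrArg (·⁻¹) (inv_mul_mul_of_braid braid_bc.symm)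

theorem braid_inv_c_inv_b : c⁻¹ * b⁻¹ * c⁻¹ = b⁻¹ * c⁻¹ * b⁻¹ := by
  simpa [mul_assoc] using congrArg (·⁻¹) braid_bc.symm

theorem conj_a_incl_one : a * (b * a * c⁻¹ * b⁻¹) * a⁻¹ = b * a * c⁻¹ * b⁻¹ * (a * c⁻¹)⁻¹ := by
  calc a * (b * a * c⁻¹ * b⁻¹) * a⁻¹ = a * b * a * c⁻¹ * b⁻¹ * a⁻¹ := by group
    _ = b * a * (b * c⁻¹ * b⁻¹) * a⁻¹ := by rw [braid_ab]; group
    _ = b * a * c⁻¹ * b⁻¹ * (a * c⁻¹)⁻¹ := by rw [← inv_c_mul_inv_b_mul_c]; group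

theorem conj_b_incl_one : b * (b * a * c⁻¹ * b⁻¹) * b⁻¹ =
    b * a * c⁻¹ * b⁻¹ * (a * c⁻¹)⁻¹ * (b * a * c⁻¹ * b⁻¹) := by
  have hac : c⁻¹ * a = a * c⁻¹ := by
    rw [inv_mul_eq_iff_eq_mul, ← mul_assoc, eq_mul_inv_iff_mul_eq, comm_ac]
  symm
  calc b * a * c⁻¹ * b⁻¹ * (a * c⁻¹)⁻¹ * (b * a * c⁻¹ * b⁻¹)
      = b * a * (c⁻¹ * b⁻¹ * c) * (a⁻¹ * b * a) * c⁻¹ * b⁻¹ := by group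
    _ = b * a * b * (c⁻¹ * a) * b⁻¹ * c⁻¹ * b⁻¹ := by
        rw [inv_c_mul_inv_b_mul_c, inv_mul_mul_of_braid braid_ab]; group
    _ = b * (a * b * a) * (c⁻¹ * b⁻¹ * c⁻¹) * b⁻¹ := by rw [hac]; group
    _ = b * (b * a * c⁻¹ * b⁻¹) * b⁻¹ := by rw [braid_inv_c_inv_b, braid_ab]; group

theorem conj_c_incl_one : c * (b * a * c⁻¹ * b⁻¹) * c⁻¹ =
    (a * c⁻¹)⁻¹ * (b * a * c⁻¹ * b⁻¹) := by
  calc c * (b * a * c⁻¹ * b⁻¹) * c⁻¹ = c * b * a * (c⁻¹ * b⁻¹ * c⁻¹) := by group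
    _ = c * (b * a * b⁻¹) * c⁻¹ * b⁻¹ := by rw [braid_inv_c_inv_b]; group
    _ = (a * c⁻¹)⁻¹ * (b * a * c⁻¹ * b⁻¹) := by rw [← inv_mul_mul_of_braid braid_ab]; group

/-- The inclusion `incl` is equivariant. -/
theorem incl_action (g : B4) (w : FreeGroup (Fin 2)) :
    incl (action g w) = g * incl w * g⁻¹ := by
  have hgen : ∀ g ∈ ({a, b, c} : Set B4), ∀ w, incl (action g w) = g * incl w * g⁻¹ := by
    intro g hg
    suffices incl.comp (action g).toMonoidHom = (MulAut.conj g).toMonoidHom.comp incl from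
      fun w => DFunLike.congr_fun this w
    rcases hg with rfl | rfl | rfl
    · apply incl_ext
      · simp [mul_assoc, (show Commute a c from comm_ac).inv_right.eq]
      · simpa using conj_a_incl_one.symm
    · apply incl_ext
      · simp [mul_assoc]
      · simpa using conj_b_incl_one.symm
    · apply incl_ext
      · simp [← mul_assoc, ← comm_ac]
      · simpa using conj_c_incl_one.symm
  have hg : g ∈ Subgroup.closure {a, b, c} := closure_generators ▸ Subgroup.mem_top g
  induction hg using Subgroup.closure_induction generalizing w with
  | mem g hg => exact hgen g hg w
  | one => simp
  | mul g g' _ _ hg hg' => simp [hg, hg', mul_assoc]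
  | inv g _ hg =>
    have := hg (action g⁻¹ w)
    rw [← MulAut.mul_apply, ← map_mul, mul_inv_cancel, map_one, MulAut.one_apply] at this
    rw [this]
    group

theorem action_incl (w : FreeGroup (Fin 2)) : action (incl w) = MulAut.conj w := by
  suffices action.comp incl = MulAut.conj from DFunLike.congr_fun this w
  have hac : action (a * c⁻¹) = MulAut.conj (of 0) := by
    rw [map_mul, map_inv, mul_inv_eq_iff_eq_mul]
    apply mulAut_ext <;> simp [mul_assoc]
  ext1 i
  fin_cases i
  · simpa using hac
  · have h : b * a * c⁻¹ * b⁻¹ = b * (a * c⁻¹) * b⁻¹ := by group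
    change action (incl (of 1)) = MulAut.conj (of 1)
    rw [incl_one, h, map_mul, map_mul, hac, map_inv, mul_inv_eq_iff_eq_mul]
    apply mulAut_ext <;> simp [mul_assoc]

theorem action_eq_one_of_mem_center {g : B4} (hg : g ∈ Subgroup.center B4) : action g = 1 := by
  refine MulEquiv.ext fun w => ?_
  have h : incl (action g w) = incl w := by
    rw [incl_action, ← Subgroup.mem_center_iff.1 hg, mul_inv_cancel_right]
  have hconj : MulAut.conj (action g w) = MulAut.conj w := by
    rw [← action_incl, h, action_incl]
  rw [MulAut.one_apply, ← inv_mul_eq_one]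
  refine freeGroup_eq_one_of_forall_commute fun i => ?_
  have h' : action g w * of i * (action g w)⁻¹ = w * of i * w⁻¹ := DFunLike.congr_fun hconj (of i)
  calc of i * ((action g w)⁻¹ * w) = (action g w)⁻¹ * (action g w * of i * (action g w)⁻¹) * w := by
        group
    _ = (action g w)⁻¹ * w * of i := by rw [h']; group

theorem normal_range_incl : incl.range.Normal where
  conj_mem := by
    rintro _ ⟨w, rfl⟩ g
    exact ⟨action g w, incl_action g w⟩

theorem range_incl_sup_closure : incl.range ⊔ Subgroup.closure {a, b} = ⊤ := by
  rw [eq_top_iff, ← closure_generators, Subgroup.closure_le]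
  have ha : a ∈ incl.range ⊔ Subgroup.closure {a, b} :=
    Subgroup.mem_sup_right (Subgroup.subset_closure (by simp))
  rintro g (rfl | rfl | rfl)
  · exact ha
  · exact Subgroup.mem_sup_right (Subgroup.subset_closure (by simp))
  · have hu : a * c⁻¹ ∈ incl.range ⊔ Subgroup.closure {a, b} :=
      Subgroup.mem_sup_left ⟨of 0, incl_zero⟩
    simpa using mul_mem (inv_mem hu) ha

/-- The square of the central element `(a b a)²` of `⟨a, b⟩` agrees with `z` up to an element of the
normal free subgroup `⟨a c⁻¹, b a c⁻¹ b⁻¹⟩`. -/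
theorem pow_four_mul_inv_z_mem : (a * b * a) ^ 4 * z⁻¹ ∈ incl.range := by
  have := normal_range_incl
  rw [← QuotientGroup.eq_one_iff, QuotientGroup.mk_mul, QuotientGroup.mk_inv, mul_inv_eq_one]
  have hc : (a : B4 ⧸ incl.range) = c := by
    rw [← mul_inv_eq_one, ← QuotientGroup.mk_inv, ← QuotientGroup.mk_mul, QuotientGroup.eq_one_iff]
    exact ⟨of 0, incl_zero⟩
  have hab : (a * b * a : B4 ⧸ incl.range) = b * a * b := congrArg _ braid_ab
  change ((a * b * a : B4 ⧸ incl.range)) ^ 4 = (b * a * c : B4 ⧸ incl.range) ^ 4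
  rw [← hc]
  generalize (a : B4 ⧸ incl.range) = x at *
  generalize (b : B4 ⧸ incl.range) = y at *
  obtain ⟨s, hs⟩ : ∃ s, s = x * y * x := ⟨_, rfl⟩
  have hx : s * x = y * s := by
    calc s * x = y * x * y * x := by rw [hs, hab]
      _ = y * s := by rw [hs]; simp only [mul_assoc]
  have hy : s * y = x * s := by
    calc s * y = x * y * x * y := by rw [hs]
      _ = x * (y * x * y) := by simp only [mul_assoc]
      _ = x * s := by rw [← hab, hs]
  have hcomm : s ^ 4 * x = x * s ^ 4 := by
    have h2 : Commute (s ^ 2) x := by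
      rw [Commute, SemiconjBy, pow_two, mul_assoc, hx, ← mul_assoc, hy, mul_assoc]
    rw [show 4 = 2 * 2 from rfl, pow_mul]
    exact (h2.pow_left 2).eq
  have hconj : y * x * x = x⁻¹ * s * x := by rw [hs]; group
  rw [← hs, hconj]
  calc s ^ 4 = x⁻¹ * (x * s ^ 4) := by group
    _ = (x⁻¹ * s * x) ^ 4 := by rw [← hcomm]; simp [pow_succ, mul_assoc]

/-- The exponent sum of the first generator. -/
def exponentSum : FreeGroup (Fin 2) →* Multiplicative ℤ :=
  FreeGroup.lift ![Multiplicative.ofAdd 1, 1]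

theorem incl_mul_sq_notMem_center (w : FreeGroup (Fin 2)) :
    incl w * (a * b * a) ^ 2 ∉ Subgroup.center B4 := by
  intro h
  have h' := DFunLike.congr_fun (action_eq_one_of_mem_center h) (of 0)
  rw [map_mul, action_incl, MulAut.mul_apply, MulAut.conj_apply, MulAut.one_apply] at h'
  have h'' := congrArg (fun y => Multiplicative.toAdd (exponentSum y)) h'
  simp [exponentSum, pow_two] at h''

end FreeAction

section Linear

/-- The homomorphism from `B₄` to `SL₂(ℤ)` describing the action on the abelianization of the free
group. -/
def linear : B4 →* Matrix.SpecialLinearGroup (Fin 2) ℤ :=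
  lift (G := Matrix.SpecialLinearGroup (Fin 2) ℤ)
    ⟨!![1, 1; 0, 1], by simp⟩ ⟨!![1, 0; -1, 1], by simp⟩ ⟨!![1, 1; 0, 1], by simp⟩
    (Subtype.ext (by decide)) (Subtype.ext (by decide)) rfl

theorem linear_a : (linear a : Matrix (Fin 2) (Fin 2) ℤ) = !![1, 1; 0, 1] :=
  congrArg (fun A : Matrix.SpecialLinearGroup (Fin 2) ℤ => (A : Matrix (Fin 2) (Fin 2) ℤ))
    (lift_a ..)

theorem linear_b : (linear b : Matrix (Fin 2) (Fin 2) ℤ) = !![1, 0; -1, 1] :=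
  congrArg (fun A : Matrix.SpecialLinearGroup (Fin 2) ℤ => (A : Matrix (Fin 2) (Fin 2) ℤ))
    (lift_b ..)

theorem linear_incl (w : FreeGroup (Fin 2)) : linear (incl w) = 1 := by
  suffices linear.comp incl = 1 from DFunLike.congr_fun this w
  have hac : linear c = linear a := (lift_c ..).trans (lift_a ..).symm
  ext1 i
  fin_cases i
  · change linear (incl (of 0)) = 1
    simp [hac]
  · change linear (incl (of 1)) = 1
    simp [hac]

theorem linear_eq_scalar_of_mem_center {g : B4} (hg : g ∈ Subgroup.center B4) :
    ∃ d : ℤ, (d = 1 ∨ d = -1) ∧ (linear g : Matrix (Fin 2) (Fin 2) ℤ) = !![d, 0; 0, d] := by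
  have ha := congrArg (fun x => (linear x : Matrix (Fin 2) (Fin 2) ℤ))
    (Subgroup.mem_center_iff.1 hg a)
  have hb := congrArg (fun x => (linear x : Matrix (Fin 2) (Fin 2) ℤ))
    (Subgroup.mem_center_iff.1 hg b)
  have hdet := (linear g).det_coe
  simp only [map_mul, Matrix.SpecialLinearGroup.coe_mul, linear_a, linear_b] at ha hb
  generalize (linear g : Matrix (Fin 2) (Fin 2) ℤ) = M at ha hb hdet ⊢
  have ha₀ := congrFun₂ ha 0 0
  have ha₁ := congrFun₂ ha 0 1
  have hb₀ := congrFun₂ hb 0 0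
  simp [Matrix.mul_apply, Fin.sum_univ_two] at ha₀ ha₁ hb₀
  have h01 : M 0 1 = 0 := by omega
  have h11 : M 1 1 = M 0 0 := by omega
  rw [Matrix.det_fin_two, ha₀, h11, mul_zero, sub_zero] at hdet
  refine ⟨M 0 0, mul_self_eq_one_iff.1 hdet, ?_⟩
  ext i j
  fin_cases i <;> fin_cases j <;> simp [ha₀, h01, h11]

/-- A nontrivial positive word in `a`, `b⁻¹` is sent to a matrix with nonnegative entries of sum
at least `3`. -/
theorem linear_positive {p : B4} (hp : p ∈ Submonoid.closure {a, b⁻¹}) :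
    (∀ i j, 0 ≤ linear p i j) ∧ (∀ j, 1 ≤ linear p 0 j + linear p 1 j) ∧
      (p = 1 ∨ 3 ≤ linear p 0 0 + linear p 1 0 + (linear p 0 1 + linear p 1 1)) := by
  induction hp using Submonoid.closure_induction_right with
  | one => simp [Fin.forall_fin_two]
  | mul_right q _ w hw ih =>
    simp only [Fin.forall_fin_two] at ih ⊢
    rcases hw with rfl | rfl <;>
    simp [linear_a, linear_b, Matrix.mul_apply, Fin.sum_univ_two, Matrix.SpecialLinearGroup.coe_inv,
      Matrix.adjugate_fin_two] <;> omega

theorem eq_even_zpow_of_linear_eq_scalar {h : B4} (hh : h ∈ Subgroup.closure {a, b}) {d : ℤ}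
    (hd : d = 1 ∨ d = -1) (hl : (linear h : Matrix (Fin 2) (Fin 2) ℤ) = !![d, 0; 0, d]) :
    ∃ k : ℤ, h = (a * b * a) ^ (2 * k) := by
  obtain ⟨m, p, hp, j, hj, rfl⟩ := exists_braid_normal_form braid_ab hh
  obtain ⟨hpos, hcol, hsum⟩ := linear_positive hp
  simp only [Fin.forall_fin_two] at hpos hcol
  have hs : (linear (a * b * a) : Matrix (Fin 2) (Fin 2) ℤ) = !![0, 1; -1, 0] := by
    simp [linear_a, linear_b]
  have hs2 : linear (a * b * a) ^ 2 = -1 := by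
    ext i j
    rw [pow_two, Matrix.SpecialLinearGroup.coe_mul, hs]
    fin_cases i <;> fin_cases j <;> simp
  have hr : (linear (a * b) : Matrix (Fin 2) (Fin 2) ℤ) = !![0, 1; -1, 1] := by
    simp [linear_a, linear_b]
  have hpow : ∀ k : ℤ, ∃ e : ℤ, (e = 1 ∨ e = -1) ∧
      (linear ((a * b * a) ^ (2 * k)) : Matrix (Fin 2) (Fin 2) ℤ) = !![e, 0; 0, e] := by
    intro k
    rw [map_zpow, zpow_mul, show (2 : ℤ) = (2 : ℕ) from rfl, zpow_natCast, hs2]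
    rcases Int.even_or_odd k with hk | hk
    · refine ⟨1, Or.inl rfl, ?_⟩
      rw [hk.neg_one_zpow]
      ext i j
      fin_cases i <;> fin_cases j <;> simp
    · refine ⟨-1, Or.inr rfl, ?_⟩
      rw [hk.neg_one_zpow]
      ext i j
      fin_cases i <;> fin_cases j <;> simp
  rw [map_mul, map_mul, map_pow, Matrix.SpecialLinearGroup.coe_mul,
    Matrix.SpecialLinearGroup.coe_mul, Matrix.SpecialLinearGroup.coe_pow, hr] at hl
  generalize (linear p : Matrix (Fin 2) (Fin 2) ℤ) = M at hl hpos hcol hsum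
  rw [M.eta_fin_two] at hl
  have hcases : j = 0 ∨ j = 1 ∨ j = 2 := by omega
  obtain ⟨k, rfl | rfl⟩ := Int.even_or_odd' m
  · obtain ⟨e, he, hek⟩ := hpow k
    rw [hek] at hl
    have h00 := congrFun₂ hl 0 0
    have h01 := congrFun₂ hl 0 1
    have h10 := congrFun₂ hl 1 0
    have h11 := congrFun₂ hl 1 1
    rcases hcases with rfl | rfl | rfl <;>
    simp [pow_two] at h00 h01 h10 h11 <;>
    rcases he with rfl | rfl <;> rcases hd with rfl | rfl <;> try omega
    all_goals
      obtain rfl : p = 1 := hsum.resolve_right (by omega)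
      exact ⟨k, by simp⟩
  · exfalso
    obtain ⟨e, he, hek⟩ := hpow k
    rw [zpow_add_one, map_mul, Matrix.SpecialLinearGroup.coe_mul, hek, hs] at hl
    have h00 := congrFun₂ hl 0 0
    have h01 := congrFun₂ hl 0 1
    have h10 := congrFun₂ hl 1 0
    have h11 := congrFun₂ hl 1 1
    rcases hcases with rfl | rfl | rfl <;>
    simp [pow_two] at h00 h01 h10 h11 <;>
    rcases he with rfl | rfl <;> rcases hd with rfl | rfl <;> omega

end Linear

theorem exists_eq_incl_mul_zpow {x : B4} (hx : x ∈ Subgroup.center B4) :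
    ∃ w, ∃ k : ℤ, x = incl w * (a * b * a) ^ (2 * k) := by
  have := normal_range_incl
  have hmem : x ∈ incl.range ⊔ Subgroup.closure {a, b} :=
    range_incl_sup_closure ▸ Subgroup.mem_top x
  obtain ⟨_, ⟨w, rfl⟩, h, hh, rfl⟩ := Subgroup.mem_sup_of_normal_left.1 hmem
  obtain ⟨d, hd, hl⟩ := linear_eq_scalar_of_mem_center hx
  rw [map_mul, linear_incl, one_mul] at hl
  obtain ⟨k, rfl⟩ := eq_even_zpow_of_linear_eq_scalar hh hd hl
  exact ⟨w, k, rfl⟩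

theorem exists_pow_four_zpow_eq (t : ℤ) :
    ∃ w, (a * b * a) ^ (4 * t) = incl w * z ^ t := by
  obtain ⟨w, hw⟩ := pow_four_mul_inv_z_mem
  have hz : Commute (incl w) z := Subgroup.mem_center_iff.1 z_mem_center _
  refine ⟨w ^ t, ?_⟩
  rw [map_zpow, ← hz.mul_zpow, hw, inv_mul_cancel_right, zpow_mul]
  rfl

theorem incl_eq_one_of_mem_center {w : FreeGroup (Fin 2)} (h : incl w ∈ Subgroup.center B4) :
    incl w = 1 := by
  have h₁ := action_eq_one_of_mem_center h
  rw [action_incl] at h₁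
  rw [freeGroup_eq_one_of_forall_commute (w := w) fun i => ?_, map_one]
  have : w * of i * w⁻¹ = of i := DFunLike.congr_fun h₁ (of i)
  exact (mul_inv_eq_iff_eq_mul.1 this).symm

theorem mem_zpowers_z_of_mem_center {x : B4} (hx : x ∈ Subgroup.center B4) :
    x ∈ Subgroup.zpowers z := by
  obtain ⟨w, k, hxw⟩ := exists_eq_incl_mul_zpow hx
  obtain ⟨t, ht⟩ := Int.even_or_odd' k
  obtain ⟨v, hv⟩ := exists_pow_four_zpow_eq t
  have hzt : z ^ t ∈ Subgroup.center B4 := zpow_mem z_mem_center t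
  rcases ht with rfl | rfl
  · rw [show 2 * (2 * t) = 4 * t by ring, hv, ← mul_assoc, ← map_mul] at hxw
    have h : incl (w * v) ∈ Subgroup.center B4 := by
      rwa [hxw, Subgroup.mul_mem_cancel_right _ hzt] at hx
    rw [hxw, incl_eq_one_of_mem_center h, one_mul]
    exact Subgroup.zpow_mem_zpowers z t
  · rw [show 2 * (2 * t + 1) = 4 * t + 2 by ring, zpow_add, hv, mul_assoc,
      ← Subgroup.mem_center_iff.1 hzt, ← mul_assoc, ← mul_assoc, ← map_mul] at hxw
    rw [hxw, Subgroup.mul_mem_cancel_right _ hzt] at hx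
    exact absurd hx (incl_mul_sq_notMem_center _)

end BraidFour

/-- The center of the braid group `B₄` is the infinite cyclic subgroup generated
by `z = (bac)⁴`: the element `z` has infinite order and the subgroup it generates
is the center of `B₄`. -/
theorem center_B4_eq_zpowers_z :
    ¬ IsOfFinOrder z ∧ Subgroup.zpowers z = Subgroup.center B4 := by
  refine ⟨BraidFour.not_isOfFinOrder_z, le_antisymm ?_ fun x hx => ?_⟩
  · rw [Subgroup.zpowers_le]
    exact BraidFour.z_mem_center
  · exact BraidFour.mem_zpowers_z_of_mem_center hx
end

section
/- In the central quotient G = B₄/⟨z⟩ with z = (bac)⁴, the images x̄ of x = bac and ȳ of y = bac² satisfy x̄⁴ = ȳ³ = 1, and every element of finite order in G is conjugate to a power of x̄ or to a power of ȳ. -/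
/-- The image in `G` of `x = bac`. -/
noncomputable def xbar : G := π (b * a * c)

/-- The image in `G` of `y = bac²`. -/
noncomputable def ybar : G := π (b * a * c ^ 2)

theorem braid_ab : a * b * a = b * a * b :=
  mul_inv_eq_one.1 (PresentedGroup.one_of_mem (rels := braidRels4) (by simp [braidRels4]))

theorem braid_bc : b * c * b = c * b * c :=
  mul_inv_eq_one.1 (PresentedGroup.one_of_mem (rels := braidRels4) (by simp [braidRels4]))

theorem commute_ac : a * c = c * a :=
  mul_inv_eq_one.1 (PresentedGroup.one_of_mem (rels := braidRels4) (by simp [braidRels4]))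

/-- A triple satisfying the braid relations, with `(bac)⁴ = 1`, defines a homomorphism from `G`. -/
noncomputable def liftG {K : Type*} [Group K] (p q r : K) (h₁ : p * q * p = q * p * q)
    (h₂ : q * r * q = r * q * r) (h₃ : p * r = r * p) (h₄ : (q * p * r) ^ 4 = 1) : G →* K :=
  QuotientGroup.lift _
    (PresentedGroup.toGroup (rels := braidRels4) (f := ![p, q, r]) (by
      rintro w (rfl | rfl | rfl) <;> simp [h₁, h₂, h₃]))
    (by
      refine Subgroup.normalClosure_le_normal ?_
      rintro w rfl
      simpa [z, a, b, c] using h₄)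

section LiftG

variable {K : Type*} [Group K] {p q r : K} (h₁ : p * q * p = q * p * q)
    (h₂ : q * r * q = r * q * r) (h₃ : p * r = r * p) (h₄ : (q * p * r) ^ 4 = 1)

@[simp] theorem liftG_a : liftG p q r h₁ h₂ h₃ h₄ (π a) = p := by
  simp [liftG, π, a]

@[simp] theorem liftG_b : liftG p q r h₁ h₂ h₃ h₄ (π b) = q := by
  simp [liftG, π, b]

@[simp] theorem liftG_c : liftG p q r h₁ h₂ h₃ h₄ (π c) = r := by
  simp [liftG, π, c]

end LiftG

theorem closure_generators : Subgroup.closure ({π a, π b, π c} : Set G) = ⊤ := by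
  have h : Subgroup.closure ({a, b, c} : Set B4) = ⊤ := by
    rw [← PresentedGroup.closure_range_of braidRels4]
    congr 1
    ext w
    simp [a, b, c, Fin.exists_fin_succ, eq_comm]
  have hs : π.range = ⊤ := MonoidHom.range_eq_top.2 (QuotientGroup.mk'_surjective _)
  have h' := congrArg (Subgroup.map π) h
  rw [MonoidHom.map_closure, ← MonoidHom.range_eq_map, hs] at h'
  simpa [Set.image_insert_eq] using h'

theorem xbar_pow_four : xbar ^ 4 = 1 := by
  rw [xbar, ← map_pow]
  exact (QuotientGroup.eq_one_iff _).2 (Subgroup.subset_normalClosure rfl)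

abbrev F2 : Type := FreeGroup (Fin 2)

/-- The automorphism of `F2` given by mutually inverse substitutions. -/
def substEquiv (p q p' q' : F2)
    (h₀ : FreeGroup.lift ![p', q'] p = .of 0) (h₁ : FreeGroup.lift ![p', q'] q = .of 1)
    (h₀' : FreeGroup.lift ![p, q] p' = .of 0) (h₁' : FreeGroup.lift ![p, q] q' = .of 1) :
    MulAut F2 :=
  MonoidHom.toMulEquiv (FreeGroup.lift ![p, q]) (FreeGroup.lift ![p', q'])
    (by ext i; fin_cases i <;> simp [h₀, h₁]) (by ext i; fin_cases i <;> simp [h₀', h₁'])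

/-- The automorphism `u ↦ u`, `v ↦ v u⁻¹`. -/
def autA : MulAut F2 :=
  substEquiv (.of 0) (.of 1 * (.of 0)⁻¹) (.of 0) (.of 1 * .of 0)
    (by decide) (by decide) (by decide) (by decide)

/-- The automorphism `u ↦ v`, `v ↦ v u⁻¹ v`. -/
def autB : MulAut F2 :=
  substEquiv (.of 1) (.of 1 * (.of 0)⁻¹ * .of 1) (.of 0 * (.of 1)⁻¹ * .of 0) (.of 0)
    (by decide) (by decide) (by decide) (by decide)

/-- The automorphism `u ↦ u`, `v ↦ u⁻¹ v`. -/
def autC : MulAut F2 :=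
  substEquiv (.of 0) ((.of 0)⁻¹ * .of 1) (.of 0) (.of 0 * .of 1)
    (by decide) (by decide) (by decide) (by decide)

theorem mulAut_ext {φ ψ : MulAut F2} (h₀ : φ (.of 0) = ψ (.of 0)) (h₁ : φ (.of 1) = ψ (.of 1)) :
    φ = ψ := by
  apply MulEquiv.toMonoidHom_injective
  ext i
  fin_cases i
  exacts [h₀, h₁]

theorem autX_of_zero : (autB * autA * autC) (.of 0) = .of 1 := by decide

theorem autX_of_one : (autB * autA * autC) (.of 1) = (.of 0)⁻¹ := by decide

theorem autX_pow_four : (autB * autA * autC) ^ 4 = 1 := by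
  have h₀ := autX_of_zero
  have h₁ := autX_of_one
  generalize autB * autA * autC = φ at h₀ h₁
  apply mulAut_ext <;> simp [pow_succ, MulAut.mul_apply, h₀, h₁]

/-- The action of `G` on the free group of rank two. -/
noncomputable def freeAction : G →* MulAut F2 :=
  liftG autA autB autC (mulAut_ext (by decide) (by decide)) (mulAut_ext (by decide) (by decide))
    (mulAut_ext (by decide) (by decide)) autX_pow_four

/-- The image of `a` and of `c` in `SL₂(ℤ)`. -/
def slA : Matrix.SpecialLinearGroup (Fin 2) ℤ := ⟨!![1, 1; 0, 1], by decide⟩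

/-- The image of `b` in `SL₂(ℤ)`. -/
def slB : Matrix.SpecialLinearGroup (Fin 2) ℤ := ⟨!![0, 1; -1, 2], by decide⟩

/-- The image of `xbar` in `SL₂(ℤ)`. -/
def slX : Matrix.SpecialLinearGroup (Fin 2) ℤ := ⟨!![0, 1; -1, 0], by decide⟩

/-- The homomorphism onto `SL₂(ℤ)`. -/
noncomputable def toSL : G →* Matrix.SpecialLinearGroup (Fin 2) ℤ :=
  liftG slA slB slA (by decide) (by decide) (by decide) (by decide)

/-- The homomorphism recording the permutation of the four strings. -/
noncomputable def toPerm : G →* Equiv.Perm (Fin 4) :=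
  liftG (Equiv.swap 0 1) (Equiv.swap 1 2) (Equiv.swap 2 3)
    (by decide) (by decide) (by decide) (by decide)

/-- The embedding of `F2` in `G` with `u = ac⁻¹` and `v = bac⁻¹b⁻¹`. -/
noncomputable def freeEmb : F2 →* G :=
  FreeGroup.lift ![π (a * c⁻¹), π (b * a * c⁻¹ * b⁻¹)]

theorem freeEmb_zero : freeEmb (.of 0) = π (a * c⁻¹) := by simp [freeEmb]

theorem freeEmb_one : freeEmb (.of 1) = π (b * a * c⁻¹ * b⁻¹) := by simp [freeEmb]

theorem conj_x_u : b * a * c * (a * c⁻¹) = b * a * c⁻¹ * b⁻¹ * (b * a * c) := by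
  have h := commute_ac
  have h' : c⁻¹ * a = a * c⁻¹ := by rw [inv_mul_eq_iff_eq_mul, ← mul_assoc, ← h]; group
  calc _ = b * a * (c * a) * c⁻¹ := by group
    _ = b * a * a := by rw [← h]; group
    _ = b * a * (c⁻¹ * a) * c := by rw [h']; group
    _ = _ := by group

theorem conj_c_v : c * (b * a * c⁻¹ * b⁻¹) = (a * c⁻¹)⁻¹ * (b * a * c⁻¹ * b⁻¹) * c := by
  have h := commute_ac
  have hab := braid_ab
  have hbc := braid_bc
  have e₁ : b⁻¹ * c⁻¹ * b = c * b⁻¹ * c⁻¹ := by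
    have : b = c * b * c * b⁻¹ * c⁻¹ := by rw [← hbc]; group
    nth_rewrite 2 [this]
    group
  have e₂ : b⁻¹ * a⁻¹ * b = a * b⁻¹ * a⁻¹ := by
    have : b = a * b * a * b⁻¹ * a⁻¹ := by rw [hab]; group
    nth_rewrite 2 [this]
    group
  have e₃ : a⁻¹ * c = c * a⁻¹ := by rw [inv_mul_eq_iff_eq_mul, ← mul_assoc, h]; group
  calc _ = c * (b * a * c⁻¹ * (b⁻¹ * c⁻¹ * b) * b⁻¹ * c) := by group
    _ = c * b * a * b⁻¹ * (c⁻¹ * b⁻¹ * c) := by rw [e₁]; group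
    _ = c * b * (a * b⁻¹ * a⁻¹) * (a * c⁻¹) * b⁻¹ * c := by group
    _ = c * a⁻¹ * (b * a * c⁻¹ * b⁻¹ * c) := by rw [← e₂]; group
    _ = c * a⁻¹ * (b * a * c⁻¹ * b⁻¹) * c := by group
    _ = _ := by group

theorem conj_x_sq_c : (b * a * c) ^ 2 * c = a * (b * a * c) ^ 2 := by
  have h := commute_ac
  have hab := braid_ab
  have hbc := braid_bc
  calc _ = b * a * c * b * (a * c) * c := by rw [pow_two]; group
    _ = b * a * (c * b * c) * a * c := by rw [h]; group
    _ = b * (a * b) * c * b * a * c := by rw [← hbc]; group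
    _ = (b * a * b) * c * b * a * c := by group
    _ = a * b * (a * c) * b * a * c := by rw [← hab]; group
    _ = _ := by rw [pow_two]; group

theorem bac_sq_pow_three : (b * a * c ^ 2) ^ 3 = (b * a * c) ^ 4 := by
  have h := commute_ac
  have hab := braid_ab
  have hbc := braid_bc
  have h1 : b * a * c * b * a = c * (b * a * c * b) := by
    calc _ = b * (a * c) * b * a := by group
      _ = b * c * (a * b * a) := by rw [h]; group
      _ = (b * c * b) * a * b := by rw [hab]; group
      _ = c * b * (c * a) * b := by rw [hbc]; group
      _ = _ := by rw [← h]; group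
  have h2 : b * a * c * b * c = a * (b * a * c * b) := by
    calc _ = b * a * (c * b * c) := by group
      _ = (b * a * b) * c * b := by rw [← hbc]; group
      _ = a * b * (a * c) * b := by rw [← hab]; group
      _ = _ := by group
  calc (b * a * c ^ 2) ^ 3 = (b * a * c) * (c * b * a * c * c * b * (a * c) * c) := by
        simp only [pow_succ, pow_zero, one_mul]; group
    _ = (b * a * c) * (c * b * a * c * (c * b * c) * a * c) := by rw [h]; group
    _ = (b * a * c) * (c * b * a * c * (b * c * b) * a * c) := by rw [hbc]
    _ = (b * a * c) * (c * b * a * (c * b * c) * b * a * c) := by group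
    _ = (b * a * c) * (c * b * a * (b * c * b) * b * a * c) := by rw [hbc]
    _ = (b * a * c) * (c * (b * a * b) * c * b * b * a * c) := by group
    _ = (b * a * c) * ((c * a) * b * a * c * b * b * a * c) := by rw [← hab]; group
    _ = (b * a * c) * (a * (c * (b * a * c * b)) * b * a * c) := by rw [← h]; group
    _ = (b * a * c) * ((a * (b * a * c * b)) * a * b * a * c) := by rw [← h1]; group
    _ = (b * a * c) * (b * a * c * b * (c * a) * b * a * c) := by rw [← h2]; group
    _ = _ := by rw [← h]; simp only [pow_succ, pow_zero, one_mul]; group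

/-- A free group on at least two generators has trivial center. -/
theorem eq_one_of_forall_of_mul_eq_mul_of {α : Type*} [DecidableEq α] [Nontrivial α] {f : FreeGroup α}
    (h : ∀ i, .of i * f = f * .of i) : f = 1 := by
  by_contra hf
  rw [← FreeGroup.toWord_eq_nil_iff] at hf
  obtain ⟨⟨i, s⟩, L, hL⟩ := List.exists_cons_of_ne_nil hf
  obtain ⟨j, hj⟩ := exists_ne i
  have hw : (FreeGroup.of j * f).toWord = (j, true) :: f.toWord := by
    rw [FreeGroup.toWord_mul, FreeGroup.toWord_of, List.singleton_append]
    apply FreeGroup.IsReduced.reduce_eq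
    have := FreeGroup.isReduced_toWord (x := f)
    rw [hL] at this ⊢
    rw [FreeGroup.IsReduced, List.isChain_cons_cons]
    exact ⟨fun h => absurd h hj, this⟩
  have hs := FreeGroup.toWord_mul_sublist f (.of j)
  rw [← h, hw, FreeGroup.toWord_of] at hs
  have := hs.eq_of_length (by simp)
  rw [hL] at this
  simp at this
  exact hj this.1.1

theorem ybar_pow_three : ybar ^ 3 = 1 := by
  rw [ybar, ← map_pow, bac_sq_pow_three, map_pow]
  exact xbar_pow_four

theorem ybar_eq : ybar = xbar * π c := by
  rw [ybar, xbar, ← map_mul, pow_two, mul_assoc (b * a) c c]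

theorem xbar_sq_mul_c : xbar ^ 2 * π c = π a * xbar ^ 2 := by
  rw [xbar, ← map_pow, ← map_mul, ← map_mul, conj_x_sq_c]

theorem xbar_sq_mul_a : xbar ^ 2 * π a = π c * xbar ^ 2 := by
  have h := xbar_pow_four
  calc _ = xbar ^ 2 * (π a * xbar ^ 2) * (xbar ^ 2)⁻¹ := by group
    _ = xbar ^ 4 * π c * (xbar ^ 4)⁻¹ * xbar ^ 2 := by rw [← xbar_sq_mul_c]; group
    _ = _ := by rw [h]; group

theorem freeAction_xbar_zero : freeAction xbar (.of 0) = .of 1 := by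
  simpa [freeAction, xbar] using autX_of_zero

theorem freeAction_xbar_one : freeAction xbar (.of 1) = (.of 0)⁻¹ := by
  simpa [freeAction, xbar] using autX_of_one

theorem freeAction_freeEmb (f : F2) : freeAction (freeEmb f) = MulAut.conj f := by
  have : freeAction.comp freeEmb = MulAut.conj := by
    ext1 i
    apply mulAut_ext <;> fin_cases i <;> simp [freeAction, freeEmb] <;> decide
  exact DFunLike.congr_fun this f

theorem freeEmb_injective : Function.Injective freeEmb := by
  rw [injective_iff_map_eq_one]
  intro f hf
  have h := freeAction_freeEmb f
  rw [hf, map_one] at h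
  refine eq_one_of_forall_of_mul_eq_mul_of fun i => ?_
  have := DFunLike.congr_fun h (.of i)
  rw [MulAut.one_apply, MulAut.conj_apply] at this
  rw [eq_mul_inv_iff_mul_eq] at this
  exact this

theorem freeEmb_hom_ext {g : G} (φ : MulAut F2)
    (h₀ : freeEmb (φ (.of 0)) = g * freeEmb (.of 0) * g⁻¹)
    (h₁ : freeEmb (φ (.of 1)) = g * freeEmb (.of 1) * g⁻¹) (f : F2) :
    freeEmb (φ f) = g * freeEmb f * g⁻¹ := by
  have : freeEmb.comp φ.toMonoidHom = (MulAut.conj g).toMonoidHom.comp freeEmb := by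
    ext i
    fin_cases i
    · simpa using h₀
    · simpa using h₁
  simpa using DFunLike.congr_fun this f

/-- The embedding of `F2` in `G` intertwines the action of `G` on `F2` with conjugation. -/
theorem freeEmb_freeAction (g : G) (f : F2) :
    freeEmb (freeAction g f) = g * freeEmb f * g⁻¹ := by
  let E : Subgroup G :=
    { carrier := {g | ∀ f, freeEmb (freeAction g f) = g * freeEmb f * g⁻¹}
      one_mem' := by simp
      mul_mem' := by
        intro g g' hg hg' f
        rw [map_mul, MulAut.mul_apply, hg, hg']
        group
      inv_mem' := by
        intro g hg f
        have := hg (freeAction g⁻¹ f)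
        rw [← MulAut.mul_apply, ← map_mul, mul_inv_cancel, map_one, MulAut.one_apply] at this
        rw [this]
        group }
  have hu : freeEmb (.of 0) = π a * (π c)⁻¹ := by rw [freeEmb_zero, map_mul, map_inv]
  have hac : π a * π c = π c * π a := by rw [← map_mul, ← map_mul, commute_ac]
  have hx : xbar ∈ E := by
    have hxu : freeEmb (.of 1) = xbar * freeEmb (.of 0) * xbar⁻¹ := by
      rw [eq_mul_inv_iff_mul_eq, freeEmb_zero, freeEmb_one, xbar, ← map_mul, ← map_mul, conj_x_u]
    refine freeEmb_hom_ext _ ?_ ?_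
    · rw [freeAction_xbar_zero, hxu]
    · rw [freeAction_xbar_one, hxu, map_inv, hu]
      calc (π a * (π c)⁻¹)⁻¹ = (π c * xbar ^ 2) * (π a * xbar ^ 2)⁻¹ := by group
        _ = xbar ^ 2 * (π a * (π c)⁻¹) * (xbar ^ 2)⁻¹ := by
          rw [← xbar_sq_mul_c, ← xbar_sq_mul_a]; group
        _ = _ := by simp only [pow_two, mul_assoc, mul_inv_rev]
  have hc : π c ∈ E := by
    refine freeEmb_hom_ext _ ?_ ?_
    · have : freeAction (π c) (.of 0) = .of 0 := by simp [freeAction]; decide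
      rw [this, hu, ← mul_assoc, ← hac]
      group
    · have : freeAction (π c) (.of 1) = (.of 0)⁻¹ * .of 1 := by simp [freeAction]; decide
      rw [this, map_mul, map_inv, freeEmb_zero, freeEmb_one, eq_mul_inv_iff_mul_eq]
      simp only [← map_mul, ← map_inv]
      rw [conj_c_v]
  have ha : π a ∈ E := by
    have h : freeEmb (.of 0) ∈ E := fun f => by
      simp [freeAction_freeEmb]
    have := E.mul_mem h hc
    rwa [hu, inv_mul_cancel_right] at this
  have hb : π b ∈ E := by
    have := E.mul_mem hx (E.inv_mem (E.mul_mem ha hc))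
    rw [xbar, map_mul, map_mul] at this
    convert this using 1
    group
  have hE : E = ⊤ := by
    rw [eq_top_iff, ← closure_generators, Subgroup.closure_le]
    rintro _ (rfl | rfl | rfl) <;> assumption
  have : g ∈ E := hE ▸ Subgroup.mem_top g
  exact this f

instance : freeEmb.range.Normal where
  conj_mem := by
    rintro _ ⟨f, rfl⟩ g
    exact ⟨freeAction g f, freeEmb_freeAction g f⟩

/-- An element of the join of two subgroups is conjugate to an element of one of them, or to a
nonempty alternating product of elements of either one that do not lie in the other. -/
theorem exists_isConj_of_mem_sup {Γ : Type*} [Group Γ] (A B : Subgroup Γ) {g : Γ}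
    (hg : g ∈ A ⊔ B) :
    (∃ p ∈ A, IsConj g p) ∨ (∃ q ∈ B, IsConj g q) ∨
      ∃ l : List Γ, l ≠ [] ∧ (∀ x ∈ l, ∃ p ∈ A, p ∉ B ∧ ∃ q ∈ B, q ∉ A ∧ x = p * q) ∧
        IsConj g l.prod := by
  suffices H : ∀ (n : ℕ) (l : List Γ), l.length = n → (∀ x ∈ l, ∃ p ∈ A, ∃ q ∈ B, x = p * q) →
      ∀ g, IsConj g l.prod → (∃ p ∈ A, IsConj g p) ∨ (∃ q ∈ B, IsConj g q) ∨
        ∃ l : List Γ, l ≠ [] ∧ (∀ x ∈ l, ∃ p ∈ A, p ∉ B ∧ ∃ q ∈ B, q ∉ A ∧ x = p * q) ∧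
          IsConj g l.prod by
    rw [Subgroup.sup_eq_closure, ← Subgroup.mem_toSubmonoid, Subgroup.closure_toSubmonoid] at hg
    obtain ⟨l, hl, rfl⟩ := Submonoid.exists_list_of_mem_closure hg
    refine H _ l rfl (fun x hx => ?_) _ (IsConj.refl _)
    have : x ∈ A ∨ x ∈ B := by simpa [or_self] using hl x hx
    rcases this with h | h
    · exact ⟨x, h, 1, B.one_mem, by simp⟩
    · exact ⟨1, A.one_mem, x, h, by simp⟩
  intro n
  induction n with
  | zero =>
    intro l hl _ g hg
    rw [List.length_eq_zero_iff.1 hl] at hg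
    exact .inl ⟨1, A.one_mem, hg⟩
  | succ n ih =>
    intro l hl hAB g hg
    by_cases hgood : ∀ x ∈ l, ∃ p ∈ A, p ∉ B ∧ ∃ q ∈ B, q ∉ A ∧ x = p * q
    · exact .inr (.inr ⟨l, by rintro rfl; simp at hl, hgood, hg⟩)
    push Not at hgood
    obtain ⟨x, hx, hbad⟩ := hgood
    obtain ⟨p, hp, q, hq, rfl⟩ := hAB x hx
    obtain ⟨l₁, l₂, rfl⟩ := List.append_of_mem hx
    have hconj : IsConj g (p * q * (l₂ ++ l₁).prod) := by
      refine hg.trans (isConj_iff.2 ⟨l₁.prod⁻¹, ?_⟩)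
      simp only [List.prod_append, List.prod_cons]
      group
    have hAB' : ∀ x ∈ l₂ ++ l₁, ∃ p ∈ A, ∃ q ∈ B, x = p * q := fun x hx =>
      hAB x (by simp only [List.mem_append, List.mem_cons] at hx ⊢; tauto)
    have hlen : (l₂ ++ l₁).length = n := by
      simp only [List.length_append, List.length_cons] at hl ⊢
      omega
    generalize l₂ ++ l₁ = l at hconj hAB' hlen
    by_cases hpB : p ∈ B
    · rcases List.eq_nil_or_concat l with rfl | ⟨l', y, rfl⟩
      · exact .inr (.inl ⟨p * q, B.mul_mem hpB hq, by simpa using hconj⟩)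
      obtain ⟨p', hp', q', hq', rfl⟩ := hAB' y (by simp)
      refine ih (l' ++ [p' * (q' * (p * q))]) (by simpa using hlen) ?_ g
        (hconj.trans (isConj_iff.2 ⟨(p * q)⁻¹, ?_⟩))
      · intro x hx
        rcases List.mem_append.1 hx with h | h
        · exact hAB' x (by simp [h])
        · exact ⟨p', hp', _, B.mul_mem hq' (B.mul_mem hpB hq), by simpa using h⟩
      · simp [mul_assoc]
    · have hqA : q ∈ A := by
        by_contra h
        exact hbad p hp hpB q hq h rfl
      rcases l with _ | ⟨y, l'⟩
      · exact .inl ⟨p * q, A.mul_mem hp hqA, by simpa using hconj⟩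
      obtain ⟨p', hp', q', hq', rfl⟩ := hAB' y (by simp)
      refine ih ((p * q * p') * q' :: l') (by simpa using hlen) ?_ g
        (by simpa [mul_assoc] using hconj)
      intro x hx
      rcases List.mem_cons.1 hx with h | h
      · exact ⟨_, A.mul_mem (A.mul_mem hp hqA) hp', q', hq', h⟩
      · exact hAB' x (by simp [h])

theorem exists_of_mem_sup_zpowers {Γ : Type*} [Group Γ] {N : Subgroup Γ} [N.Normal] {g : Γ}
    {m : ℕ} (hm : 0 < m) (hg : g ^ m ∈ N) {p : Γ} (hp : p ∈ N ⊔ Subgroup.zpowers g) :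
    ∃ n ∈ N, ∃ r < m, p = n * g ^ r := by
  obtain ⟨n, hn, _, ⟨k, rfl⟩, rfl⟩ := Subgroup.mem_sup_of_normal_left.1 hp
  have hm' : (0 : ℤ) < m := by exact_mod_cast hm
  refine ⟨n * (g ^ m) ^ (k / m), N.mul_mem hn (N.zpow_mem hg _), (k % m).toNat, ?_, ?_⟩
  · have := Int.emod_lt_of_pos k hm'
    omega
  · rw [mul_assoc, ← zpow_natCast g m, ← zpow_mul, ← zpow_natCast g (k % m).toNat,
      Int.toNat_of_nonneg (Int.emod_nonneg _ hm'.ne'), ← zpow_add, Int.mul_ediv_add_emod]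

/-- Up to sign, the matrix has nonnegative entries and is not diagonal. -/
def IsPositive (M : Matrix.SpecialLinearGroup (Fin 2) ℤ) : Prop :=
  ∃ e ∈ ({1, -1} : Finset ℤ), 1 ≤ e * M 0 0 ∧ 1 ≤ e * M 1 1 ∧ 0 ≤ e * M 0 1 ∧ 0 ≤ e * M 1 0 ∧
    1 ≤ e * M 0 1 + e * M 1 0

instance (M : Matrix.SpecialLinearGroup (Fin 2) ℤ) : Decidable (IsPositive M) := by
  unfold IsPositive
  infer_instance

namespace IsPositive

variable {M N : Matrix.SpecialLinearGroup (Fin 2) ℤ}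

theorem mul (hM : IsPositive M) (hN : IsPositive N) : IsPositive (M * N) := by
  obtain ⟨e, he, h₁, h₂, h₃, h₄, h₅⟩ := hM
  obtain ⟨e', he', h₁', h₂', h₃', h₄', h₅'⟩ := hN
  refine ⟨e * e', ?_, ?_⟩
  · simp only [Finset.mem_insert, Finset.mem_singleton] at he he' ⊢
    rcases he with rfl | rfl <;> rcases he' with rfl | rfl <;> simp
  simp only [Matrix.SpecialLinearGroup.coe_mul, Matrix.mul_apply, Fin.sum_univ_two]
  have key : ∀ p q r s : ℤ, e * e' * (p * q + r * s) = (e * p) * (e' * q) + (e * r) * (e' * s) := by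
    intros; ring
  rw [key, key, key, key]
  generalize e * M 0 0 = m₁ at *
  generalize e * M 0 1 = m₂ at *
  generalize e * M 1 0 = m₃ at *
  generalize e * M 1 1 = m₄ at *
  generalize e' * N 0 0 = n₁ at *
  generalize e' * N 0 1 = n₂ at *
  generalize e' * N 1 0 = n₃ at *
  generalize e' * N 1 1 = n₄ at *
  refine ⟨?_, ?_, ?_, ?_, ?_⟩ <;> nlinarith [mul_nonneg h₃ h₄', mul_nonneg h₄ h₃',
    mul_nonneg h₃ h₃', mul_nonneg h₄ h₄', mul_nonneg (sub_nonneg.2 h₁) (sub_nonneg.2 h₁'),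
    mul_nonneg (sub_nonneg.2 h₂) (sub_nonneg.2 h₂'), mul_nonneg (sub_nonneg.2 h₁) h₃',
    mul_nonneg h₃ (sub_nonneg.2 h₂'), mul_nonneg h₄ (sub_nonneg.2 h₁'),
    mul_nonneg (sub_nonneg.2 h₂) h₄']

theorem list_prod {l : List (Matrix.SpecialLinearGroup (Fin 2) ℤ)} (hl : l ≠ [])
    (h : ∀ M ∈ l, IsPositive M) : IsPositive l.prod := by
  induction l with
  | nil => exact absurd rfl hl
  | cons M l ih =>
    rcases eq_or_ne l [] with rfl | hl'
    · simpa using h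
    · rw [List.prod_cons]
      exact (h M (by simp)).mul (ih hl' fun N hN => h N (by simp [hN]))

theorem not_isOfFinOrder (hM : IsPositive M) : ¬ IsOfFinOrder M := by
  rw [isOfFinOrder_iff_pow_eq_one]
  rintro ⟨n, hn, h⟩
  have : IsPositive (M ^ n) := by
    rw [← List.prod_replicate]
    refine list_prod (by simpa using hn.ne') fun N hN => ?_
    rwa [List.eq_of_mem_replicate hN]
  rw [h] at this
  revert this
  decide

end IsPositive

section Inversion

variable {α : Type*} {t : FreeGroup α →* FreeGroup α}

/-- If `t` inverts the generators, then `f ↦ (t f)⁻¹` reverses words. -/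
theorem inv_map_mk_eq_mk_reverse (ht : ∀ i, t (.of i) = (.of i)⁻¹) (L : List (α × Bool)) :
    (t (.mk L))⁻¹ = .mk L.reverse := by
  induction L with
  | nil => simp [← FreeGroup.one_eq_mk]
  | cons p L ih =>
    have hp : (t (.mk [p]))⁻¹ = .mk [p] := by
      rcases p with ⟨i, _ | _⟩
      · have : (FreeGroup.mk [(i, false)]) = (.of i)⁻¹ := by simp [FreeGroup.of, FreeGroup.invRev]
        rw [this, map_inv, ht, inv_inv]
      · have : (FreeGroup.mk [(i, true)]) = .of i := rfl
        rw [this, ht, inv_inv]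
    rw [← List.singleton_append, ← FreeGroup.mul_mk, map_mul, mul_inv_rev, ih, hp,
      FreeGroup.mul_mk]
    simp

theorem toWord_inv_map [DecidableEq α] (ht : ∀ i, t (.of i) = (.of i)⁻¹) (f : FreeGroup α) :
    (t f)⁻¹.toWord = f.toWord.reverse := by
  conv_lhs => rw [← FreeGroup.mk_toWord (x := f), inv_map_mk_eq_mk_reverse ht, FreeGroup.toWord_mk]
  apply FreeGroup.IsReduced.reduce_eq
  have h := FreeGroup.isReduced_toWord (x := f)
  rw [FreeGroup.IsReduced] at h ⊢
  rw [List.isChain_reverse]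
  exact h.imp fun p q h h' => (h h'.symm).symm

theorem eq_one_of_map_eq_self [DecidableEq α] (ht : ∀ i, t (.of i) = (.of i)⁻¹) {f : FreeGroup α}
    (h : t f = f) : f = 1 := by
  have h' := toWord_inv_map ht f
  rw [h, FreeGroup.toWord_inv, FreeGroup.invRev, List.reverse_inj] at h'
  rw [← FreeGroup.toWord_eq_nil_iff]
  rcases hL : f.toWord with _ | ⟨p, L⟩
  · rfl
  · rw [hL] at h'
    rcases p with ⟨i, _ | _⟩ <;> simp at h'

theorem exists_eq_mul_of_mul_map_eq_one [DecidableEq α]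
    (ht : ∀ i, t (.of i) = (.of i)⁻¹) {f : FreeGroup α}
    (h : f * t f = 1) :
    ∃ w m, (m = 1 ∨ ∃ i, m = .of i ∨ m = (.of i)⁻¹) ∧ f = w * m * (t w)⁻¹ := by
  have hpal : f.toWord.Palindrome := by
    apply List.Palindrome.of_reverse_eq
    rw [← toWord_inv_map ht, ← eq_inv_of_mul_eq_one_left h]
  rw [← FreeGroup.mk_toWord (x := f)]
  generalize f.toWord = L at hpal
  induction hpal with
  | nil => exact ⟨1, 1, .inl rfl, by simp [← FreeGroup.one_eq_mk]⟩
  | singleton p =>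
    rcases p with ⟨i, _ | _⟩
    · exact ⟨1, (.of i)⁻¹, .inr ⟨i, .inr rfl⟩, by simp [FreeGroup.of, FreeGroup.invRev]⟩
    · exact ⟨1, .of i, .inr ⟨i, .inl rfl⟩, by simp [FreeGroup.of]⟩
  | @cons_concat p L _ ih =>
    obtain ⟨w, m, hm, hw⟩ := ih
    refine ⟨.mk [p] * w, m, hm, ?_⟩
    rw [map_mul, mul_inv_rev, inv_map_mk_eq_mk_reverse ht, List.reverse_singleton,
      ← List.singleton_append, ← FreeGroup.mul_mk, ← FreeGroup.mul_mk, hw]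
    group

end Inversion

/-- The property of being conjugate to a power of `xbar` or of `ybar`. -/
def IsConjToPower (g : G) : Prop :=
  ∃ n : ℤ, IsConj (xbar ^ n) g ∨ IsConj (ybar ^ n) g

theorem IsConjToPower.of_isConj {g g' : G} (h : IsConj g g') (hg : IsConjToPower g) :
    IsConjToPower g' := by
  obtain ⟨n, hn | hn⟩ := hg
  exacts [⟨n, .inl (hn.trans h)⟩, ⟨n, .inr (hn.trans h)⟩]

theorem IsConjToPower.of_inv {g : G} (hg : IsConjToPower g⁻¹) : IsConjToPower g := by
  have key {p g : G} (h : IsConj p g⁻¹) : IsConj p⁻¹ g := by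
    obtain ⟨k, hk⟩ := isConj_iff.1 h
    refine isConj_iff.2 ⟨k, ?_⟩
    rw [← inv_inj, ← hk]
    group
  obtain ⟨n, hn | hn⟩ := hg
  · exact ⟨-n, .inl (by rw [zpow_neg]; exact key hn)⟩
  · exact ⟨-n, .inr (by rw [zpow_neg]; exact key hn)⟩

theorem eq_one_of_isOfFinOrder_freeEmb {f : F2} (h : IsOfFinOrder (freeEmb f)) : f = 1 := by
  rwa [freeEmb_injective.isOfFinOrder_iff, isOfFinOrder_iff_eq_one] at h

theorem freeAction_xbar_sq_of (i : Fin 2) : freeAction (xbar ^ 2) (.of i) = (.of i)⁻¹ := by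
  rw [pow_two, map_mul, MulAut.mul_apply]
  fin_cases i
  · simp [freeAction_xbar_zero, freeAction_xbar_one]
  · simp [freeAction_xbar_zero, freeAction_xbar_one]

theorem exists_isConj_freeEmb_mul_xbar_sq {f : F2} (h : IsOfFinOrder (freeEmb f * xbar ^ 2)) :
    ∃ w m, (m = 1 ∨ ∃ i, m = .of i ∨ m = (.of i)⁻¹) ∧
      freeEmb f * xbar ^ 2 = freeEmb w * (freeEmb m * xbar ^ 2) * (freeEmb w)⁻¹ := by
  have hsq : (freeEmb f * xbar ^ 2) ^ 2 = freeEmb (f * freeAction (xbar ^ 2) f) := by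
    rw [map_mul, freeEmb_freeAction]
    have h4 := xbar_pow_four
    calc _ = freeEmb f * (xbar ^ 2 * freeEmb f * (xbar ^ 2)⁻¹) * xbar ^ 4 := by
          rw [pow_two (_ * _)]; group
      _ = _ := by rw [h4, mul_one]
  have h1 := eq_one_of_isOfFinOrder_freeEmb (hsq ▸ h.pow)
  obtain ⟨w, m, hm, hf⟩ := exists_eq_mul_of_mul_map_eq_one
    (t := (freeAction (xbar ^ 2)).toMonoidHom) freeAction_xbar_sq_of h1
  refine ⟨w, m, hm, ?_⟩
  rw [hf, map_mul, map_mul, map_inv]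
  have := freeEmb_freeAction (xbar ^ 2) w
  simp only [MulEquiv.toMonoidHom_eq_coe, MonoidHom.coe_coe]
  rw [this]
  group

theorem freeEmb_zero' : freeEmb (.of 0) = π a * (π c)⁻¹ := by
  rw [freeEmb_zero, map_mul, map_inv]

theorem freeEmb_one_eq : freeEmb (.of 1) = xbar * freeEmb (.of 0) * xbar⁻¹ := by
  rw [← freeEmb_freeAction, freeAction_xbar_zero]

theorem isConjToPower_freeEmb_mul_xbar_sq {f : F2} (h : IsOfFinOrder (freeEmb f * xbar ^ 2)) :
    IsConjToPower (freeEmb f * xbar ^ 2) := by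
  obtain ⟨w, m, hm, hf⟩ := exists_isConj_freeEmb_mul_xbar_sq h
  suffices H : IsConj (xbar ^ 2) (freeEmb m * xbar ^ 2) from
    ⟨2, .inl (H.trans (isConj_iff.2 ⟨freeEmb w, hf.symm⟩))⟩
  have hc := xbar_sq_mul_c
  have ha := xbar_sq_mul_a
  have h₀ : IsConj (xbar ^ 2) (freeEmb (.of 0) * xbar ^ 2) := by
    refine isConj_iff.2 ⟨π a, ?_⟩
    rw [freeEmb_zero', mul_inv_eq_iff_eq_mul, mul_assoc, ha]
    group
  have h₀' : IsConj (xbar ^ 2) ((freeEmb (.of 0))⁻¹ * xbar ^ 2) := by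
    refine isConj_iff.2 ⟨π c, ?_⟩
    rw [freeEmb_zero', mul_inv_eq_iff_eq_mul, mul_assoc, hc]
    group
  have hx {g : G} : IsConj (g * xbar ^ 2) (xbar * g * xbar⁻¹ * xbar ^ 2) :=
    isConj_iff.2 ⟨xbar, by group⟩
  rcases hm with rfl | ⟨i, rfl | rfl⟩
  · rw [map_one, one_mul]
  · fin_cases i
    · exact h₀
    · have := h₀.trans hx
      rwa [← freeEmb_one_eq] at this
  · fin_cases i
    · simpa using h₀'
    · have := h₀'.trans hx
      rw [← map_inv, ← freeEmb_freeAction, map_inv, freeAction_xbar_zero] at this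
      exact this

/-- The free subgroup maps into the normal Klein four-group. -/
theorem toPerm_freeEmb_mem (f : F2) :
    toPerm (freeEmb f) ∈ ({1, Equiv.swap 0 1 * Equiv.swap 2 3, Equiv.swap 0 2 * Equiv.swap 1 3,
      Equiv.swap 0 3 * Equiv.swap 1 2} : Finset (Equiv.Perm (Fin 4))) := by
  induction f using FreeGroup.induction_on with
  | C1 => simp
  | of i =>
    fin_cases i
    · simp [freeEmb, toPerm]
    · simp [freeEmb, toPerm]
      decide
  | inv_of i h =>
    rw [map_inv, map_inv]
    generalize toPerm (freeEmb (.of i)) = p at h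
    revert p
    decide
  | mul f g hf hg =>
    rw [map_mul, map_mul]
    generalize toPerm (freeEmb f) = p at hf
    generalize toPerm (freeEmb g) = q at hg
    revert p q
    decide

theorem toPerm_xbar : toPerm xbar = Equiv.swap 1 2 * Equiv.swap 0 1 * Equiv.swap 2 3 := by
  simp [toPerm, xbar]

theorem isConjToPower_freeEmb_mul_xbar {f : F2} (h : IsOfFinOrder (freeEmb f * xbar)) :
    IsConjToPower (freeEmb f * xbar) := by
  have hsq (f : F2) : (freeEmb f * xbar) ^ 2 = freeEmb (f * freeAction xbar f) * xbar ^ 2 := by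
    rw [map_mul, freeEmb_freeAction, pow_two, pow_two]
    group
  obtain ⟨w, m, hm, hf⟩ := exists_isConj_freeEmb_mul_xbar_sq (hsq f ▸ h.pow)
  obtain ⟨f', hf'⟩ : ∃ f', f' = w⁻¹ * f * freeAction xbar w := ⟨_, rfl⟩
  have hconj : freeEmb f' * xbar = (freeEmb w)⁻¹ * (freeEmb f * xbar) * freeEmb w := by
    rw [hf', map_mul, map_mul, freeEmb_freeAction, map_inv]
    group
  have hsq' : (freeEmb f' * xbar) ^ 2 = freeEmb m * xbar ^ 2 := by
    calc _ = (freeEmb w)⁻¹ * (freeEmb f * xbar) ^ 2 * freeEmb w := by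
          rw [hconj, pow_two, pow_two]; group
      _ = _ := by rw [hsq, hf]; group
  have hm1 : m = 1 := by
    rcases hm with hm | hm
    · exact hm
    exfalso
    have hp := congrArg toPerm hsq'
    have hmem := toPerm_freeEmb_mem f'
    have hmm : toPerm (freeEmb m) ∈ ({Equiv.swap 0 1 * Equiv.swap 2 3,
        Equiv.swap 0 2 * Equiv.swap 1 3} : Finset (Equiv.Perm (Fin 4))) := by
      obtain ⟨i, rfl | rfl⟩ := hm <;> fin_cases i <;> simp [freeEmb, toPerm] <;> decide
    rw [map_pow, map_mul, map_mul, map_pow, toPerm_xbar] at hp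
    generalize toPerm (freeEmb f') = p at hp hmem
    generalize toPerm (freeEmb m) = q at hp hmm
    clear * - hp hmem hmm
    revert p q
    decide
  rw [hm1, map_one, one_mul] at hsq'
  have hf1 : f' = 1 := by
    apply eq_one_of_map_eq_self (t := (freeAction (xbar ^ 2)).toMonoidHom) freeAction_xbar_sq_of
    apply freeEmb_injective
    refine (freeEmb_freeAction _ _).trans ?_
    rw [← hsq', mul_inv_eq_iff_eq_mul]
    have hcomm : (freeEmb f' * xbar) * xbar ^ 2 = xbar ^ 2 * (freeEmb f' * xbar) := by
      rw [← hsq', ← pow_succ, ← pow_succ']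
    rw [hsq', ← mul_left_inj xbar, mul_assoc, ← hcomm]
    group
  rw [hf1, map_one, one_mul] at hconj
  exact ⟨1, .inl (isConj_iff.2 ⟨freeEmb w, by rw [zpow_one]; nth_rewrite 1 [hconj]; group⟩)⟩

theorem conj_xbar_sq_ybar : xbar ^ 2 * ybar = freeEmb (.of 1) * ybar * xbar ^ 2 := by
  rw [freeEmb_one_eq, freeEmb_zero', ybar_eq]
  calc _ = xbar * (xbar ^ 2 * π c) := by group
    _ = _ := by rw [xbar_sq_mul_c]; group

theorem freeAction_ybar_zero : freeAction ybar (.of 0) = .of 1 := by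
  rw [ybar_eq, map_mul, MulAut.mul_apply]
  have : freeAction (π c) (.of 0) = .of 0 := by simp [freeAction]; decide
  rw [this, freeAction_xbar_zero]

theorem freeAction_ybar_one : freeAction ybar (.of 1) = (.of 1)⁻¹ * (.of 0)⁻¹ := by
  rw [ybar_eq, map_mul, MulAut.mul_apply]
  have : freeAction (π c) (.of 1) = (.of 0)⁻¹ * .of 1 := by simp [freeAction]; decide
  rw [this, map_mul, map_inv, freeAction_xbar_zero, freeAction_xbar_one]

/-- An element of order three in `SL₂(ℤ)`. -/
def slT : Matrix.SpecialLinearGroup (Fin 2) ℤ := ⟨!![0, 1; -1, -1], by decide⟩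

/-- The conjugate of `slT` by `slX`. -/
def slS : Matrix.SpecialLinearGroup (Fin 2) ℤ := slX * slT * slX⁻¹

theorem isPositive_slS_pow_mul_slT_pow :
    ∀ i ∈ ({1, 2} : Finset ℕ), ∀ j ∈ ({1, 2} : Finset ℕ), IsPositive (slS ^ i * slT ^ j) := by
  decide

theorem isConj_ybar_freeEmb_zero_mul_ybar : IsConj ybar (freeEmb (.of 0) * ybar) := by
  refine isConj_iff.2 ⟨ybar⁻¹ * xbar ^ 2, ?_⟩
  have h : freeEmb (.of 1) = ybar * freeEmb (.of 0) * ybar⁻¹ := by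
    rw [← freeEmb_freeAction, freeAction_ybar_zero]
  calc _ = ybar⁻¹ * (xbar ^ 2 * ybar) * (xbar ^ 2)⁻¹ * ybar := by group
    _ = _ := by rw [conj_xbar_sq_ybar, h]; group

theorem exists_zpowers_eq {Γ : Type*} [Group Γ] {g : Γ} {m : ℕ} (hm : 0 < m) (hg : g ^ m = 1)
    {p : Γ} (hp : p ∈ Subgroup.zpowers g) : ∃ r < m, p = g ^ r := by
  rw [← bot_sup_eq (Subgroup.zpowers g)] at hp
  obtain ⟨n, hn, r, hr, h⟩ := exists_of_mem_sup_zpowers hm (by rw [hg]; exact Subgroup.one_mem _) hp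
  rw [Subgroup.mem_bot] at hn
  exact ⟨r, hr, by rw [h, hn, one_mul]⟩

theorem isConjToPower_freeEmb_mul_ybar {f : F2} (h : IsOfFinOrder (freeEmb f * ybar)) :
    IsConjToPower (freeEmb f * ybar) := by
  let ψ : F2 →* Matrix.SpecialLinearGroup (Fin 2) ℤ :=
    FreeGroup.lift ![slT * slS⁻¹, slS * slT * slS⁻¹ * slS⁻¹]
  have hψ₀ : ψ (.of 0) = slT * slS⁻¹ := by simp [ψ]
  have hψ₁ : ψ (.of 1) = slS * slT * slS⁻¹ * slS⁻¹ := by simp [ψ]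
  let θ : F2 →* G × Matrix.SpecialLinearGroup (Fin 2) ℤ := freeEmb.prod ψ
  let s : G × Matrix.SpecialLinearGroup (Fin 2) ℤ := (ybar, slS)
  have hs3 : s ^ 3 = 1 := Prod.ext ybar_pow_three (by decide : slS ^ 3 = 1)
  let t : G × Matrix.SpecialLinearGroup (Fin 2) ℤ := (freeEmb (.of 0) * ybar, slT)
  have ht3 : t ^ 3 = 1 := by
    refine Prod.ext ?_ (by decide : slT ^ 3 = 1)
    obtain ⟨k, hk⟩ := isConj_iff.1 isConj_ybar_freeEmb_zero_mul_ybar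
    change (freeEmb (.of 0) * ybar) ^ 3 = 1
    rw [← hk, conj_pow, ybar_pow_three]
    group
  have hθ₀ : θ (.of 0) = t * s⁻¹ := by
    refine Prod.ext ?_ hψ₀
    change freeEmb (.of 0) = freeEmb (.of 0) * ybar * ybar⁻¹
    group
  have hθ₁ : θ (.of 1) = s * θ (.of 0) * s⁻¹ := by
    refine Prod.ext ?_ ?_
    · change freeEmb (.of 1) = ybar * freeEmb (.of 0) * ybar⁻¹
      rw [← freeEmb_freeAction, freeAction_ybar_zero]
    · change ψ (.of 1) = slS * ψ (.of 0) * slS⁻¹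
      rw [hψ₀, hψ₁, mul_assoc slS slT]
  have hθ (f : F2) : θ (freeAction ybar f) = s * θ f * s⁻¹ := by
    refine Prod.ext (freeEmb_freeAction _ _) ?_
    have : ψ.comp (freeAction ybar).toMonoidHom = (MulAut.conj slS).toMonoidHom.comp ψ := by
      ext1 i
      fin_cases i
      · simp [freeAction_ybar_zero, hψ₀, hψ₁, mul_assoc]
      · simp only [Fin.mk_one, MonoidHom.comp_apply, MulEquiv.toMonoidHom_eq_coe,
          MonoidHom.coe_coe, MulAut.conj_apply, freeAction_ybar_one, map_mul, map_inv, hψ₀, hψ₁]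
        decide
    exact DFunLike.congr_fun this f
  let A := Subgroup.zpowers s
  let B := Subgroup.zpowers t
  have hsA : s ∈ A ⊔ B := Subgroup.mem_sup_left (Subgroup.mem_zpowers s)
  have htB : t ∈ A ⊔ B := Subgroup.mem_sup_right (Subgroup.mem_zpowers t)
  have hrange : θ.range ≤ A ⊔ B := by
    have h₀ : θ (.of 0) ∈ A ⊔ B := hθ₀ ▸ mul_mem htB (inv_mem hsA)
    have h₁ : θ (.of 1) ∈ A ⊔ B := hθ₁ ▸ mul_mem (mul_mem hsA h₀) (inv_mem hsA)
    rintro _ ⟨f, rfl⟩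
    induction f using FreeGroup.induction_on with
    | C1 => rw [map_one]; exact one_mem _
    | of i => fin_cases i; exacts [h₀, h₁]
    | inv_of i h => rw [map_inv]; exact inv_mem h
    | mul f g hf hg => rw [map_mul]; exact mul_mem hf hg
  have he : θ f * s ∈ A ⊔ B := mul_mem (hrange ⟨f, rfl⟩) hsA
  have hcube : (θ f * s) ^ 3 =
      θ (f * freeAction ybar f * freeAction ybar (freeAction ybar f)) := by
    rw [map_mul, map_mul, hθ, hθ, hθ]
    calc _ = θ f * (s * θ f * s⁻¹) * (s * (s * θ f * s⁻¹) * s⁻¹) * s ^ 3 := by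
          simp only [pow_succ, pow_zero, one_mul]; group
      _ = _ := by rw [hs3, mul_one]
  have hcube1 : (θ f * s) ^ 3 = 1 := by
    rw [hcube]
    have := congrArg Prod.fst hcube
    change (freeEmb f * ybar) ^ 3 = freeEmb _ at this
    have hfin := h.pow (n := 3)
    rw [this] at hfin
    rw [eq_one_of_isOfFinOrder_freeEmb hfin, map_one]
  have hfst {p} (hp : IsConj (θ f * s) p) : IsConj p.1 (freeEmb f * ybar) :=
    ((MonoidHom.fst _ _).map_isConj hp).symm
  rcases exists_isConj_of_mem_sup A B he with ⟨p, hp, hc⟩ | ⟨q, hq, hc⟩ | ⟨l, hl, hl', hc⟩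
  · obtain ⟨k, rfl⟩ := hp
    exact ⟨k, .inr (hfst hc)⟩
  · obtain ⟨k, rfl⟩ := hq
    refine ⟨k, .inr (IsConj.trans ?_ (hfst hc))⟩
    obtain ⟨g, hg⟩ := isConj_iff.1 isConj_ybar_freeEmb_zero_mul_ybar
    refine isConj_iff.2 ⟨g, ?_⟩
    rw [← conj_zpow, hg]
    rfl
  · exfalso
    have hfin := hc.isOfFinOrder (isOfFinOrder_iff_pow_eq_one.2 ⟨3, by norm_num, hcube1⟩)
    have := (MonoidHom.snd _ _).isOfFinOrder hfin
    rw [map_list_prod] at this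
    refine IsPositive.not_isOfFinOrder (IsPositive.list_prod (by simpa using hl) ?_) this
    simp only [List.mem_map]
    rintro _ ⟨_, hx, rfl⟩
    obtain ⟨p, hp, hpB, q, hq, hqA, rfl⟩ := hl' _ hx
    obtain ⟨i, hi, rfl⟩ := exists_zpowers_eq (by norm_num) hs3 hp
    obtain ⟨j, hj, rfl⟩ := exists_zpowers_eq (by norm_num) ht3 hq
    have hi0 : i ≠ 0 := by rintro rfl; exact hpB (by simp)
    have hj0 : j ≠ 0 := by rintro rfl; exact hqA (by simp)
    exact isPositive_slS_pow_mul_slT_pow i (by simp; omega) j (by simp; omega)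

theorem toSL_freeEmb (f : F2) : toSL (freeEmb f) = 1 := by
  have : toSL.comp freeEmb = 1 := by
    ext1 i
    fin_cases i <;> simp [toSL, freeEmb]
  exact DFunLike.congr_fun this f

/-- An element of order six modulo the free subgroup. -/
noncomputable def wbar : G := xbar ^ 2 * ybar

theorem exists_mul_eq (f f' : F2) (g g' : G) :
    ∃ m, freeEmb f * g * (freeEmb f' * g') = freeEmb m * (g * g') :=
  ⟨f * freeAction g f', by rw [map_mul, freeEmb_freeAction]; group⟩

theorem exists_pow_eq (f : F2) (g : G) (n : ℕ) :
    ∃ m, (freeEmb f * g) ^ n = freeEmb m * g ^ n := by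
  induction n with
  | zero => exact ⟨1, by simp⟩
  | succ n ih =>
    obtain ⟨m, hm⟩ := ih
    rw [pow_succ, hm, pow_succ]
    exact exists_mul_eq ..

theorem wbar_sq : ∃ f, wbar ^ 2 = freeEmb f * ybar ^ 2 := by
  refine ⟨freeAction (xbar ^ 2) (.of 1)⁻¹, ?_⟩
  have h : ybar * xbar ^ 2 = (freeEmb (.of 1))⁻¹ * (xbar ^ 2 * ybar) := by
    rw [conj_xbar_sq_ybar]; group
  rw [freeEmb_freeAction, map_inv]
  calc wbar ^ 2 = xbar ^ 2 * (ybar * xbar ^ 2) * ybar := by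
        rw [wbar, pow_two (_ * _)]; simp only [mul_assoc]
    _ = xbar ^ 2 * (freeEmb (.of 1))⁻¹ * (xbar ^ 2)⁻¹ * xbar ^ 4 * ybar ^ 2 := by
      rw [h, pow_two ybar]; group
    _ = _ := by rw [xbar_pow_four, mul_one]

theorem wbar_pow_three : ∃ f, wbar ^ 3 = freeEmb f * xbar ^ 2 := by
  obtain ⟨f, hf⟩ := wbar_sq
  obtain ⟨m, hm⟩ := exists_mul_eq 1 f wbar (ybar ^ 2)
  refine ⟨m, ?_⟩
  rw [map_one, one_mul] at hm
  rw [pow_succ', hf, hm, wbar, mul_assoc, ← pow_succ', ybar_pow_three, mul_one]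

theorem wbar_pow_four : ∃ f, wbar ^ 4 = freeEmb f * ybar := by
  obtain ⟨f, hf⟩ := wbar_pow_three
  refine ⟨f, ?_⟩
  calc wbar ^ 4 = freeEmb f * (xbar ^ 4 * ybar) := by rw [pow_succ, hf, wbar]; group
    _ = _ := by rw [xbar_pow_four, one_mul]

theorem wbar_pow_six : wbar ^ 6 ∈ freeEmb.range := by
  obtain ⟨f, hf⟩ := wbar_pow_three
  obtain ⟨m, hm⟩ := exists_pow_eq f (xbar ^ 2) 2
  refine ⟨m, ?_⟩
  rw [show 6 = 3 * 2 from rfl, pow_mul, hf, hm, ← pow_mul, xbar_pow_four, mul_one]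

set_option maxRecDepth 4000 in
theorem not_isOfFinOrder_freeEmb_mul_wbar (f : F2) : ¬ IsOfFinOrder (freeEmb f * wbar) := by
  intro h
  obtain ⟨f₁, h₁⟩ := exists_pow_eq f wbar 3
  obtain ⟨f₃, h₃⟩ := wbar_pow_three
  rw [h₃, ← mul_assoc, ← map_mul] at h₁
  obtain ⟨w, m, hm, hf⟩ := exists_isConj_freeEmb_mul_xbar_sq (h₁ ▸ h.pow)
  have hp : toPerm (freeEmb m * xbar ^ 2) = 1 := by
    have hc : toPerm (π c) = Equiv.swap 2 3 := by simp [toPerm]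
    have hmem := toPerm_freeEmb_mem f
    have h3 : toPerm (freeEmb f * wbar) ^ 3 = 1 := by
      rw [map_mul, wbar, ybar_eq, map_mul, map_mul, map_pow, toPerm_xbar, hc]
      generalize toPerm (freeEmb f) = p at hmem ⊢
      clear * - hmem
      revert p
      decide
    rwa [← map_pow, h₁, hf, map_mul, map_mul, map_inv, mul_inv_eq_one, mul_eq_left] at h3
  have hmm : toPerm (freeEmb m) ∈ ({1, Equiv.swap 0 1 * Equiv.swap 2 3,
      Equiv.swap 0 2 * Equiv.swap 1 3} : Finset (Equiv.Perm (Fin 4))) := by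
    rcases hm with rfl | ⟨i, rfl | rfl⟩
    · simp
    all_goals fin_cases i <;> simp [freeEmb, toPerm] <;> decide
  rw [map_mul, map_pow, toPerm_xbar] at hp
  generalize toPerm (freeEmb m) = q at hp hmm
  clear * - hp hmm
  revert q
  decide

theorem exists_inv_eq (f : F2) (g : G) : ∃ f', (freeEmb f * g)⁻¹ = freeEmb f' * g⁻¹ :=
  ⟨freeAction g⁻¹ f⁻¹, by rw [freeEmb_freeAction, map_inv]; group⟩

theorem sup_zpowers_eq_top :
    (freeEmb.range ⊔ Subgroup.zpowers xbar) ⊔ (freeEmb.range ⊔ Subgroup.zpowers wbar) = ⊤ := by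
  set H := (freeEmb.range ⊔ Subgroup.zpowers xbar) ⊔ (freeEmb.range ⊔ Subgroup.zpowers wbar)
  have hx : xbar ∈ H := Subgroup.mem_sup_left (Subgroup.mem_sup_right (Subgroup.mem_zpowers _))
  have hw : wbar ∈ H := Subgroup.mem_sup_right (Subgroup.mem_sup_right (Subgroup.mem_zpowers _))
  have hu : π a * (π c)⁻¹ ∈ H :=
    Subgroup.mem_sup_left (Subgroup.mem_sup_left ⟨.of 0, freeEmb_zero'⟩)
  have hc : π c ∈ H := by
    have := H.mul_mem (H.inv_mem (H.pow_mem hx 3)) hw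
    rw [wbar, ybar_eq] at this
    convert this using 1
    group
  have ha : π a ∈ H := by simpa using H.mul_mem hu hc
  have hb : π b ∈ H := by
    have := H.mul_mem hx (H.inv_mem (H.mul_mem ha hc))
    rw [xbar, map_mul, map_mul] at this
    convert this using 1
    group
  rw [eq_top_iff, ← closure_generators, Subgroup.closure_le]
  rintro _ (rfl | rfl | rfl) <;> assumption

theorem isConjToPower_of_isOfFinOrder {g : G} (hg : IsOfFinOrder g) : IsConjToPower g := by
  have hx4 : xbar ^ 4 ∈ freeEmb.range := by rw [xbar_pow_four]; exact one_mem _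
  have hone {f : F2} (h : IsOfFinOrder (freeEmb f)) : IsConjToPower (freeEmb f) :=
    ⟨0, .inl (by rw [eq_one_of_isOfFinOrder_freeEmb h]; simp)⟩
  have hinv {f : F2} {g : G} (H : ∀ f, IsOfFinOrder (freeEmb f * g⁻¹) →
      IsConjToPower (freeEmb f * g⁻¹)) (h : IsOfFinOrder (freeEmb f * g)) :
      IsConjToPower (freeEmb f * g) := by
    obtain ⟨f', hf'⟩ := exists_inv_eq f g
    apply IsConjToPower.of_inv
    rw [← isOfFinOrder_inv_iff, hf'] at h
    rw [hf']
    exact H f' h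
  obtain ⟨f₂, h₂⟩ := wbar_sq
  obtain ⟨f₃, h₃⟩ := wbar_pow_three
  obtain ⟨f₄, h₄⟩ := wbar_pow_four
  obtain ⟨f₆, h₆⟩ := wbar_pow_six
  rcases exists_isConj_of_mem_sup _ _ (sup_zpowers_eq_top ▸ Subgroup.mem_top g) with
    ⟨p, hp, hc⟩ | ⟨q, hq, hc⟩ | ⟨l, hl, hl', hc⟩
  · refine IsConjToPower.of_isConj hc.symm ?_
    replace hg := hc.isOfFinOrder hg
    obtain ⟨_, ⟨f, rfl⟩, r, hr, rfl⟩ := exists_of_mem_sup_zpowers (by norm_num) hx4 hp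
    interval_cases r
    · rw [pow_zero, mul_one] at hg ⊢
      exact hone hg
    · rw [pow_one] at hg ⊢
      exact isConjToPower_freeEmb_mul_xbar hg
    · exact isConjToPower_freeEmb_mul_xbar_sq hg
    · have : xbar ^ 3 = xbar⁻¹ := by
        rw [eq_inv_iff_mul_eq_one, ← pow_succ, xbar_pow_four]
      rw [this] at hg ⊢
      refine hinv (fun f h => ?_) hg
      rw [inv_inv] at h ⊢
      exact isConjToPower_freeEmb_mul_xbar h
  · refine IsConjToPower.of_isConj hc.symm ?_
    replace hg := hc.isOfFinOrder hg
    obtain ⟨_, ⟨f, rfl⟩, r, hr, rfl⟩ := exists_of_mem_sup_zpowers (by norm_num) wbar_pow_six hq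
    interval_cases r
    · rw [pow_zero, mul_one] at hg ⊢
      exact hone hg
    · rw [pow_one] at hg ⊢
      exact absurd hg (not_isOfFinOrder_freeEmb_mul_wbar f)
    · have : ybar ^ 2 = ybar⁻¹ := by
        rw [eq_inv_iff_mul_eq_one, ← pow_succ, ybar_pow_three]
      rw [h₂, this, ← mul_assoc, ← map_mul] at hg ⊢
      refine hinv (fun f h => ?_) hg
      rw [inv_inv] at h ⊢
      exact isConjToPower_freeEmb_mul_ybar h
    · rw [h₃, ← mul_assoc, ← map_mul] at hg ⊢
      exact isConjToPower_freeEmb_mul_xbar_sq hg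
    · rw [h₄, ← mul_assoc, ← map_mul] at hg ⊢
      exact isConjToPower_freeEmb_mul_ybar hg
    · have : wbar ^ 5 = freeEmb f₆ * wbar⁻¹ := by
        rw [h₆]; group
      rw [this, ← mul_assoc, ← map_mul] at hg ⊢
      refine hinv (fun f h => ?_) hg
      rw [inv_inv] at h
      exact absurd h (not_isOfFinOrder_freeEmb_mul_wbar f)
  · exfalso
    have hfin := toSL.isOfFinOrder (hc.isOfFinOrder hg)
    rw [map_list_prod] at hfin
    refine IsPositive.not_isOfFinOrder (IsPositive.list_prod (by simpa using hl) ?_) hfin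
    simp only [List.mem_map]
    rintro _ ⟨_, hx, rfl⟩
    obtain ⟨p, hp, hpB, q, hq, hqA, rfl⟩ := hl' _ hx
    obtain ⟨_, ⟨f, rfl⟩, i, hi, rfl⟩ := exists_of_mem_sup_zpowers (by norm_num) hx4 hp
    obtain ⟨_, ⟨f', rfl⟩, j, hj, rfl⟩ := exists_of_mem_sup_zpowers (by norm_num) wbar_pow_six hq
    have hN {A : Subgroup G} (f : F2) : freeEmb f ∈ freeEmb.range ⊔ A :=
      Subgroup.mem_sup_left ⟨f, rfl⟩
    have hx2 : xbar ^ 2 ∈ freeEmb.range ⊔ Subgroup.zpowers wbar := by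
      rw [eq_inv_mul_of_mul_eq h₃.symm]
      exact mul_mem (inv_mem (hN _)) (Subgroup.mem_sup_right (Subgroup.npow_mem_zpowers _ _))
    have hw3 : wbar ^ 3 ∈ freeEmb.range ⊔ Subgroup.zpowers xbar := by
      rw [h₃]
      exact mul_mem (hN _) (Subgroup.mem_sup_right (Subgroup.npow_mem_zpowers _ _))
    have hi' : i ∈ ({1, 3} : Finset ℕ) := by
      interval_cases i
      · exact absurd (mul_mem (hN f) (by simp)) hpB
      · simp
      · exact absurd (mul_mem (hN f) hx2) hpB
      · simp
    have hj' : j ∈ ({1, 2, 4, 5} : Finset ℕ) := by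
      interval_cases j
      · exact absurd (mul_mem (hN f') (by simp)) hqA
      · simp
      · simp
      · exact absurd (mul_mem (hN f') hw3) hqA
      · simp
      · simp
    have hX : toSL xbar = slX := by
      rw [xbar, map_mul, map_mul, map_mul, map_mul, toSL, liftG_b, liftG_a, liftG_c]
      decide
    have hW : toSL wbar = slX ^ 2 * (slX * slA) := by
      rw [wbar, ybar_eq, map_mul, map_mul, map_pow, hX]
      rw [toSL, liftG_c]
    rw [map_mul, map_mul, map_mul, map_pow, map_pow, toSL_freeEmb, toSL_freeEmb, one_mul, one_mul,
      hX, hW]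
    have key : ∀ i ∈ ({1, 3} : Finset ℕ), ∀ j ∈ ({1, 2, 4, 5} : Finset ℕ),
        IsPositive (slX ^ i * (slX ^ 2 * (slX * slA)) ^ j) := by
      decide
    exact key i hi' j hj'

/-- In the central quotient `G = B₄/⟨z⟩`, the images `x̄` of `x = bac` and `ȳ` of
`y = bac²` satisfy `x̄⁴ = ȳ³ = 1`, and every element of finite order in `G` is
conjugate to a power of `x̄` or to a power of `ȳ`. -/
theorem torsion_in_G :
    xbar ^ 4 = 1 ∧ ybar ^ 3 = 1 ∧
    ∀ g : G, IsOfFinOrder g →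
      ∃ n : ℤ, IsConj (xbar ^ n) g ∨ IsConj (ybar ^ n) g :=
  ⟨xbar_pow_four, ybar_pow_three, fun _ hg => isConjToPower_of_isOfFinOrder hg⟩
end
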